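/- Let p be a prime with p \equiv 1 or 9 mod 20, written as p = u^2 + 5v^2 with integers u, v, signs chosen so that u + v\sqrt{-5} is a p-adic unit (for a fixed square root of -5 in Z_p). Then \sum_{k=0}^{p-1} \frac{(4k)!}{k!^4} (-1/1024)^k \equiv (u + v\sqrt{-5})^2 mod p^3 in Z_p. -/

import Mathlib

open Finset

/-- A formal point of the Jacobi quartic `Y² = 1 + A g² + B g⁴` reducing to the origin. -/
structure JPair {R : Type*} [CommRing R] (A B : R) where
  g : PowerSeries R
  Y : PowerSeries R
  g0 : PowerSeries.constantCoeff g = 0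
  Y0 : PowerSeries.constantCoeff Y = 1
  eqn : Y ^ 2 = 1 + PowerSeries.C A * g ^ 2 + PowerSeries.C B * g ^ 4

namespace JPair

open PowerSeries

section basic

variable {R : Type*} [CommRing R] {A B : R}

theorem exists_inv (P Q : JPair A B) :
    ∃ E : PowerSeries R, (1 - C B * P.g ^ 2 * Q.g ^ 2) * E = 1 ∧ constantCoeff E = 1 := by
  have h : constantCoeff (1 - C B * P.g ^ 2 * Q.g ^ 2) = ((1 : Rˣ) : R) := by
    simp [P.g0]
  have h2 := PowerSeries.mul_invOfUnit _ 1 h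
  refine ⟨_, h2, ?_⟩
  have h3 := congrArg constantCoeff h2
  rwa [map_mul, h, Units.val_one, one_mul, map_one] at h3

theorem exists_add (P Q : JPair A B) : ∃ S : JPair A B,
    S.g * (1 - C B * P.g ^ 2 * Q.g ^ 2) = P.g * Q.Y + Q.g * P.Y ∧
    S.Y * (1 - C B * P.g ^ 2 * Q.g ^ 2) ^ 2 =
      (P.Y * Q.Y + C A * P.g * Q.g) * (1 + C B * P.g ^ 2 * Q.g ^ 2) +
        2 * C B * P.g * Q.g * (P.g ^ 2 + Q.g ^ 2) := by
  obtain ⟨E, hE, hE1⟩ := exists_inv P Q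
  have hP := P.eqn
  have hQ := Q.eqn
  refine ⟨⟨(P.g * Q.Y + Q.g * P.Y) * E,
    ((P.Y * Q.Y + C A * P.g * Q.g) * (1 + C B * P.g ^ 2 * Q.g ^ 2) +
        2 * C B * P.g * Q.g * (P.g ^ 2 + Q.g ^ 2)) * E ^ 2, ?_, ?_, ?_⟩, ?_, ?_⟩
  · simp [P.g0, Q.g0]
  · simp [P.g0, Q.g0, P.Y0, Q.Y0, hE1]
  · have key : ((P.Y * Q.Y + C A * P.g * Q.g) * (1 + C B * P.g ^ 2 * Q.g ^ 2) +
        2 * C B * P.g * Q.g * (P.g ^ 2 + Q.g ^ 2)) ^ 2 =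
        (1 - C B * P.g ^ 2 * Q.g ^ 2) ^ 4 +
        C A * (P.g * Q.Y + Q.g * P.Y) ^ 2 * (1 - C B * P.g ^ 2 * Q.g ^ 2) ^ 2 +
        C B * (P.g * Q.Y + Q.g * P.Y) ^ 4 := by
      generalize P.g = a at *
      generalize Q.g = b at *
      generalize P.Y = y at *
      generalize Q.Y = z at *
      generalize (C A : PowerSeries R) = A' at *
      generalize (C B : PowerSeries R) = B' at *
      have hz4 : z ^ 4 = (1 + A' * b ^ 2 + B' * b ^ 4) ^ 2 := by rw [← hQ]; ring
      have hy4 : y ^ 4 = (1 + A' * a ^ 2 + B' * a ^ 4) ^ 2 := by rw [← hP]; ring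
      have h3 : y ^ 3 = y * (1 + A' * a ^ 2 + B' * a ^ 4) := by rw [← hP]; ring
      have hz3 : z ^ 3 = z * (1 + A' * b ^ 2 + B' * b ^ 4) := by rw [← hQ]; ring
      ring_nf
      simp only [hz4, hy4, h3, hz3, hP, hQ]
      ring
    have e2 : (1 - C B * P.g ^ 2 * Q.g ^ 2) ^ 2 * E ^ 2 = 1 := by
      rw [← mul_pow, hE, one_pow]
    have e4 : (1 - C B * P.g ^ 2 * Q.g ^ 2) ^ 4 * E ^ 4 = 1 := by
      rw [← mul_pow, hE, one_pow]
    linear_combination E ^ 4 * key + e4 + C A * (P.g * Q.Y + Q.g * P.Y) ^ 2 * E ^ 2 * e2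
  · linear_combination (P.g * Q.Y + Q.g * P.Y) * hE
  · have e2 : (1 - C B * P.g ^ 2 * Q.g ^ 2) ^ 2 * E ^ 2 = 1 := by
      rw [← mul_pow, hE, one_pow]
    linear_combination ((P.Y * Q.Y + C A * P.g * Q.g) * (1 + C B * P.g ^ 2 * Q.g ^ 2) +
        2 * C B * P.g * Q.g * (P.g ^ 2 + Q.g ^ 2)) * e2

/-- The sum of two formal points. -/
noncomputable def add (P Q : JPair A B) : JPair A B := (exists_add P Q).choose

theorem add_g (P Q : JPair A B) :
    (add P Q).g * (1 - C B * P.g ^ 2 * Q.g ^ 2) = P.g * Q.Y + Q.g * P.Y :=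
  (exists_add P Q).choose_spec.1

theorem add_Y (P Q : JPair A B) : (add P Q).Y * (1 - C B * P.g ^ 2 * Q.g ^ 2) ^ 2 =
      (P.Y * Q.Y + C A * P.g * Q.g) * (1 + C B * P.g ^ 2 * Q.g ^ 2) +
        2 * C B * P.g * Q.g * (P.g ^ 2 + Q.g ^ 2) :=
  (exists_add P Q).choose_spec.2

/-- The opposite of a formal point. -/
noncomputable def neg (P : JPair A B) : JPair A B where
  g := -P.g
  Y := P.Y
  g0 := by simp [P.g0]
  Y0 := P.Y0
  eqn := by rw [P.eqn]; ring

/-- The origin. -/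
noncomputable def zero : JPair A B where
  g := 0
  Y := 1
  g0 := by simp
  Y0 := by simp
  eqn := by simp

/-- Base change. -/
noncomputable def map {S : Type*} [CommRing S] (f : R →+* S) (P : JPair A B) :
    JPair (f A) (f B) where
  g := PowerSeries.map f P.g
  Y := PowerSeries.map f P.Y
  g0 := by
    rw [← coeff_zero_eq_constantCoeff_apply, coeff_map, coeff_zero_eq_constantCoeff_apply, P.g0,
      map_zero]
  Y0 := by
    rw [← coeff_zero_eq_constantCoeff_apply, coeff_map, coeff_zero_eq_constantCoeff_apply, P.Y0,
      map_one]
  eqn := by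
    have := congrArg (PowerSeries.map f) P.eqn
    simpa using this

/-- The substitution `w ↦ w ^ n`. -/
noncomputable def expand (n : ℕ) (hn : n ≠ 0) (P : JPair A B) : JPair A B where
  g := PowerSeries.expand n hn P.g
  Y := PowerSeries.expand n hn P.Y
  g0 := by simp [P.g0]
  Y0 := by simp [P.Y0]
  eqn := by
    have := congrArg (PowerSeries.expand n hn) P.eqn
    simpa [PowerSeries.expand_C] using this

theorem isUnit_Y (P : JPair A B) : IsUnit P.Y := by
  rw [isUnit_iff_constantCoeff, P.Y0]; exact isUnit_one

theorem isUnit_den (P Q : JPair A B) : IsUnit (1 - C B * P.g ^ 2 * Q.g ^ 2) := by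
  rw [isUnit_iff_constantCoeff]; simp [P.g0]

/-- The invariant differential pulls back to `ω`. -/
def HasLog (P : JPair A B) (ω : PowerSeries R) : Prop := derivative R P.g = ω * P.Y

theorem HasLog.neg {P : JPair A B} {ω : PowerSeries R} (hP : P.HasLog ω) :
    P.neg.HasLog (-ω) := by
  unfold HasLog at *
  simp [JPair.neg, hP]

theorem hasLog_zero : (zero : JPair A B).HasLog 0 := by
  simp [HasLog, zero]

theorem eq_Y_of_sq_eq {K : Type*} [CommRing K] [IsDomain K] {A B : K}
    {P Q : JPair A B} (h2 : (2 : K) ≠ 0) (e : P.g ^ 2 = Q.g ^ 2) : P.Y = Q.Y := by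
  have e5 : P.Y ^ 2 = Q.Y ^ 2 := by
    rw [P.eqn, Q.eqn]; linear_combination (C A + C B * (P.g ^ 2 + Q.g ^ 2)) * e
  rcases sq_eq_sq_iff_eq_or_eq_neg.1 e5 with h | h
  · exact h
  · have := congrArg constantCoeff h
    rw [map_neg, P.Y0, Q.Y0] at this
    exact absurd (by linear_combination this) h2

end basic

section log

variable {R : Type*} [CommRing R] [IsDomain R] [CharZero R] {A B : R}

theorem HasLog.deriv_Y {P : JPair A B} {ω : PowerSeries R} (h : P.HasLog ω) :
    derivative R P.Y = (C A * P.g + 2 * C B * P.g ^ 3) * ω := by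
  have e := congrArg (derivative R) P.eqn
  simp only [map_add, Derivation.leibniz, Derivation.leibniz_pow, smul_eq_mul, derivative_C,
    Derivation.map_one_eq_zero] at e
  unfold HasLog at h
  rw [h] at e
  have hY : (2 * P.Y) ≠ 0 := by
    refine mul_ne_zero ?_ P.isUnit_Y.ne_zero
    have : (C (2 : R)) ≠ 0 := by
      rw [Ne, map_eq_zero_iff _ (PowerSeries.C_injective)]; exact two_ne_zero
    rwa [map_ofNat] at this
  apply mul_left_cancel₀ hY
  simp only [nsmul_eq_mul, Nat.cast_ofNat] at e
  linear_combination e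

theorem HasLog.add {P Q : JPair A B} {ω ψ : PowerSeries R} (hP : P.HasLog ω) (hQ : Q.HasLog ψ) :
    (P.add Q).HasLog (ω + ψ) := by
  have hP' := hP.deriv_Y
  have hQ' := hQ.deriv_Y
  have e1 := congrArg (derivative R) (add_g P Q)
  have e2 := add_Y P Q
  have e0 := add_g P Q
  unfold HasLog at *
  simp only [map_add, map_sub, Derivation.leibniz, Derivation.leibniz_pow, smul_eq_mul,
    derivative_C, Derivation.map_one_eq_zero, hP, hQ, hP', hQ', nsmul_eq_mul,
    Nat.cast_ofNat] at e1
  apply (isUnit_den P Q).mul_left_cancel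
  apply (isUnit_den P Q).mul_left_cancel
  have h1 := P.eqn
  have h2 := Q.eqn
  generalize (P.add Q).g = a3 at *
  generalize (P.add Q).Y = y3 at *
  generalize P.g = a at *
  generalize Q.g = b at *
  generalize P.Y = y at *
  generalize Q.Y = z at *
  generalize (C A : PowerSeries R) = A' at *
  generalize (C B : PowerSeries R) = B' at *
  linear_combination (1 - B' * a ^ 2 * b ^ 2) * e1 - (ω + ψ) * e2 +
    (2 * B' * a * ω * y * b ^ 2 + 2 * B' * a ^ 2 * b * ψ * z) * e0 +
    2 * B' * a * b ^ 3 * ω * h1 + 2 * B' * a ^ 3 * b * ψ * h2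

theorem HasLog.unique {P Q : JPair A B} {ω : PowerSeries R} (hP : P.HasLog ω)
    (hQ : Q.HasLog ω) : P.g = Q.g ∧ P.Y = Q.Y := by
  have h := hP.add hQ.neg
  rw [add_neg_cancel] at h
  have h0 : (P.add Q.neg).g = 0 := by
    apply derivative.ext
    · rw [h]; simp
    · rw [(P.add Q.neg).g0]; simp
  have e := add_g P Q.neg
  rw [h0, zero_mul] at e
  simp only [JPair.neg] at e
  have e1 : P.g ^ 2 * Q.Y ^ 2 = Q.g ^ 2 * P.Y ^ 2 := by
    linear_combination (-P.g * Q.Y - Q.g * P.Y) * e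
  have e2 : (P.g ^ 2 - Q.g ^ 2) * (1 - C B * P.g ^ 2 * Q.g ^ 2) = 0 := by
    rw [P.eqn, Q.eqn] at e1
    linear_combination e1
  have e3 : P.g ^ 2 = Q.g ^ 2 := by
    rcases mul_eq_zero.1 e2 with h | h
    · exact sub_eq_zero.1 h
    · exact absurd h (isUnit_den P Q).ne_zero
  have e4 := eq_Y_of_sq_eq two_ne_zero e3
  refine ⟨?_, e4⟩
  rw [e4] at e
  apply mul_right_cancel₀ Q.isUnit_Y.ne_zero
  linear_combination -e

end log


end JPair

section height

open Polynomial

theorem isCoprime_duplication {S : Type*} [CommRing S] {A B n d : S} (h2 : IsUnit (2 : S))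
    (hB : IsUnit B) (hAB : IsUnit (A ^ 2 - 4 * B)) (h : IsCoprime n d) :
    IsCoprime ((n ^ 2 - B * d ^ 2) ^ 2) (4 * d * n * (n ^ 2 + A * d * n + B * d ^ 2)) := by
  have had : IsCoprime (n ^ 2 - B * d ^ 2) d := by
    have : IsCoprime (n ^ 2 + d * (-(B * d))) d := (h.pow_left (m := 2)).add_mul_left_left _
    convert this using 1; ring
  have han : IsCoprime (n ^ 2 - B * d ^ 2) n := by
    have h1 : IsCoprime (-B * d ^ 2) n :=
      (isCoprime_mul_unit_left_left hB.neg _ _).2 (h.symm.pow_left)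
    have : IsCoprime (-B * d ^ 2 + n * n) n := h1.add_mul_left_left _
    convert this using 1; ring
  have hab : IsCoprime (n ^ 2 - B * d ^ 2) (A * n + 2 * B * d) := by
    have h1 : IsCoprime (n ^ 2 - B * d ^ 2) (-(B * (A ^ 2 - 4 * B)) * d ^ 2) :=
      (isCoprime_mul_unit_left_right (hB.mul hAB).neg _ _).2 had.pow_right
    have h3 : IsCoprime (n ^ 2 - B * d ^ 2)
      (-(B * (A ^ 2 - 4 * B)) * d ^ 2 + (n ^ 2 - B * d ^ 2) * (-A ^ 2)) :=
      h1.add_mul_left_right _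
    have h4 : IsCoprime (n ^ 2 - B * d ^ 2) ((A * n + 2 * B * d) * (2 * B * d - A * n)) := by
      convert h3 using 1; ring
    exact h4.of_mul_right_left
  have hac : IsCoprime (n ^ 2 - B * d ^ 2) (n ^ 2 + A * d * n + B * d ^ 2) := by
    have h3 : IsCoprime (n ^ 2 - B * d ^ 2) (d * (A * n + 2 * B * d) + (n ^ 2 - B * d ^ 2) * 1) :=
      (had.mul_right hab).add_mul_left_right _
    convert h3 using 1; ring
  have h4 : IsUnit (4 : S) := by
    have := h2.mul h2; norm_num at this; exact this
  apply IsCoprime.pow_left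
  rw [mul_assoc, mul_assoc]
  rw [isCoprime_mul_unit_left_right h4]
  exact had.mul_right (han.mul_right hac)

variable {k : Type*} [Field k] {L : Type*} [CommRing L] [IsDomain L]

/-- `q` is the rational function `D / N` of degree `d`. -/
def IsRep (φ : k[X] →+* L) (q : L) (N D : k[X]) (d : ℕ) : Prop :=
  IsCoprime N D ∧ max N.natDegree D.natDegree = d ∧ φ N * q = φ D

variable {φ : k[X] →+* L} (hφ : Function.Injective φ)

include hφ

omit [IsDomain L] in
theorem IsRep.ne_zero {q : L} {N D : k[X]} {d : ℕ} (h : IsRep φ q N D d) : N ≠ 0 := by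
  rintro rfl
  obtain ⟨h1, -, h3⟩ := h
  rw [map_zero, zero_mul] at h3
  have := hφ (h3.symm.trans (map_zero φ).symm)
  subst this
  exact not_isCoprime_zero_zero h1

omit [IsDomain L] in
theorem IsRep.unique {q : L} {N D N' D' : k[X]} {d d' : ℕ} (h : IsRep φ q N D d)
    (h' : IsRep φ q N' D' d') : d = d' := by
  have hN := h.ne_zero hφ
  have hN' := h'.ne_zero hφ
  obtain ⟨h1, h2, h3⟩ := h
  obtain ⟨h1', h2', h3'⟩ := h'
  have e : N * D' = N' * D := by
    apply hφ; rw [map_mul, map_mul, ← h3, ← h3']; ring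
  have d1 : N ∣ N' := h1.dvd_of_dvd_mul_right ⟨D', e.symm⟩
  obtain ⟨c, hc⟩ := d1
  have d2 : N' ∣ N := h1'.dvd_of_dvd_mul_right ⟨D, e⟩
  have eD : D' = D * c := by
    apply mul_left_cancel₀ hN; rw [e, hc]; ring
  have hc0 : c ≠ 0 := by rintro rfl; exact hN' (by simpa using hc)
  have hu : c.natDegree = 0 := by
    have := natDegree_le_of_dvd d2 hN
    rw [hc, natDegree_mul hN hc0] at this
    omega
  rw [eq_C_of_natDegree_eq_zero hu] at hc eD
  have hc1 : c.coeff 0 ≠ 0 := by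
    intro h; apply hc0; rw [eq_C_of_natDegree_eq_zero hu, h, C_0]
  rw [← h2, ← h2', hc, eD, natDegree_mul_C hc1, natDegree_mul_C hc1]

theorem exists_isRep {q : L} {N D : k[X]} (hN : N ≠ 0) (h : φ N * q = φ D) :
    ∃ N' D' d, IsRep φ q N' D' d := by
  classical
  have h1 := EuclideanDomain.gcd_dvd_left N D
  have h2 := EuclideanDomain.gcd_dvd_right N D
  have hg : EuclideanDomain.gcd N D ≠ 0 := fun h0 => hN (by rw [h0] at h1; exact zero_dvd_iff.1 h1)
  set g := EuclideanDomain.gcd N D with hgdef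
  obtain ⟨N', hN'⟩ := h1
  obtain ⟨D', hD'⟩ := h2
  refine ⟨N', D', _, ?_, rfl, ?_⟩
  · have e := EuclideanDomain.gcd_eq_gcd_ab N D
    rw [← hgdef] at e
    refine ⟨EuclideanDomain.gcdA N D, EuclideanDomain.gcdB N D, ?_⟩
    apply mul_left_cancel₀ hg
    linear_combination -e - EuclideanDomain.gcdA N D * hN' - EuclideanDomain.gcdB N D * hD'
  · have : φ g ≠ 0 := by rwa [Ne, map_eq_zero_iff _ hφ]
    apply mul_left_cancel₀ this
    rw [hN', hD', map_mul, map_mul] at h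
    linear_combination h

theorem IsRep.add_le {q1 q2 q3 q4 : L} {N1 D1 N2 D2 N3 D3 N4 D4 : k[X]} {d1 d2 d3 d4 : ℕ}
    (A B : k)
    (h1 : IsRep φ q1 N1 D1 d1) (h2 : IsRep φ q2 N2 D2 d2)
    (h3 : IsRep φ q3 N3 D3 d3) (h4 : IsRep φ q4 N4 D4 d4)
    (hW : 1 - φ (C B) * q1 * q2 ≠ 0)
    (hm : q3 * q4 * (1 - φ (C B) * q1 * q2) ^ 2 = (q1 - q2) ^ 2)
    (ha : (q3 + q4) * (1 - φ (C B) * q1 * q2) ^ 2 =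
      2 * ((q1 + q2) * (1 + φ (C B) * q1 * q2) + 2 * φ (C A) * q1 * q2)) :
    d3 + d4 ≤ 2 * (d1 + d2) := by
  have n1 := h1.ne_zero hφ
  have n2 := h2.ne_zero hφ
  have n3 := h3.ne_zero hφ
  have n4 := h4.ne_zero hφ
  obtain ⟨-, m1, e1⟩ := h1
  obtain ⟨-, m2, e2⟩ := h2
  obtain ⟨c3, m3, e3⟩ := h3
  obtain ⟨c4, m4, e4⟩ := h4
  set T0 := (N1 * N2 - C B * D1 * D2) ^ 2 with hT0
  set T1 := 2 * ((D1 * N2 + D2 * N1) * (N1 * N2 + C B * D1 * D2) +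
    2 * C A * D1 * D2 * N1 * N2) with hT1
  set T2 := (D1 * N2 - D2 * N1) ^ 2 with hT2
  have f0 : φ T0 = (φ N1 * φ N2) ^ 2 * (1 - φ (C B) * q1 * q2) ^ 2 := by
    simp only [hT0, map_pow, map_sub, map_mul, ← e1, ← e2]; ring
  have f1 : φ T1 = (φ N1 * φ N2) ^ 2 *
      (2 * ((q1 + q2) * (1 + φ (C B) * q1 * q2) + 2 * φ (C A) * q1 * q2)) := by
    simp only [hT1, map_add, map_mul, map_ofNat, ← e1, ← e2]; ring
  have f2 : φ T2 = (φ N1 * φ N2) ^ 2 * (q1 - q2) ^ 2 := by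
    simp only [hT2, map_pow, map_sub, map_mul, ← e1, ← e2]; ring
  have g2 : T0 * (D3 * D4) = T2 * (N3 * N4) := by
    apply hφ
    simp only [map_mul, f0, f2, ← e3, ← e4, ← hm]; ring
  have g1 : T0 * (D3 * N4 + D4 * N3) = T1 * (N3 * N4) := by
    apply hφ
    simp only [map_mul, map_add, f0, f1, ← e3, ← e4, ← ha]; ring
  have hT0' : T0 ≠ 0 := by
    intro h
    rw [h, map_zero] at f0
    have : (φ N1 * φ N2) ^ 2 * (1 - φ (C B) * q1 * q2) ^ 2 ≠ 0 := by
      refine mul_ne_zero (pow_ne_zero _ (mul_ne_zero ?_ ?_)) (pow_ne_zero _ hW)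
      · rwa [Ne, map_eq_zero_iff _ hφ]
      · rwa [Ne, map_eq_zero_iff _ hφ]
    exact this f0.symm
  have k3 : N3 ∣ T0 := by
    have a1 : N3 ∣ T0 * N4 := by
      apply c3.dvd_of_dvd_mul_right
      refine ⟨T1 * N4 - T0 * D4, ?_⟩
      linear_combination g1
    have a2 : N3 ∣ T0 * D4 := by
      apply c3.dvd_of_dvd_mul_right
      refine ⟨T2 * N4, ?_⟩
      linear_combination g2
    obtain ⟨x, y, hxy⟩ := c4
    have : T0 = x * (T0 * N4) + y * (T0 * D4) := by linear_combination (-T0) * hxy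
    rw [this]
    exact dvd_add (a1.mul_left _) (a2.mul_left _)
  obtain ⟨T', hT'⟩ := k3
  have g2' : T' * (D3 * D4) = T2 * N4 := by
    apply mul_left_cancel₀ n3; linear_combination g2 - D3 * D4 * hT'
  have g1' : T' * (D3 * N4 + D4 * N3) = T1 * N4 := by
    apply mul_left_cancel₀ n3; linear_combination g1 - (D3 * N4 + D4 * N3) * hT'
  have k4 : N4 ∣ T' := by
    have a1 : N4 ∣ T' * N3 := by
      apply c4.dvd_of_dvd_mul_right
      refine ⟨T1 - T' * D3, ?_⟩
      linear_combination g1'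
    have a2 : N4 ∣ T' * D3 := by
      apply c4.dvd_of_dvd_mul_right
      refine ⟨T2, ?_⟩
      linear_combination g2'
    obtain ⟨x, y, hxy⟩ := c3
    have : T' = x * (T' * N3) + y * (T' * D3) := by linear_combination (-T') * hxy
    rw [this]
    exact dvd_add (a1.mul_left _) (a2.mul_left _)
  obtain ⟨l, hl⟩ := k4
  have r0 : T0 = l * (N3 * N4) := by rw [hT', hl]; ring
  have r2 : T2 = l * (D3 * D4) := by
    apply mul_left_cancel₀ n4; linear_combination D3 * D4 * hl - g2'
  have r1 : T1 = l * (D3 * N4 + D4 * N3) := by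
    apply mul_left_cancel₀ n4; linear_combination (D3 * N4 + D4 * N3) * hl - g1'
  have l0 : l ≠ 0 := by rintro rfl; exact hT0' (by rw [r0, zero_mul])
  have bN1 : N1.natDegree ≤ d1 := m1 ▸ le_max_left _ _
  have bD1 : D1.natDegree ≤ d1 := m1 ▸ le_max_right _ _
  have bN2 : N2.natDegree ≤ d2 := m2 ▸ le_max_left _ _
  have bD2 : D2.natDegree ≤ d2 := m2 ▸ le_max_right _ _
  have bN3 : N3.natDegree ≤ d3 := m3 ▸ le_max_left _ _
  have bD3 : D3.natDegree ≤ d3 := m3 ▸ le_max_right _ _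
  have bN4 : N4.natDegree ≤ d4 := m4 ▸ le_max_left _ _
  have bD4 : D4.natDegree ≤ d4 := m4 ▸ le_max_right _ _
  have bb : ∀ {a b : k[X]}, a.natDegree ≤ d1 → b.natDegree ≤ d2 → (a * b).natDegree ≤ d1 + d2 :=
    fun ha hb => natDegree_mul_le_of_le ha hb
  have bm : ∀ {a b : k[X]}, a.natDegree ≤ d1 + d2 → b.natDegree ≤ d1 + d2 →
      (a * b).natDegree ≤ 2 * (d1 + d2) := fun ha hb =>
    (natDegree_mul_le_of_le ha hb).trans (by omega)
  have bs : ∀ {a b : k[X]} {n : ℕ}, a.natDegree ≤ n → b.natDegree ≤ n → (a + b).natDegree ≤ n :=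
    fun ha hb => (natDegree_add_le _ _).trans (max_le ha hb)
  have bs' : ∀ {a b : k[X]} {n : ℕ}, a.natDegree ≤ n → b.natDegree ≤ n → (a - b).natDegree ≤ n :=
    fun ha hb => (natDegree_sub_le _ _).trans (max_le ha hb)
  have bc : ∀ {a : k[X]} {c : k} {n : ℕ}, a.natDegree ≤ n → (C c * a).natDegree ≤ n :=
    fun ha => (natDegree_C_mul_le _ _).trans ha
  have t0 : T0.natDegree ≤ 2 * (d1 + d2) := by
    rw [hT0, sq, mul_assoc]
    exact bm (bs' (bb bN1 bN2) (bc (bb bD1 bD2))) (bs' (bb bN1 bN2) (bc (bb bD1 bD2)))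
  have t2 : T2.natDegree ≤ 2 * (d1 + d2) := by
    rw [hT2, sq, mul_comm D2]
    exact bm (bs' (bb bD1 bN2) (bb bN1 bD2)) (bs' (bb bD1 bN2) (bb bN1 bD2))
  have t1 : T1.natDegree ≤ 2 * (d1 + d2) := by
    have : T1 = C 2 * ((D1 * N2 + N1 * D2) * (N1 * N2 + C B * (D1 * D2)) +
        C (2 * A) * ((D1 * D2) * (N1 * N2))) := by
      rw [hT1, C_mul, show (C (2 : k) : k[X]) = 2 from rfl]; ring
    rw [this]
    exact bc (bs (bm (bs (bb bD1 bN2) (bb bN1 bD2)) (bs (bb bN1 bN2) (bc (bb bD1 bD2))))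
      (bc (bm (bb bD1 bD2) (bb bN1 bN2))))
  have fin : ∀ {a : k[X]}, a ≠ 0 → d3 + d4 ≤ a.natDegree → (l * a).natDegree ≤ 2 * (d1 + d2) →
      d3 + d4 ≤ 2 * (d1 + d2) := fun h0 h1 h2 => by
    rw [natDegree_mul l0 h0] at h2; omega
  have nz : ∀ {a : k[X]} {n : ℕ}, a.coeff n ≠ 0 → a ≠ 0 ∧ n ≤ a.natDegree := fun h =>
    ⟨fun h0 => h (by rw [h0, coeff_zero]), le_natDegree_of_ne_zero h⟩
  have top : ∀ {N D : k[X]} {d : ℕ}, N ≠ 0 → max N.natDegree D.natDegree = d →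
      N.coeff d ≠ 0 ∨ (N.coeff d = 0 ∧ D.coeff d ≠ 0) := by
    intro N D d hN hd
    by_cases hc : N.coeff d = 0
    · right
      refine ⟨hc, fun hD => ?_⟩
      rcases max_choice N.natDegree D.natDegree with h | h
      · rw [hd] at h
        rw [h] at hc
        exact hN (leadingCoeff_eq_zero.1 hc)
      · rw [hd] at h
        rw [h] at hD hd
        have h0 := leadingCoeff_eq_zero.1 hD
        rw [h0] at hd h
        rw [natDegree_zero] at h
        have : N.natDegree = 0 := by simpa [h0] using hd
        rw [h, ← this] at hc
        exact hN (leadingCoeff_eq_zero.1 hc)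
    · exact Or.inl hc
  have cm : ∀ {a b : k[X]}, a.natDegree ≤ d3 → b.natDegree ≤ d4 →
      (a * b).coeff (d3 + d4) = a.coeff d3 * b.coeff d4 := fun ha hb =>
    coeff_mul_add_eq_of_natDegree_le ha hb
  rcases top n3 m3 with h3 | ⟨h3, h3'⟩ <;> rcases top n4 m4 with h4 | ⟨h4, h4'⟩
  · have := nz (a := N3 * N4) (n := d3 + d4) (by rw [cm bN3 bN4]; exact mul_ne_zero h3 h4)
    exact fin this.1 this.2 (r0 ▸ t0)
  · have := nz (a := D3 * N4 + D4 * N3) (n := d3 + d4) (by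
      rw [mul_comm D4, coeff_add, cm bD3 bN4, cm bN3 bD4, h4, mul_zero, zero_add]
      exact mul_ne_zero h3 h4')
    exact fin this.1 this.2 (r1 ▸ t1)
  · have := nz (a := D3 * N4 + D4 * N3) (n := d3 + d4) (by
      rw [mul_comm D4, coeff_add, cm bD3 bN4, cm bN3 bD4, h3, zero_mul, add_zero]
      exact mul_ne_zero h3' h4)
    exact fin this.1 this.2 (r1 ▸ t1)
  · have := nz (a := D3 * D4) (n := d3 + d4) (by rw [cm bD3 bD4]; exact mul_ne_zero h3' h4')
    exact fin this.1 this.2 (r2 ▸ t2)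

omit [IsDomain L] in
theorem IsRep.duplication {q q' : L} {N D : k[X]} {d : ℕ} {A B : k} (h2 : (2 : k) ≠ 0)
    (hB : B ≠ 0) (hAB : A ^ 2 - 4 * B ≠ 0) (h : IsRep φ q N D d)
    (hq : q' * (1 - φ (C B) * q ^ 2) ^ 2 = 4 * q * (1 + φ (C A) * q + φ (C B) * q ^ 2)) :
    ∃ N' D', IsRep φ q' N' D' (4 * d) := by
  have n0 := h.ne_zero hφ
  obtain ⟨c, m, e⟩ := h
  have bN : N.natDegree ≤ d := m ▸ le_max_left _ _
  have bD : D.natDegree ≤ d := m ▸ le_max_right _ _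
  have top : N.coeff d ≠ 0 ∨ D.coeff d ≠ 0 := by
    by_contra! hc
    rcases max_choice N.natDegree D.natDegree with h | h
    · rw [m] at h
      rw [h] at hc
      exact n0 (leadingCoeff_eq_zero.1 hc.1)
    · rw [m] at h
      rw [h] at hc m
      have h0 := leadingCoeff_eq_zero.1 hc.2
      rw [h0, natDegree_zero] at m hc
      have hN0 : N.natDegree = 0 := by simpa using m
      apply n0
      rw [eq_C_of_natDegree_eq_zero hN0, hc.1, C_0]
  have u : ∀ {a : k}, a ≠ 0 → IsUnit (C a) := fun ha => (isUnit_iff_ne_zero.2 ha).map C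
  have hcop := isCoprime_duplication (A := C A) (B := C B) (n := N) (d := D)
    (u h2) (u hB) (by
      have := u hAB; rwa [C_sub, C_pow, C_mul, show (C (4 : k) : k[X]) = 4 from rfl] at this) c
  have htop := isCoprime_duplication (A := A) (B := B) (n := N.coeff d) (d := D.coeff d)
    (isUnit_iff_ne_zero.2 h2) (isUnit_iff_ne_zero.2 hB) (isUnit_iff_ne_zero.2 hAB) (by
      rcases top with h | h
      · exact ⟨(N.coeff d)⁻¹, 0, by rw [inv_mul_cancel₀ h, zero_mul, add_zero]⟩
      · exact ⟨0, (D.coeff d)⁻¹, by rw [inv_mul_cancel₀ h, zero_mul, zero_add]⟩)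
  have cm : ∀ {a b : k[X]} {m n : ℕ}, a.natDegree ≤ m → b.natDegree ≤ n →
      (a * b).coeff (m + n) = a.coeff m * b.coeff n := fun ha hb =>
    coeff_mul_add_eq_of_natDegree_le ha hb
  have bb : ∀ {a b : k[X]} {m n : ℕ}, a.natDegree ≤ m → b.natDegree ≤ n →
      (a * b).natDegree ≤ m + n := fun ha hb => natDegree_mul_le_of_le ha hb
  have bs : ∀ {a b : k[X]} {n : ℕ}, a.natDegree ≤ n → b.natDegree ≤ n → (a + b).natDegree ≤ n :=
    fun ha hb => (natDegree_add_le _ _).trans (max_le ha hb)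
  have bs' : ∀ {a b : k[X]} {n : ℕ}, a.natDegree ≤ n → b.natDegree ≤ n → (a - b).natDegree ≤ n :=
    fun ha hb => (natDegree_sub_le _ _).trans (max_le ha hb)
  have bc : ∀ {a : k[X]} {c : k} {n : ℕ}, a.natDegree ≤ n → (C c * a).natDegree ≤ n :=
    fun ha => (natDegree_C_mul_le _ _).trans ha
  have bn2 := bs' (bb bN bN) (bc (c := B) (bb bD bD))
  have bdn := bc (c := 4) (bb bD bN)
  have b3 := bs (bs (bb bN bN) (bc (c := A) (bb bD bN))) (bc (c := B) (bb bD bD))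
  have bl := bb bn2 bn2
  have br := bb bdn b3
  have cl := cm bn2 bn2
  have cr := cm bdn b3
  have el : (N ^ 2 - C B * D ^ 2) ^ 2 = (N * N - C B * (D * D)) * (N * N - C B * (D * D)) := by ring
  have er : 4 * D * N * (N ^ 2 + C A * D * N + C B * D ^ 2) =
      (C 4 * (D * N)) * (N * N + C A * (D * N) + C B * (D * D)) := by
    rw [show (C (4 : k) : k[X]) = 4 from rfl]; ring
  refine ⟨(N ^ 2 - C B * D ^ 2) ^ 2, 4 * D * N * (N ^ 2 + C A * D * N + C B * D ^ 2), hcop, ?_, ?_⟩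
  · rw [← el] at bl cl
    rw [← er] at br cr
    have e4 : d + d + (d + d) = 4 * d := by ring
    rw [e4] at bl br cl cr
    apply le_antisymm (max_le bl br)
    simp only [coeff_sub, coeff_add, coeff_C_mul, cm bN bN, cm bD bN, cm bD bD] at cl cr
    by_contra! hlt
    rw [max_lt_iff] at hlt
    rw [coeff_eq_zero_of_natDegree_lt hlt.1] at cl
    rw [coeff_eq_zero_of_natDegree_lt hlt.2] at cr
    obtain ⟨x, y, hxy⟩ := htop
    apply one_ne_zero (α := k)
    linear_combination -hxy - x * cl - y * cr
  · simp only [map_pow, map_sub, map_mul, map_add, map_ofNat, ← e]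
    linear_combination (φ N) ^ 4 * hq

end height

namespace JPair

open Polynomial

section heightpair

variable {k : Type*} [Field k] {A B : k}

/-- `S` is the sum of `P` and `Q`. -/
def IsSum (P Q S : JPair A B) : Prop :=
  S.g * (1 - PowerSeries.C B * P.g ^ 2 * Q.g ^ 2) = P.g * Q.Y + Q.g * P.Y ∧
    S.Y * (1 - PowerSeries.C B * P.g ^ 2 * Q.g ^ 2) ^ 2 =
      (P.Y * Q.Y + PowerSeries.C A * P.g * Q.g) * (1 + PowerSeries.C B * P.g ^ 2 * Q.g ^ 2) +
        2 * PowerSeries.C B * P.g * Q.g * (P.g ^ 2 + Q.g ^ 2)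

/-- The point `P` has height `d` relative to the point `O`. -/
def HasHt (O P : JPair A B) (d : ℕ) : Prop :=
  ∃ N D E F : k[X], IsRep (aeval (O.g ^ 2)).toRingHom (P.g ^ 2) N D d ∧ F ≠ 0 ∧
    aeval (O.g ^ 2) F * (P.g * P.Y) = aeval (O.g ^ 2) E * (O.g * O.Y)

theorem aeval_injective {K : Type*} [Field K] {z : PowerSeries K}
    (h0 : PowerSeries.constantCoeff z = 0) (hz : z ≠ 0) :
    Function.Injective (aeval (R := K) z).toRingHom := by
  rw [injective_iff_map_eq_zero]
  intro N
  induction hn : N.natDegree using Nat.strong_induction_on generalizing N with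
  | _ n ih =>
    intro h
    change aeval z N = 0 at h
    have e := N.X_mul_divX_add
    rw [← e, map_add, map_mul, aeval_X, aeval_C] at h
    have h1 := congrArg PowerSeries.constantCoeff h
    rw [map_add, map_mul, h0, zero_mul, zero_add, map_zero] at h1
    have h2 : N.coeff 0 = 0 := by
      simpa [PowerSeries.algebraMap_apply] using h1
    rw [h2, map_zero, add_zero] at h
    have h3 := (mul_eq_zero.1 h).resolve_left hz
    rw [h2, C_0, add_zero] at e
    by_cases hd : N.natDegree = 0
    · rw [eq_C_of_natDegree_eq_zero hd, h2, C_0]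
    · have := ih N.divX.natDegree (by rw [natDegree_divX_eq_natDegree_tsub_one]; omega)
        N.divX rfl h3
      rw [← e, this, mul_zero]

variable {O : JPair A B} (hO : O.g ≠ 0)

include hO

theorem aeval_sq_injective : Function.Injective (aeval (R := k) (O.g ^ 2)).toRingHom :=
  aeval_injective (by simp [O.g0]) (pow_ne_zero 2 hO)

theorem HasHt.unique {P : JPair A B} {d d' : ℕ} (h : HasHt O P d) (h' : HasHt O P d') :
    d = d' := by
  obtain ⟨N, D, E, F, h1, -⟩ := h
  obtain ⟨N', D', E', F', h1', -⟩ := h'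
  exact h1.unique (aeval_sq_injective hO) h1'

theorem IsSum.exists_hasHt {P Q S : JPair A B} (h : IsSum P Q S) {d d' : ℕ} (hP : HasHt O P d)
    (hQ : HasHt O Q d') : ∃ e, HasHt O S e := by
  have inj := aeval_sq_injective hO
  obtain ⟨N1, D1, E1, F1, h1, f1, r1⟩ := hP
  obtain ⟨N2, D2, E2, F2, h2, f2, r2⟩ := hQ
  have n1 := h1.ne_zero inj
  have n2 := h2.ne_zero inj
  have e1 : aeval (O.g ^ 2) N1 * P.g ^ 2 = aeval (O.g ^ 2) D1 := h1.2.2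
  have e2 : aeval (O.g ^ 2) N2 * Q.g ^ 2 = aeval (O.g ^ 2) D2 := h2.2.2
  have hC : ∀ a : k, aeval (O.g ^ 2) (C a) = PowerSeries.C a := fun a => by simp
  have hW := (isUnit_den P Q).ne_zero
  have nw : N1 * N2 - C B * D1 * D2 ≠ 0 := by
    intro h0
    have := congrArg (aeval (O.g ^ 2)) h0
    simp only [map_sub, map_mul, hC, ← e1, ← e2, map_zero] at this
    have a1 : aeval (O.g ^ 2) N1 ≠ 0 := by
      have := (map_ne_zero_iff _ inj).2 n1; exact this
    have a2 : aeval (O.g ^ 2) N2 ≠ 0 := by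
      have := (map_ne_zero_iff _ inj).2 n2; exact this
    apply mul_ne_zero (mul_ne_zero a1 a2) hW
    linear_combination this
  obtain ⟨hg, hY⟩ := h
  have q1 := P.eqn
  have q2 := Q.eqn
  have qO := O.eqn
  obtain ⟨N', D', d, hr⟩ := exists_isRep inj (q := S.g ^ 2)
    (N := (N1 * N2 - C B * D1 * D2) ^ 2 * (F1 * F2))
    (D := F1 * F2 * (D1 * N1 * (N2 ^ 2 + C A * D2 * N2 + C B * D2 ^ 2) +
      D2 * N2 * (N1 ^ 2 + C A * D1 * N1 + C B * D1 ^ 2)) +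
      2 * (N1 * N2) ^ 2 * (E1 * E2) * (X * (1 + C A * X + C B * X ^ 2)))
    (mul_ne_zero (pow_ne_zero _ nw) (mul_ne_zero f1 f2)) (by
      change aeval (O.g ^ 2) _ * _ = aeval (O.g ^ 2) _
      simp only [map_add, map_sub, map_mul, map_pow, map_one, map_ofNat, hC, aeval_X, ← e1, ← e2]
      have r12 : aeval (O.g ^ 2) F1 * aeval (O.g ^ 2) F2 * (P.g * P.Y * (Q.g * Q.Y)) =
        aeval (O.g ^ 2) E1 * aeval (O.g ^ 2) E2 * (O.g ^ 2 * (1 + PowerSeries.C A * O.g ^ 2 +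
          PowerSeries.C B * (O.g ^ 2) ^ 2)) := by
        rw [show (1 + PowerSeries.C A * O.g ^ 2 + PowerSeries.C B * (O.g ^ 2) ^ 2) = O.Y ^ 2 by
          rw [qO]; ring]
        linear_combination aeval (O.g ^ 2) F2 * (Q.g * Q.Y) * r1 +
          aeval (O.g ^ 2) E1 * (O.g * O.Y) * r2
      generalize aeval (O.g ^ 2) N1 = x1 at *
      generalize aeval (O.g ^ 2) N2 = x2 at *
      generalize aeval (O.g ^ 2) F1 = y1 at *
      generalize aeval (O.g ^ 2) F2 = y2 at *
      generalize aeval (O.g ^ 2) E1 = z1 at *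
      generalize aeval (O.g ^ 2) E2 = z2 at *
      have hg2 : S.g ^ 2 * (1 - PowerSeries.C B * P.g ^ 2 * Q.g ^ 2) ^ 2 =
          (P.g * Q.Y + Q.g * P.Y) ^ 2 := by rw [← hg]; ring
      linear_combination (x1 * x2) ^ 2 * (y1 * y2) * hg2 + 2 * (x1 * x2) ^ 2 * r12 +
        (x1 * x2) ^ 2 * (y1 * y2) * (P.g ^ 2 * q2 + Q.g ^ 2 * q1))
  refine ⟨d, N', D', N1 ^ 2 * E1 * F2 * ((N1 * N2 + C B * D1 * D2) *
      (N2 ^ 2 + 2 * C A * D2 * N2 + C B * D2 ^ 2) + 2 * C B * (D1 * N2 + D2 * N1) * D2 * N2) +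
      N2 ^ 2 * E2 * F1 * ((N1 * N2 + C B * D1 * D2) *
      (N1 ^ 2 + 2 * C A * D1 * N1 + C B * D1 ^ 2) + 2 * C B * (D1 * N2 + D2 * N1) * D1 * N1),
    (N1 * N2 - C B * D1 * D2) ^ 3 * (F1 * F2), hr,
    mul_ne_zero (pow_ne_zero _ nw) (mul_ne_zero f1 f2), ?_⟩
  simp only [map_add, map_sub, map_mul, map_pow, map_ofNat, hC, ← e1, ← e2]
  generalize aeval (O.g ^ 2) N1 = x1 at *
  generalize aeval (O.g ^ 2) N2 = x2 at *
  generalize aeval (O.g ^ 2) F1 = y1 at *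
  generalize aeval (O.g ^ 2) F2 = y2 at *
  generalize aeval (O.g ^ 2) E1 = z1 at *
  generalize aeval (O.g ^ 2) E2 = z2 at *
  have hgY : S.g * S.Y * (1 - PowerSeries.C B * P.g ^ 2 * Q.g ^ 2) ^ 3 =
      (P.g * Q.Y + Q.g * P.Y) * ((P.Y * Q.Y + PowerSeries.C A * P.g * Q.g) *
        (1 + PowerSeries.C B * P.g ^ 2 * Q.g ^ 2) +
        2 * PowerSeries.C B * P.g * Q.g * (P.g ^ 2 + Q.g ^ 2)) := by
    rw [← hg, ← hY]; ring
  generalize S.g = a3 at *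
  generalize S.Y = b3 at *
  generalize P.g = a1 at *
  generalize P.Y = b1 at *
  generalize Q.g = a2 at *
  generalize Q.Y = b2 at *
  generalize O.g = a0 at *
  generalize O.Y = b0 at *
  generalize (PowerSeries.C A : PowerSeries k) = A' at *
  generalize (PowerSeries.C B : PowerSeries k) = B' at *
  linear_combination (x1 * x2) ^ 3 * (y1 * y2) * hgY +
    (x1 * x2) ^ 3 * (y1 * y2) * (1 + B' * a1 ^ 2 * a2 ^ 2) * (a1 * b1 * q2 + a2 * b2 * q1) +
    (x1 * x2) ^ 3 * y2 * ((1 + B' * a1 ^ 2 * a2 ^ 2) * (1 + 2 * A' * a2 ^ 2 + B' * a2 ^ 4) +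
      2 * B' * (a1 ^ 2 + a2 ^ 2) * a2 ^ 2) * r1 +
    (x1 * x2) ^ 3 * y1 * ((1 + B' * a1 ^ 2 * a2 ^ 2) * (1 + 2 * A' * a1 ^ 2 + B' * a1 ^ 4) +
      2 * B' * (a1 ^ 2 + a2 ^ 2) * a1 ^ 2) * r2

end heightpair

end JPair

theorem quadratic_of_second_difference {f : ℤ → ℤ} {c : ℤ}
    (h : ∀ m, f (m + 1) + f (m - 1) = 2 * f m + 2 * c) (m : ℤ) :
    f m = f 0 + m * (f 1 - f 0 - c) + m ^ 2 * c := by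
  have key : ∀ n : ℕ, f n = f 0 + n * (f 1 - f 0 - c) + (n : ℤ) ^ 2 * c ∧
      f (n + 1) = f 0 + (n + 1) * (f 1 - f 0 - c) + ((n : ℤ) + 1) ^ 2 * c := by
    intro n
    induction n with
    | zero => exact ⟨by simp, by simp; ring⟩
    | succ n ih =>
      refine ⟨by push_cast; exact ih.2, ?_⟩
      have := h (n + 1)
      rw [add_sub_cancel_right] at this
      push_cast
      linear_combination this - ih.1 + 2 * ih.2
  have key' : ∀ n : ℕ, f (-n) = f 0 - n * (f 1 - f 0 - c) + (n : ℤ) ^ 2 * c ∧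
      f (-n - 1) = f 0 - (n + 1) * (f 1 - f 0 - c) + ((n : ℤ) + 1) ^ 2 * c := by
    intro n
    induction n with
    | zero =>
      have := h 0
      refine ⟨by simp, ?_⟩
      simp only [zero_add] at this
      simp only [Nat.cast_zero, neg_zero, zero_add]
      linear_combination this
    | succ n ih =>
      have e : (-((n + 1 : ℕ) : ℤ)) = -(n : ℤ) - 1 := by push_cast; ring
      refine ⟨by rw [e]; push_cast; exact ih.2, ?_⟩
      have := h (-n - 1)
      rw [sub_add_cancel] at this
      rw [e]
      push_cast
      linear_combination this - ih.1 + 2 * ih.2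
  obtain ⟨n, rfl | rfl⟩ := m.eq_nat_or_neg
  · exact (key n).1
  · rw [(key' n).1]; ring

namespace JPair

open Polynomial

variable {k : Type*} [Field k] {A B : k}

theorem IsSum.mul_g {P Q S D : JPair A B} (hS : IsSum P Q S) (hD : IsSum P Q.neg D) :
    S.g ^ 2 * D.g ^ 2 * (1 - PowerSeries.C B * P.g ^ 2 * Q.g ^ 2) ^ 2 =
      (P.g ^ 2 - Q.g ^ 2) ^ 2 := by
  have h1 := hS.1
  have h2 := hD.1
  simp only [neg] at h2
  apply (isUnit_den P Q).mul_left_cancel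
  apply (isUnit_den P Q).mul_left_cancel
  have e : (S.g * (1 - PowerSeries.C B * P.g ^ 2 * Q.g ^ 2)) ^ 2 *
    (D.g * (1 - PowerSeries.C B * P.g ^ 2 * (-Q.g) ^ 2)) ^ 2 =
      ((P.g ^ 2 - Q.g ^ 2) * (1 - PowerSeries.C B * P.g ^ 2 * Q.g ^ 2)) ^ 2 := by
    rw [h1, h2]
    have q1 := P.eqn
    have q2 := Q.eqn
    have : (P.g * Q.Y + Q.g * P.Y) * (P.g * Q.Y + -Q.g * P.Y) =
        (P.g ^ 2 - Q.g ^ 2) * (1 - PowerSeries.C B * P.g ^ 2 * Q.g ^ 2) := by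
      linear_combination P.g ^ 2 * q2 - Q.g ^ 2 * q1
    rw [← this]; ring
  linear_combination e

theorem IsSum.add_g {P Q S D : JPair A B} (hS : IsSum P Q S) (hD : IsSum P Q.neg D) :
    (S.g ^ 2 + D.g ^ 2) * (1 - PowerSeries.C B * P.g ^ 2 * Q.g ^ 2) ^ 2 =
      2 * ((P.g ^ 2 + Q.g ^ 2) * (1 + PowerSeries.C B * P.g ^ 2 * Q.g ^ 2) +
        2 * PowerSeries.C A * P.g ^ 2 * Q.g ^ 2) := by
  have h1 := hS.1
  have h2 := hD.1
  simp only [neg] at h2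
  have e : (S.g * (1 - PowerSeries.C B * P.g ^ 2 * Q.g ^ 2)) ^ 2 +
    (D.g * (1 - PowerSeries.C B * P.g ^ 2 * (-Q.g) ^ 2)) ^ 2 =
      2 * (P.g ^ 2 * Q.Y ^ 2 + Q.g ^ 2 * P.Y ^ 2) := by
    rw [h1, h2]; ring
  rw [P.eqn, Q.eqn] at e
  linear_combination e

theorem IsSum.sq_g {P D : JPair A B} (h : IsSum P P D) :
    D.g ^ 2 * (1 - PowerSeries.C B * (P.g ^ 2) ^ 2) ^ 2 =
      4 * P.g ^ 2 * (1 + PowerSeries.C A * P.g ^ 2 + PowerSeries.C B * (P.g ^ 2) ^ 2) := by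
  have h1 := h.1
  have e : (D.g * (1 - PowerSeries.C B * P.g ^ 2 * P.g ^ 2)) ^ 2 = 4 * P.g ^ 2 * P.Y ^ 2 := by
    rw [h1]; ring
  rw [P.eqn] at e
  linear_combination e

/-- A family of points indexed additively by `ℤ × ℤ`. -/
structure IsFamily (W : ℤ → ℤ → JPair A B) : Prop where
  add : ∀ a b c d, IsSum (W a b) (W c d) (W (a + c) (b + d))
  sub : ∀ a b c d, IsSum (W a b) (W c d).neg (W (a - c) (b - d))

variable {O : JPair A B} (hO : O.g ≠ 0)

include hO

theorem HasHt.add_le {P Q S D : JPair A B} (hS : IsSum P Q S) (hD : IsSum P Q.neg D)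
    {d1 d2 d3 d4 : ℕ} (h1 : HasHt O P d1) (h2 : HasHt O Q d2) (h3 : HasHt O S d3)
    (h4 : HasHt O D d4) : d3 + d4 ≤ 2 * (d1 + d2) := by
  obtain ⟨N1, D1, E1, F1, h1, -⟩ := h1
  obtain ⟨N2, D2, E2, F2, h2, -⟩ := h2
  obtain ⟨N3, D3, E3, F3, h3, -⟩ := h3
  obtain ⟨N4, D4, E4, F4, h4, -⟩ := h4
  have hC : ∀ a : k, (aeval (O.g ^ 2)).toRingHom (C a) = PowerSeries.C a := fun a => by simp
  refine IsRep.add_le (aeval_sq_injective hO) A B h1 h2 h3 h4 ?_ ?_ ?_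
  · rw [hC]; exact (isUnit_den P Q).ne_zero
  · rw [hC]; exact hS.mul_g hD
  · rw [hC, hC]; exact hS.add_g hD

theorem HasHt.double {P D : JPair A B} (h2 : (2 : k) ≠ 0) (hB : B ≠ 0) (hAB : A ^ 2 - 4 * B ≠ 0)
    (hD : IsSum P P D) {d d' : ℕ} (h : HasHt O P d) (h' : HasHt O D d') : d' = 4 * d := by
  obtain ⟨N1, D1, E1, F1, h1, -⟩ := h
  obtain ⟨N3, D3, E3, F3, h3, -⟩ := h'
  have inj := aeval_sq_injective hO
  have hC : ∀ a : k, (aeval (O.g ^ 2)).toRingHom (C a) = PowerSeries.C a := fun a => by simp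
  obtain ⟨N', D', hr⟩ := IsRep.duplication inj h2 hB hAB h1 (q' := D.g ^ 2)
    (by rw [hC, hC]; exact hD.sq_g)
  exact h3.unique inj hr

theorem IsFamily.hasHt {W : ℤ → ℤ → JPair A B} (hW : IsFamily W) (h2 : (2 : k) ≠ 0) (hB : B ≠ 0)
    (hAB : A ^ 2 - 4 * B ≠ 0) (h10 : HasHt O (W 1 0) 1) (h01 : HasHt O (W 0 1) 5)
    {d : ℕ} (h11 : HasHt O (W 1 1) d) (hd : d ≤ 6)
    {d' : ℕ} (h11' : HasHt O (W 1 (-1)) d') (hd' : d' ≤ 6) (m n : ℤ) :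
    HasHt O (W m n) (m ^ 2 + 5 * n ^ 2).toNat := by
  have h00 : ∃ d, HasHt O (W 0 0) d := by
    have := (hW.add 1 (-1) (-1) 1)
    obtain ⟨e, he⟩ := IsSum.exists_hasHt hO (hW.sub 1 0 1 0) h10
      (d' := 1) (by
        obtain ⟨N, D, E, F, a, b, c⟩ := h10
        refine ⟨N, D, -E, F, ?_, b, ?_⟩
        · simpa [neg] using a
        · simp only [neg, map_neg]; linear_combination -c)
    exact ⟨e, he⟩
  have neg_ht : ∀ {P : JPair A B} {d : ℕ}, HasHt O P d → HasHt O P.neg d := by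
    rintro P d ⟨N, D, E, F, a, b, c⟩
    refine ⟨N, D, -E, F, ?_, b, ?_⟩
    · simpa [neg] using a
    · simp only [neg, map_neg]; linear_combination -c
  have ex : ∀ m n : ℤ, ∃ d, HasHt O (W m n) d := by
    have step : ∀ (a b c d : ℤ), (∃ e, HasHt O (W a b) e) → (∃ e, HasHt O (W c d) e) →
        (∃ e, HasHt O (W (a + c) (b + d)) e) := fun a b c d ⟨e, he⟩ ⟨e', he'⟩ =>
      IsSum.exists_hasHt hO (hW.add a b c d) he he'
    have step' : ∀ (a b c d : ℤ), (∃ e, HasHt O (W a b) e) → (∃ e, HasHt O (W c d) e) →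
        (∃ e, HasHt O (W (a - c) (b - d)) e) := fun a b c d ⟨e, he⟩ ⟨e', he'⟩ =>
      IsSum.exists_hasHt hO (hW.sub a b c d) he (neg_ht he')
    have hm : ∀ m : ℤ, ∃ d, HasHt O (W m 0) d := by
      intro m
      induction m using Int.induction_on with
      | zero => exact h00
      | succ i ih => simpa using step _ _ _ _ ih ⟨_, h10⟩
      | pred i ih => simpa using step' _ _ _ _ ih ⟨_, h10⟩
    intro m n
    induction n using Int.induction_on with
    | zero => exact hm m
    | succ i ih => simpa using step _ _ _ _ ih ⟨_, h01⟩
    | pred i ih => simpa using step' _ _ _ _ ih ⟨_, h01⟩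
  choose H hH using ex
  have par : ∀ a b c d : ℤ, H (a + c) (b + d) + H (a - c) (b - d) = 2 * (H a b + H c d) := by
    intro a b c d
    apply le_antisymm
    · exact HasHt.add_le hO (hW.add a b c d) (hW.sub a b c d) (hH _ _) (hH _ _) (hH _ _) (hH _ _)
    · have dbl : ∀ a b, H (a + a) (b + b) = 4 * H a b := fun a b =>
        HasHt.double hO h2 hB hAB (hW.add a b a b) (hH _ _) (hH _ _)
      have := HasHt.add_le hO (hW.add (a + c) (b + d) (a - c) (b - d))
        (hW.sub (a + c) (b + d) (a - c) (b - d)) (hH _ _) (hH _ _) (hH _ _) (hH _ _)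
      rw [show a + c + (a - c) = a + a by ring, show b + d + (b - d) = b + b by ring,
        show a + c - (a - c) = c + c by ring, show b + d - (b - d) = d + d by ring,
        dbl, dbl] at this
      omega
  have b10 : H 1 0 = 1 := (hH 1 0).unique hO h10
  have b01 : H 0 1 = 5 := (hH 0 1).unique hO h01
  have b11 : H 1 1 ≤ 6 := ((hH 1 1).unique hO h11).trans_le hd
  have b11' : H 1 (-1) ≤ 6 := ((hH 1 (-1)).unique hO h11').trans_le hd'
  have b00 : H 0 0 = 0 := by have := par 0 0 0 0; simp at this; omega
  have c11 := par 1 0 0 1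
  simp only [add_zero, zero_add, sub_zero, zero_sub] at c11
  have e11 : H 1 1 = 6 := by omega
  have q1 : ∀ n : ℤ, (H 0 n : ℤ) = 5 * n ^ 2 := by
    intro n
    have := quadratic_of_second_difference (f := fun n => (H 0 n : ℤ)) (c := 5) (fun m => by
      have := par 0 m 0 1
      simp only [add_zero, sub_zero] at this
      push_cast [← Nat.cast_add, this, b01]; ring) n
    simp only [b00, b01] at this
    rw [this]; push_cast; ring
  have q2 : ∀ n : ℤ, (H 1 n : ℤ) = 1 + 5 * n ^ 2 := by
    intro n
    have := quadratic_of_second_difference (f := fun n => (H 1 n : ℤ)) (c := 5) (fun m => by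
      have := par 1 m 0 1
      simp only [add_zero, sub_zero] at this
      push_cast [← Nat.cast_add, this, b01]; ring) n
    simp only [b10, e11] at this
    rw [this]; push_cast; ring
  have q3 : (H m n : ℤ) = m ^ 2 + 5 * n ^ 2 := by
    have := quadratic_of_second_difference (f := fun m => (H m n : ℤ)) (c := 1) (fun m => by
      have := par m n 1 0
      simp only [add_zero, sub_zero] at this
      push_cast [← Nat.cast_add, this, b10]; ring) m
    simp only [q1, q2] at this
    rw [this]; ring
  rw [← q3, Int.toNat_natCast]
  exact hH m n

end JPair

open Polynomial in
theorem squarefree_jacobiCubic {k : Type*} [Field k] {A B : k} (hAB : A ^ 2 - 4 * B ≠ 0) :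
    Squarefree (X * (1 + C A * X + C B * X ^ 2) : k[X]) := by
  apply Separable.squarefree
  refine Separable.mul separable_X ?_ ⟨-(C A + C B * X), 1, by ring⟩
  have h : (C (A ^ 2 - 4 * B) : k[X]) * C ((A ^ 2 - 4 * B)⁻¹) = 1 := by
    rw [← C_mul, mul_inv_cancel₀ hAB, C_1]
  rw [C_sub, C_pow, C_mul, show (C (4 : k) : k[X]) = 4 from rfl] at h
  refine ⟨-4 * C B * C ((A ^ 2 - 4 * B)⁻¹), (2 * C B * X + C A) * C ((A ^ 2 - 4 * B)⁻¹), ?_⟩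
  simp only [derivative_add, derivative_one, derivative_C_mul, derivative_X, derivative_X_pow]
  simp only [Nat.cast_ofNat, show (C (2 : k) : k[X]) = 2 from rfl]
  linear_combination h

namespace JPair

open Polynomial

variable {p : ℕ} [Fact p.Prime] {A B : ZMod p}

theorem jacobi_coeffs {k : Type*} [Field k] {A B a b d : k} (ha : a ≠ 0) (h3 : (3 : k) ≠ 0)
    (hA : A ≠ 0) (h1 : A ^ 2 - 3 * B ≠ 0) (h2 : 2 * A ^ 2 - 9 * B ≠ 0)
    (e1 : 3 * b + A * d = a * A) (e2 : 3 * b ^ 2 + 2 * A * d * b + B * d ^ 2 = a ^ 2 * B)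
    (e3 : b * (b ^ 2 + A * d * b + B * d ^ 2) = 0) : b = 0 ∧ d = a := by
  by_cases hb : b = 0
  · refine ⟨hb, mul_left_cancel₀ hA ?_⟩
    rw [hb] at e1
    linear_combination e1
  · exfalso
    have e4 := (mul_eq_zero.1 e3).resolve_left hb
    have had : a - d ≠ 0 := by
      intro h
      apply hb
      apply mul_left_cancel₀ h3
      linear_combination e1 + A * h
    have e5 : (a - d) * ((a + d) * (3 * (A ^ 2 - 3 * B))) = 0 := by
      linear_combination (-(3 * (3 * b + A * (a - d))) - 6 * A * d) * e1 + 9 * e2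
    have e6 := (mul_eq_zero.1 ((mul_eq_zero.1 e5).resolve_left had)).resolve_right
      (mul_ne_zero h3 h1)
    have e7 : A ^ 2 * (a - d) * (a + 2 * d) + 9 * B * d ^ 2 = 0 := by
      linear_combination 9 * e4 - (3 * b + A * (a - d) + 3 * A * d) * e1
    apply mul_ne_zero (pow_ne_zero 2 ha) h2
    have : d = -a := by linear_combination e6
    rw [this] at e7
    linear_combination -e7

theorem HasHt.sq_eq {O P : JPair A B} (hp : p ≠ 2) (hO : O.g ≠ 0)
    (hO' : PowerSeries.derivative (ZMod p) O.g ≠ 0) (h3 : (3 : ZMod p) ≠ 0) (hA : A ≠ 0)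
    (h1 : A ^ 2 - 3 * B ≠ 0) (h2 : 2 * A ^ 2 - 9 * B ≠ 0) (hAB : A ^ 2 - 4 * B ≠ 0) (hB : B ≠ 0)
    (hP : HasHt O P p) (hP' : PowerSeries.derivative (ZMod p) P.g = 0) :
    P.g ^ 2 = (O.g ^ p) ^ 2 := by
  have inj := aeval_sq_injective hO
  have inj' : Function.Injective (aeval (R := ZMod p) (O.g ^ 2)) := inj
  have hpp : p.Prime := Fact.out
  have h20 : (2 : ZMod p) ≠ 0 := by
    intro h
    have := (ZMod.natCast_eq_zero_iff 2 p).1 (by exact_mod_cast h)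
    exact hp ((Nat.prime_dvd_prime_iff_eq hpp Nat.prime_two).1 this)
  have h2s : (2 : PowerSeries (ZMod p)) ≠ 0 := by
    intro h
    have := congrArg PowerSeries.constantCoeff h
    rw [map_ofNat, map_zero] at this
    exact h20 this
  obtain ⟨N, D, E, F, hr, hF, hE⟩ := hP
  have hN0 := hr.ne_zero inj
  obtain ⟨hc, hm, he⟩ := hr
  change aeval (O.g ^ 2) N * P.g ^ 2 = aeval (O.g ^ 2) D at he
  have hd := congrArg (PowerSeries.derivative (ZMod p)) he
  simp only [Derivation.leibniz, Derivation.map_aeval, smul_eq_mul, hP', mul_zero, zero_add,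
    Derivation.leibniz_pow, smul_zero, Nat.cast_ofNat, nsmul_eq_mul] at hd
  have hz' : (2 * (O.g ^ (2 - 1) * PowerSeries.derivative (ZMod p) O.g)) ≠ 0 := by
    refine mul_ne_zero h2s (mul_ne_zero (by simpa using hO) hO')
  have hd1 : aeval (O.g ^ 2) (derivative N) * P.g ^ 2 = aeval (O.g ^ 2) (derivative D) := by
    apply mul_right_cancel₀ hz'
    linear_combination hd
  have hd2 : derivative N * D = derivative D * N := by
    apply inj'
    rw [map_mul, map_mul, ← he, ← hd1]; ring
  have hN' : derivative N = 0 := by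
    have hdvd : N ∣ derivative N := hc.dvd_of_dvd_mul_right ⟨derivative D, by rw [hd2]; ring⟩
    by_contra h0
    have l1 := natDegree_le_of_dvd hdvd h0
    have l2 := natDegree_derivative_lt (p := N) (fun h => h0 (by
      rw [eq_C_of_natDegree_eq_zero h, derivative_C]))
    omega
  have hD' : derivative D = 0 := by
    rw [hN', zero_mul] at hd2
    exact (mul_eq_zero.1 hd2.symm).resolve_right hN0
  have hNe := expand_contract p hN' hpp.ne_zero
  have hDe := expand_contract p hD' hpp.ne_zero
  set N1 := contract p N
  set D1 := contract p D
  have hmN : N1.natDegree ≤ 1 := by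
    have : N.natDegree ≤ p := (le_max_left _ _).trans_eq hm
    rw [← hNe, natDegree_expand] at this
    exact Nat.le_of_mul_le_mul_right (by simpa using this) hpp.pos
  have hmD : D1.natDegree ≤ 1 := by
    have : D.natDegree ≤ p := (le_max_right _ _).trans_eq hm
    rw [← hDe, natDegree_expand] at this
    exact Nat.le_of_mul_le_mul_right (by simpa using this) hpp.pos
  have hD0 : D1.coeff 0 = 0 := by
    have := congrArg PowerSeries.constantCoeff he
    rw [map_mul, map_pow, P.g0, zero_pow two_ne_zero, mul_zero, ← hDe] at this
    rw [eq_X_add_C_of_natDegree_le_one hmD] at this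
    simpa [O.g0, hpp.ne_zero, PowerSeries.algebraMap_apply] using this.symm
  have hNf := eq_X_add_C_of_natDegree_le_one hmN
  have hDf := eq_X_add_C_of_natDegree_le_one hmD
  rw [hD0, C_0, add_zero] at hDf
  set a := N1.coeff 0
  set b := N1.coeff 1
  set d := D1.coeff 1
  have ha : a ≠ 0 := by
    intro ha
    rw [ha, C_0, add_zero] at hNf
    rw [← hNe, ← hDe, hNf, hDf] at hc
    simp only [map_mul, expand_X, expand_C] at hc
    have := hc.of_mul_left_right.of_mul_right_right
    have := natDegree_eq_zero_of_isUnit (isCoprime_self.1 this)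
    rw [natDegree_X_pow] at this
    exact hpp.ne_zero this
  have hPne : D ≠ 0 := by
    intro h0
    have : p = 0 := by
      rw [h0, isCoprime_zero_right] at hc
      rw [h0, natDegree_eq_zero_of_isUnit hc] at hm
      simpa using hm.symm
    exact hpp.ne_zero this
  have hgne : P.g ≠ 0 := by
    intro h0
    rw [h0, zero_pow two_ne_zero, mul_zero] at he
    exact hPne (inj' (he.symm.trans (map_zero _).symm))
  have hEne : E ≠ 0 := by
    rintro rfl
    rw [map_zero, zero_mul] at hE
    have := (mul_eq_zero.1 hE).resolve_left (fun h => hF (inj' (h.trans (map_zero _).symm)))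
    exact mul_ne_zero hgne P.isUnit_Y.ne_zero this
  have hC : ∀ a : ZMod p, aeval (O.g ^ 2) (C a) = PowerSeries.C a := fun a => by simp
  set f : (ZMod p)[X] := X * (1 + C A * X + C B * X ^ 2) with hf
  have hfdeg : f.natDegree = 3 := by
    rw [hf]
    have : (X * (1 + C A * X + C B * X ^ 2) : (ZMod p)[X]) =
      C B * X ^ 3 + C A * X ^ 2 + C 1 * X + C 0 := by simp; ring
    rw [this, natDegree_cubic hB]
  have hfne : f ≠ 0 := by intro h; rw [h] at hfdeg; simp at hfdeg
  set Φ := N1 * D1 * (N1 ^ 2 + C A * D1 * N1 + C B * D1 ^ 2) with hΦ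
  have hsq : F ^ 2 * Φ ^ p = E ^ 2 * N ^ 4 * f := by
    rw [← ZMod.expand_card, hΦ]
    simp only [map_mul, map_add, map_pow, expand_C, hNe, hDe]
    apply inj'
    have e1 := P.eqn
    have e2 := O.eqn
    have e3 : (aeval (O.g ^ 2) F * (P.g * P.Y)) ^ 2 = (aeval (O.g ^ 2) E * (O.g * O.Y)) ^ 2 := by
      rw [hE]
    simp only [mul_pow, e1, e2] at e3
    simp only [hf, map_mul, map_add, map_pow, map_one, hC, aeval_X, ← he]
    linear_combination aeval (O.g ^ 2) N ^ 4 * e3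
  obtain ⟨j, hj⟩ := hpp.odd_of_ne_two hp
  have hsq2 : (F * Φ ^ (j + 1)) ^ 2 = (E * N ^ 2) ^ 2 * (f * Φ) := by
    have : Φ ^ p = (Φ ^ j) ^ 2 * Φ := by
      rw [congrArg (Φ ^ ·) hj]; ring
    rw [this] at hsq
    linear_combination Φ * hsq
  have hv : E * N ^ 2 ≠ 0 := mul_ne_zero hEne (pow_ne_zero _ hN0)
  obtain ⟨w, hw⟩ := (IsIntegrallyClosed.pow_dvd_pow_iff two_ne_zero).1 (Dvd.intro _ hsq2.symm)
  have hfw : f * Φ = w ^ 2 := by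
    apply mul_left_cancel₀ (pow_ne_zero 2 hv)
    rw [← hsq2, hw]; ring
  obtain ⟨w', rfl⟩ := ((squarefree_jacobiCubic hAB).dvd_pow_iff_dvd two_ne_zero).1
    (Dvd.intro _ hfw)
  have hΦw : Φ = f * w' ^ 2 := by
    apply mul_left_cancel₀ hfne
    rw [hfw]; ring
  have hΦne : Φ ≠ 0 := by
    intro h0
    rw [h0, zero_pow hpp.ne_zero, mul_zero] at hsq
    exact mul_ne_zero (mul_ne_zero (pow_ne_zero 2 hEne) (pow_ne_zero 4 hN0)) hfne hsq.symm
  have hw'ne : w' ≠ 0 := by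
    rintro rfl
    exact hΦne (by rw [hΦw]; ring)
  have hΦexp : Φ = C (a ^ 3 * d) * X + C (d * (3 * a ^ 2 * b + A * d * a ^ 2)) * X ^ 2 +
      C (d * (3 * a * b ^ 2 + 2 * A * d * a * b + B * d ^ 2 * a)) * X ^ 3 +
      C (d * b * (b ^ 2 + A * d * b + B * d ^ 2)) * X ^ 4 := by
    rw [hΦ, hNf, hDf]
    simp only [C_mul, C_add, C_pow, show (C (2 : ZMod p) : (ZMod p)[X]) = 2 from rfl,
      show (C (3 : ZMod p) : (ZMod p)[X]) = 3 from rfl]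
    ring
  have hΦdeg : Φ.natDegree ≤ 4 := by
    rw [hΦexp]; compute_degree
  have hw'deg : w'.natDegree = 0 := by
    rw [hΦw, natDegree_mul hfne (pow_ne_zero 2 hw'ne), hfdeg, natDegree_pow] at hΦdeg
    omega
  rw [eq_C_of_natDegree_eq_zero hw'deg, hΦexp] at hΦw
  set e := w'.coeff 0
  have hfe : f * C e ^ 2 = C (e ^ 2) * X + C (e ^ 2 * A) * X ^ 2 + C (e ^ 2 * B) * X ^ 3 := by
    rw [hf]; simp only [C_mul, C_pow]; ring
  rw [hfe] at hΦw
  have c1 := congrArg (coeff · 1) hΦw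
  have c2 := congrArg (coeff · 2) hΦw
  have c3 := congrArg (coeff · 3) hΦw
  have c4 := congrArg (coeff · 4) hΦw
  simp only [coeff_add, coeff_C_mul, coeff_X_pow, coeff_X, OfNat.ofNat_ne_one, if_true,
    OfNat.one_ne_ofNat, if_false, mul_one, mul_zero, add_zero, zero_add,
    OfNat.ofNat_eq_ofNat, Nat.reduceEqDiff] at c1 c2 c3 c4
  have hd : d ≠ 0 := by
    intro h
    apply hPne
    rw [← hDe, hDf, h]; simp
  obtain ⟨hb, hda⟩ := jacobi_coeffs (d := d) (b := b) ha h3 hA h1 h2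
    (by
      apply mul_left_cancel₀ (mul_ne_zero hd (pow_ne_zero 2 ha))
      linear_combination c2 - A * c1)
    (by
      apply mul_left_cancel₀ (mul_ne_zero hd ha)
      linear_combination c3 - B * c1)
    (by
      apply mul_left_cancel₀ hd
      linear_combination c4)
  rw [hb, C_0, zero_mul, zero_add] at hNf
  rw [hda] at hDf
  rw [← hNe, ← hDe, hNf, hDf, map_mul, expand_C, expand_X, map_mul, hC, map_pow, aeval_X] at he
  have hCa : (PowerSeries.C a : PowerSeries (ZMod p)) ≠ 0 := by
    rwa [Ne, map_eq_zero_iff _ PowerSeries.C_injective]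
  rw [mul_left_cancel₀ hCa he]; ring

end JPair

section multiplication_polynomials

variable {R : Type*} [CommRing R]

/-- Numerator of multiplication by `√-5`, for `r ^ 2 = 5` and `i ^ 2 = -1`. -/
def cmNum (r i z : R) : R := i * (r + (5 + r) * z + (2 + r) * z ^ 2)

/-- Denominator of multiplication by `√-5`. -/
def cmDen (r z : R) : R := 1 + (5 + r) * z + (5 + 2 * r) * z ^ 2

/-- The factor of the ordinate in multiplication by `√-5`. -/
def cmOrd (r z : R) : R :=
  1 + (-2 + 2 * r) * z + 2 * r * z ^ 2 + (6 + 2 * r) * z ^ 3 + (9 + 4 * r) * z ^ 4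

/-- Numerator of multiplication by `1 + √-5`. -/
def cmNumAdd (r i z : R) : R :=
  1 + i * r + (2 * r + 4 * i + 2 * (i * r)) * z + (2 + r + 5 * i + 2 * (i * r)) * z ^ 2

/-- Denominator of multiplication by `1 + √-5`. -/
def cmDenAdd (r i z : R) : R := 1 + (3 + r - i - i * r) * z + (2 + r) * z ^ 2

variable {r i : R} (hr : r ^ 2 = 5) (hi : i ^ 2 = -1) (z : R)

include hr hi

theorem cmOrd_sq : (1 + 4 * z + (2 + r) * z ^ 2) * cmOrd r z ^ 2 =
    cmDen r z ^ 4 + 4 * z * cmNum r i z ^ 2 * cmDen r z ^ 2 +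
      (2 + r) * z ^ 2 * cmNum r i z ^ 4 := by
  unfold cmOrd cmDen cmNum
  grind

omit hi in
theorem cmNum_deriv :
    cmNum r i z * cmDen r z + 2 * z * (i * (5 + r + 2 * (2 + r) * z) * cmDen r z -
      cmNum r i z * (5 + r + 2 * (5 + 2 * r) * z)) = i * r * cmOrd r z := by
  unfold cmOrd cmDen cmNum
  grind

theorem cmDen_sq_sub : cmDen r z ^ 2 - (2 + r) * z ^ 2 * cmNum r i z ^ 2 =
    (1 + 4 * z + (2 + r) * z ^ 2) * cmDenAdd r i z * cmDenAdd r (-i) z := by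
  unfold cmDenAdd cmDen cmNum
  grind

theorem cmOrd_add :
    cmOrd r z + cmNum r i z * cmDen r z = cmNumAdd r i z * cmDenAdd r (-i) z := by
  unfold cmOrd cmDen cmNum cmDenAdd cmNumAdd
  grind

omit hi in
theorem cm_bezout (h : i * i = -1) :
    (15 + 9 * r + (55 + 25 * r) * z) * (-i * cmNum r i z) -
      (29 + 15 * r + (25 + 11 * r) * z) * cmDen r z = 16 := by
  unfold cmDen cmNum
  grind

end multiplication_polynomials

namespace JPair

section cm

variable {R : Type*} [CommRing R] {A B r i : R}

/-- `S` is the image of `P` under multiplication by `√-5`. -/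
def IsCM (r i : R) (P S : JPair A B) : Prop :=
  S.g * cmDen (PowerSeries.C r) (P.g ^ 2) =
      P.g * cmNum (PowerSeries.C r) (PowerSeries.C i) (P.g ^ 2) ∧
    S.Y * cmDen (PowerSeries.C r) (P.g ^ 2) ^ 2 = P.Y * cmOrd (PowerSeries.C r) (P.g ^ 2)

theorem isUnit_cmDen (r : R) (P : JPair A B) : IsUnit (cmDen (PowerSeries.C r) (P.g ^ 2)) := by
  rw [PowerSeries.isUnit_iff_constantCoeff]
  simp [cmDen, P.g0]

theorem exists_isCM (hA : A = 4) (hB : B = 2 + r) (hr : r ^ 2 = 5) (hi : i ^ 2 = -1)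
    (P : JPair A B) : ∃ S, IsCM r i P S := by
  subst hA hB
  obtain ⟨E, hE⟩ := (isUnit_cmDen r P).exists_right_inv
  have hE1 : PowerSeries.constantCoeff E = 1 := by
    have := congrArg PowerSeries.constantCoeff hE
    simpa [cmDen, P.g0] using this
  have hr' : (PowerSeries.C r) ^ 2 = 5 := by rw [← map_pow, hr, map_ofNat]
  have hi' : (PowerSeries.C i) ^ 2 = -1 := by rw [← map_pow, hi, map_neg, map_one]
  have key := cmOrd_sq hr' hi' (P.g ^ 2)
  refine ⟨⟨P.g * cmNum (PowerSeries.C r) (PowerSeries.C i) (P.g ^ 2) * E,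
    P.Y * cmOrd (PowerSeries.C r) (P.g ^ 2) * E ^ 2, ?_, ?_, ?_⟩, ?_, ?_⟩
  · simp [P.g0]
  · simp [P.Y0, cmOrd, P.g0, hE1]
  · have hP := P.eqn
    rw [map_ofNat, map_add, map_ofNat] at hP ⊢
    have e2 : cmDen (PowerSeries.C r) (P.g ^ 2) ^ 2 * E ^ 2 = 1 := by
      rw [← mul_pow, hE, one_pow]
    have e4 : cmDen (PowerSeries.C r) (P.g ^ 2) ^ 4 * E ^ 4 = 1 := by
      rw [← mul_pow, hE, one_pow]
    linear_combination cmOrd (PowerSeries.C r) (P.g ^ 2) ^ 2 * E ^ 4 * hP + E ^ 4 * key +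
      e4 + 4 * P.g ^ 2 * cmNum (PowerSeries.C r) (PowerSeries.C i) (P.g ^ 2) ^ 2 * E ^ 2 * e2
  · linear_combination P.g * cmNum (PowerSeries.C r) (PowerSeries.C i) (P.g ^ 2) * hE
  · have e2 : cmDen (PowerSeries.C r) (P.g ^ 2) ^ 2 * E ^ 2 = 1 := by
      rw [← mul_pow, hE, one_pow]
    linear_combination P.Y * cmOrd (PowerSeries.C r) (P.g ^ 2) * e2

theorem IsCM.hasLog (hr : r ^ 2 = 5) {P S : JPair A B} (h : IsCM r i P S)
    {ω : PowerSeries R} (hP : P.HasLog ω) : S.HasLog (PowerSeries.C (i * r) * ω) := by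
  have hr' : (PowerSeries.C r) ^ 2 = 5 := by rw [← map_pow, hr, map_ofNat]
  obtain ⟨h1, h2⟩ := h
  have h3 := congrArg (PowerSeries.derivative R) h1
  unfold HasLog at *
  have c5 : PowerSeries.derivative R 5 = 0 := by
    rw [← map_ofNat (PowerSeries.C : R →+* _), PowerSeries.derivative_C]
  have c2 : PowerSeries.derivative R 2 = 0 := by
    rw [← map_ofNat (PowerSeries.C : R →+* _), PowerSeries.derivative_C]
  have key := cmNum_deriv (i := PowerSeries.C i) hr' (P.g ^ 2)
  have u := isUnit_cmDen r P
  simp only [cmNum, cmDen, map_add, Derivation.leibniz, Derivation.leibniz_pow, smul_eq_mul,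
    PowerSeries.derivative_C, Derivation.map_one_eq_zero, nsmul_eq_mul, c5, c2, hP] at h3
  simp only [cmNum, cmDen] at h1 h2 key u
  apply u.mul_left_cancel
  apply u.mul_left_cancel
  rw [map_mul]
  generalize PowerSeries.derivative R S.g = S' at *
  generalize cmOrd (PowerSeries.C r) (P.g ^ 2) = σ at *
  generalize S.g = b at *
  generalize P.g = a at *
  generalize S.Y = z at *
  generalize P.Y = y at *
  generalize (PowerSeries.C r) = ρ at *
  generalize (PowerSeries.C i) = ι at *
  push_cast at h3
  linear_combination (1 + (5 + ρ) * a ^ 2 + (5 + 2 * ρ) * (a ^ 2) ^ 2) * h3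
    - ι * ρ * ω * h2 + ω * y * key
    - (2 * a * (5 + ρ) + 4 * a ^ 3 * (5 + 2 * ρ)) * ω * y * h1

end cm

end JPair

open Polynomial in
theorem IsRep.le_of_rep {k L : Type*} [Field k] [CommRing L] [IsDomain L] {φ : k[X] →+* L}
    (hφ : Function.Injective φ) {q : L} {N D N' D' : k[X]} {d e : ℕ} (h : IsRep φ q N D d)
    (hN' : N' ≠ 0) (h' : φ N' * q = φ D') (h1 : N'.natDegree ≤ e) (h2 : D'.natDegree ≤ e) :
    d ≤ e := by
  have hN := h.ne_zero hφ
  obtain ⟨hc, hm, he⟩ := h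
  have e1 : N * D' = N' * D := by
    apply hφ; rw [map_mul, map_mul, ← he, ← h']; ring
  obtain ⟨c, hc'⟩ : N ∣ N' := hc.dvd_of_dvd_mul_right ⟨D', e1.symm⟩
  have hc0 : c ≠ 0 := by rintro rfl; exact hN' (by rw [hc', mul_zero])
  have e2 : D' = c * D := by
    apply mul_left_cancel₀ hN
    rw [e1, hc']; ring
  rw [← hm]
  apply max_le
  · refine le_trans ?_ h1
    rw [hc', natDegree_mul hN hc0]; omega
  · by_cases hD : D = 0
    · simp [hD]
    · refine le_trans ?_ h2
      rw [e2, natDegree_mul hc0 hD]; omega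

namespace JPair

section cmHeight

open Polynomial

variable {k : Type*} [Field k] {A B r i : k}

theorem map_cm_aeval (z : PowerSeries k) (r i : k) :
    aeval z (cmDen (C r) X) = cmDen (PowerSeries.C r) z ∧
    aeval z (cmNum (C r) (C i) X) = cmNum (PowerSeries.C r) (PowerSeries.C i) z ∧
    aeval z (cmOrd (C r) X) = cmOrd (PowerSeries.C r) z ∧
    aeval z (cmNumAdd (C r) (C i) X) = cmNumAdd (PowerSeries.C r) (PowerSeries.C i) z ∧
    aeval z (cmDenAdd (C r) (C i) X) = cmDenAdd (PowerSeries.C r) (PowerSeries.C i) z := by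
  simp [cmDen, cmNum, cmOrd, cmNumAdd, cmDenAdd, map_ofNat (aeval z)]

theorem hasHt_self (O : JPair A B) : HasHt O O 1 := by
  refine ⟨1, X, 1, 1, ⟨isCoprime_one_left, by simp, by simp⟩, one_ne_zero, by simp⟩

theorem cmDen_ne_zero : cmDen (C r) (X : k[X]) ≠ 0 := by
  intro h
  have := congrArg (eval 0) h
  simp [cmDen] at this

theorem IsCM.hasHt (h2 : (2 : k) ≠ 0) (hr : r ^ 2 = 5) (hi : i ^ 2 = -1) (hB : B = 2 + r) (hB0 : B ≠ 0)
    {O S : JPair A B} (h : IsCM r i O S) : HasHt O S 5 := by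
  subst hB
  obtain ⟨h1, h3⟩ := h
  obtain ⟨ad, an, ao, -⟩ := map_cm_aeval (O.g ^ 2) r i
  have hr' : (C r) ^ 2 = (5 : k[X]) := by rw [← map_pow, hr, map_ofNat]
  have hi' : (C i) * C i = (-1 : k[X]) := by rw [← pow_two, ← map_pow, hi, map_neg, map_one]
  have hi0 : i ≠ 0 := by rintro rfl; simp at hi
  have hcop : IsCoprime (cmDen (C r) (X : k[X])) (cmNum (C r) (C i) X) := by
    have key := cm_bezout hr' X hi'
    have h16 : (C (16 : k)⁻¹) * (16 : k[X]) = 1 := by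
      rw [← map_ofNat C, ← map_mul, inv_mul_cancel₀, map_one]
      have : (16 : k) = 2 ^ 4 := by norm_num
      rw [this]; exact pow_ne_zero _ h2
    rw [← key] at h16
    exact ⟨-(C 16⁻¹ * (29 + 15 * C r + (25 + 11 * C r) * X)),
      -(C 16⁻¹ * C i * (15 + 9 * C r + (55 + 25 * C r) * X)), by rw [← h16]; ring⟩
  have hcX : IsCoprime (cmDen (C r) (X : k[X])) X :=
    ⟨1, -((5 + C r) + (5 + 2 * C r) * X), by unfold cmDen; ring⟩
  have dN : (cmDen (C r) (X : k[X])).natDegree ≤ 2 := by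
    have : cmDen (C r) (X : k[X]) = C (5 + 2 * r) * X ^ 2 + C (5 + r) * X + C 1 := by
      simp [cmDen, map_ofNat C]; ring
    rw [this]; exact natDegree_quadratic_le
  have dD : (cmNum (C r) (C i) (X : k[X])).natDegree = 2 := by
    have : cmNum (C r) (C i) (X : k[X]) =
        C (i * (2 + r)) * X ^ 2 + C (i * (5 + r)) * X + C (i * r) := by
      simp [cmNum, map_ofNat C]; ring
    rw [this]; exact natDegree_quadratic (mul_ne_zero hi0 hB0)
  have d0 : cmNum (C r) (C i) (X : k[X]) ≠ 0 := by
    intro h; rw [h] at dD; simp at dD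
  refine ⟨cmDen (C r) X ^ 2, X * cmNum (C r) (C i) X ^ 2,
    cmNum (C r) (C i) X * cmOrd (C r) X, cmDen (C r) X ^ 3, ⟨?_, ?_, ?_⟩,
    pow_ne_zero _ cmDen_ne_zero, ?_⟩
  · exact hcX.pow_left.mul_right hcop.pow
  · rw [natDegree_mul X_ne_zero (pow_ne_zero _ d0), natDegree_X, natDegree_pow, natDegree_pow, dD]
    omega
  · change aeval (O.g ^ 2) _ * _ = aeval (O.g ^ 2) _
    simp only [map_mul, map_pow, aeval_X, ad, an]
    linear_combination (S.g * cmDen (PowerSeries.C r) (O.g ^ 2) +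
      O.g * cmNum (PowerSeries.C r) (PowerSeries.C i) (O.g ^ 2)) * h1
  · simp only [map_mul, map_pow, ad, an, ao]
    linear_combination S.Y * cmDen (PowerSeries.C r) (O.g ^ 2) ^ 2 * h1 +
      O.g * cmNum (PowerSeries.C r) (PowerSeries.C i) (O.g ^ 2) * h3

theorem IsCM.hasHt_add (h2 : (2 : k) ≠ 0) (hr : r ^ 2 = 5) (hi : i ^ 2 = -1) (hA : A = 4) (hB : B = 2 + r)
    (hB0 : B ≠ 0) {O S T : JPair A B} (hO : O.g ≠ 0) (h : IsCM r i O S) (hT : IsSum O S T) :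
    ∃ d ≤ 6, HasHt O T d := by
  subst hA hB
  obtain ⟨d, hd⟩ := hT.exists_hasHt hO (hasHt_self O) (h.hasHt h2 hr hi rfl hB0)
  refine ⟨d, ?_, hd⟩
  obtain ⟨N, D, E, F, h3, -⟩ := hd
  have hr' : (PowerSeries.C r) ^ 2 = 5 := by rw [← map_pow, hr, map_ofNat]
  have hi' : (PowerSeries.C i) ^ 2 = -1 := by rw [← map_pow, hi, map_neg, map_one]
  obtain ⟨-, -, -, am, ab⟩ := map_cm_aeval (O.g ^ 2) r i
  have k1 := cmDen_sq_sub hr' hi' (O.g ^ 2)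
  have k2 := cmOrd_add hr' hi' (O.g ^ 2)
  have hu := isUnit_cmDen r O
  have hY := O.isUnit_Y
  have hE := O.eqn
  have hv : IsUnit (cmDenAdd (PowerSeries.C r) (-PowerSeries.C i) (O.g ^ 2)) := by
    rw [PowerSeries.isUnit_iff_constantCoeff]
    simp [cmDenAdd, O.g0]
  have h5 := hT.1
  obtain ⟨h6, h7⟩ := h
  have key : T.g * (O.Y * cmDenAdd (PowerSeries.C r) (PowerSeries.C i) (O.g ^ 2)) =
      O.g * cmNumAdd (PowerSeries.C r) (PowerSeries.C i) (O.g ^ 2) := by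
    rw [map_ofNat, map_add, map_ofNat] at hE
    rw [map_add, map_ofNat] at h5
    apply hv.mul_left_cancel
    apply hY.mul_left_cancel
    generalize cmDen (PowerSeries.C r) (O.g ^ 2) = dn at *
    generalize cmNum (PowerSeries.C r) (PowerSeries.C i) (O.g ^ 2) = nm at *
    generalize cmOrd (PowerSeries.C r) (O.g ^ 2) = σ at *
    generalize cmNumAdd (PowerSeries.C r) (PowerSeries.C i) (O.g ^ 2) = nA at *
    generalize cmDenAdd (PowerSeries.C r) (PowerSeries.C i) (O.g ^ 2) = dA at *
    generalize cmDenAdd (PowerSeries.C r) (-PowerSeries.C i) (O.g ^ 2) = v at *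
    linear_combination T.g * dA * v * hE - T.g * k1 + O.g * O.Y * k2 + dn ^ 2 * h5 +
      T.g * (2 + PowerSeries.C r) * O.g ^ 2 * (S.g * dn + O.g * nm) * h6 + O.g * h7 +
      O.Y * dn * h6
  refine h3.le_of_rep (aeval_sq_injective hO)
    (N' := (1 + 4 * X + C (2 + r) * X ^ 2) * cmDenAdd (C r) (C i) X ^ 2)
    (D' := X * cmNumAdd (C r) (C i) X ^ 2) ?_ ?_ ?_ ?_
  · intro h
    have := congrArg (eval 0) h
    simp [cmDenAdd] at this
  · change aeval (O.g ^ 2) _ * _ = aeval (O.g ^ 2) _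
    simp only [map_mul, map_pow, aeval_X, am, ab, map_add, map_one, map_ofNat, aeval_C]
    rw [map_ofNat, map_add, map_ofNat] at hE
    change (1 + 4 * O.g ^ 2 + (2 + PowerSeries.C r) * _) * _ * _ = _
    linear_combination (T.g * O.Y * cmDenAdd (PowerSeries.C r) (PowerSeries.C i) (O.g ^ 2) +
      O.g * cmNumAdd (PowerSeries.C r) (PowerSeries.C i) (O.g ^ 2)) * key
      - T.g ^ 2 * cmDenAdd (PowerSeries.C r) (PowerSeries.C i) (O.g ^ 2) ^ 2 * hE
  · unfold cmDenAdd; compute_degree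
  · unfold cmNumAdd; compute_degree!

end cmHeight

end JPair

namespace JPair

section family

variable {R : Type*} [CommRing R] [IsDomain R] [CharZero R] {A B : R}

theorem HasLog.exists_intCast_mul {P : JPair A B} {ω : PowerSeries R} (hP : P.HasLog ω) (n : ℤ) :
    ∃ Q : JPair A B, Q.HasLog (n * ω) := by
  induction n using Int.induction_on with
  | zero => exact ⟨zero, by simpa using hasLog_zero⟩
  | succ n ih =>
    obtain ⟨Q, hQ⟩ := ih
    refine ⟨Q.add P, ?_⟩
    have := hQ.add hP
    convert this using 1; push_cast; ring
  | pred n ih =>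
    obtain ⟨Q, hQ⟩ := ih
    refine ⟨Q.add P.neg, ?_⟩
    have := hQ.add hP.neg
    convert this using 1; push_cast; ring

variable {k : Type*} [Field k] (f : R →+* k)

theorem HasLog.isSum_map {P Q S : JPair A B} {ω ψ : PowerSeries R} (hP : P.HasLog ω)
    (hQ : Q.HasLog ψ) (hS : S.HasLog (ω + ψ)) : IsSum (P.map f) (Q.map f) (S.map f) := by
  obtain ⟨e1, e2⟩ := hS.unique (hP.add hQ)
  have h1 := congrArg (PowerSeries.map f) (add_g P Q)
  have h2 := congrArg (PowerSeries.map f) (add_Y P Q)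
  rw [← e1] at h1
  rw [← e2] at h2
  simp only [map_mul, map_sub, map_add, map_pow, map_one, map_ofNat, PowerSeries.map_C] at h1 h2
  exact ⟨h1, h2⟩

omit [IsDomain R] [CharZero R] in
theorem map_neg' (Q : JPair A B) : (Q.map f).neg = Q.neg.map f := by
  simp [neg, map]

theorem exists_isFamily {P S : JPair A B} {ω ψ : PowerSeries R} (hP : P.HasLog ω)
    (hS : S.HasLog ψ) : ∃ W : ℤ → ℤ → JPair A B, (∀ m n, (W m n).HasLog (m * ω + n * ψ)) ∧
      W 1 0 = P ∧ W 0 1 = S ∧ IsFamily fun m n => (W m n).map f := by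
  classical
  have h : ∀ m n : ℤ, ∃ Q : JPair A B, Q.HasLog (m * ω + n * ψ) ∧
      ((m, n) = (1, 0) → Q = P) ∧ ((m, n) = (0, 1) → Q = S) := by
    intro m n
    by_cases h1 : (m, n) = (1, 0)
    · obtain ⟨rfl, rfl⟩ := Prod.mk.inj h1
      exact ⟨P, by simpa using hP, by simp, by simp⟩
    by_cases h2 : (m, n) = (0, 1)
    · obtain ⟨rfl, rfl⟩ := Prod.mk.inj h2
      exact ⟨S, by simpa using hS, by simp, by simp⟩
    obtain ⟨Q, hQ⟩ := hP.exists_intCast_mul m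
    obtain ⟨Q', hQ'⟩ := hS.exists_intCast_mul n
    exact ⟨Q.add Q', hQ.add hQ', fun h => absurd h h1, fun h => absurd h h2⟩
  choose W hW hW1 hW2 using h
  refine ⟨W, hW, hW1 1 0 rfl, hW2 0 1 rfl, ⟨fun a b c d => ?_, fun a b c d => ?_⟩⟩
  · apply (hW a b).isSum_map f (hW c d)
    convert hW (a + c) (b + d) using 1; push_cast; ring
  · simp only [map_neg']
    apply (hW a b).isSum_map f (hW c d).neg
    convert hW (a - c) (b - d) using 1; push_cast; ring

end family

section frobenius

variable {p : ℕ} [Fact p.Prime]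

theorem prime_cast_ne_zero (q : ℕ) (hq : q.Prime) (h : q < p) : (q : ZMod p) ≠ 0 := by
  intro h0
  have := (ZMod.natCast_eq_zero_iff q p).1 h0
  have := Nat.le_of_dvd hq.pos this
  omega

theorem exists_hasLog_frobenius (hp : 19 < p) {u v : ℤ} (huv : (p : ℤ) = u ^ 2 + 5 * v ^ 2)
    {r i : ℤ_[p]} (hr : r ^ 2 = 5) (hi : i ^ 2 = -1) {P : JPair 4 (2 + r)}
    {ω : PowerSeries ℤ_[p]} (hP : P.HasLog ω) (hP1 : PowerSeries.coeff 1 P.g = 1)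
    (hβ : (p : ℤ_[p]) ∣ u - v * (i * r)) :
    ∃ G : JPair 4 (2 + r), G.HasLog (PowerSeries.C (u - v * (i * r)) * ω) ∧
      (G.map PadicInt.toZMod).g ^ 2 = ((P.map PadicInt.toZMod).g ^ p) ^ 2 := by
  obtain ⟨S, hS⟩ := exists_isCM rfl rfl hr hi P
  have hSl := hS.hasLog hr hP
  obtain ⟨W, hW, hW1, hW2, hF⟩ := exists_isFamily PadicInt.toZMod hP hSl
  have hG : (W u (-v)).HasLog (PowerSeries.C (u - v * (i * r)) * ω) := by
    have := hW u (-v)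
    convert this using 1
    simp only [map_sub, map_mul, map_intCast]; push_cast; ring
  refine ⟨W u (-v), hG, ?_⟩
  set ρ := PadicInt.toZMod r with hρ
  have hρ2 : ρ ^ 2 = 5 := by rw [hρ, ← map_pow, hr, map_ofNat]
  have hι2 : (PadicInt.toZMod i) ^ 2 = -1 := by rw [← map_pow, hi, map_neg, map_one]
  have hA : PadicInt.toZMod (4 : ℤ_[p]) = 4 := map_ofNat _ _
  have hB : PadicInt.toZMod (2 + r) = 2 + ρ := by rw [map_add, map_ofNat]
  have n2 : (2 : ZMod p) ≠ 0 := prime_cast_ne_zero 2 Nat.prime_two (by omega)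
  have n3 : (3 : ZMod p) ≠ 0 := prime_cast_ne_zero 3 Nat.prime_three (by omega)
  have n5 : (5 : ZMod p) ≠ 0 := prime_cast_ne_zero 5 Nat.prime_five (by omega)
  have n11 : (11 : ZMod p) ≠ 0 := prime_cast_ne_zero 11 (by norm_num) (by omega)
  have n19 : (19 : ZMod p) ≠ 0 := prime_cast_ne_zero 19 (by norm_num) (by omega)
  have hB0 : 2 + ρ ≠ 0 := by
    intro h
    exact one_ne_zero (α := ZMod p) (by linear_combination (ρ - 2) * h - hρ2)
  have hB1 : 2 - ρ ≠ 0 := by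
    intro h
    exact one_ne_zero (α := ZMod p) (by linear_combination -(ρ + 2) * h - hρ2)
  have hAB : (4 : ZMod p) ^ 2 - 4 * (2 + ρ) ≠ 0 := by
    have := mul_ne_zero (pow_ne_zero 2 n2) hB1
    intro h; apply this; linear_combination h
  have h1 : (4 : ZMod p) ^ 2 - 3 * (2 + ρ) ≠ 0 := by
    intro h
    apply mul_ne_zero n5 n11
    linear_combination (10 + 3 * ρ) * h + 9 * hρ2
  have h2 : 2 * (4 : ZMod p) ^ 2 - 9 * (2 + ρ) ≠ 0 := by
    intro h
    apply mul_ne_zero n11 n19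
    linear_combination -(14 + 9 * ρ) * h - 81 * hρ2
  have h4 : (4 : ZMod p) ≠ 0 := by
    have := pow_ne_zero 2 n2
    intro h; apply this; linear_combination h
  have hO1 : PowerSeries.coeff 1 (P.map PadicInt.toZMod).g = 1 := by
    simp [map, hP1]
  have hO : (P.map PadicInt.toZMod).g ≠ 0 := by
    intro h; rw [h] at hO1; simp at hO1
  have hO' : PowerSeries.derivative (ZMod p) (P.map PadicInt.toZMod).g ≠ 0 := by
    intro h
    have := congrArg (PowerSeries.coeff 0) h
    rw [PowerSeries.coeff_derivative, hO1] at this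
    simp at this
  have hCM : IsCM ρ (PadicInt.toZMod i) (P.map PadicInt.toZMod) (S.map PadicInt.toZMod) := by
    have e1 := congrArg (PowerSeries.map PadicInt.toZMod) hS.1
    have e2 := congrArg (PowerSeries.map PadicInt.toZMod) hS.2
    simp only [cmDen, cmNum, cmOrd, map_mul, map_add, map_neg, map_pow, map_one, map_ofNat,
      PowerSeries.map_C] at e1 e2
    exact ⟨e1, e2⟩
  have hCM' : IsCM ρ (-PadicInt.toZMod i) (P.map PadicInt.toZMod)
      (S.map PadicInt.toZMod).neg := by
    obtain ⟨e1, e2⟩ := hCM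
    refine ⟨?_, e2⟩
    simp only [neg, cmNum, map_neg] at e1 ⊢
    linear_combination -e1
  have s1 := hF.add 1 0 0 1
  have s2 := hF.sub 1 0 0 1
  simp only [hW1, hW2] at s1 s2
  norm_num at s1 s2
  obtain ⟨d, hd, h11⟩ := hCM.hasHt_add n2 hρ2 hι2 hA hB (by rw [hB]; exact hB0) hO s1
  obtain ⟨d', hd', h11'⟩ := hCM'.hasHt_add n2 hρ2 (by rw [neg_sq]; exact hι2) hA hB
    (by rw [hB]; exact hB0) hO s2
  have hht := IsFamily.hasHt hO hF n2 (by rw [hB]; exact hB0) (by rw [hA, hB]; exact hAB)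
    (by simp only [hW1]; exact hasHt_self _)
    (by simp only [hW2]; exact hCM.hasHt n2 hρ2 hι2 hB (by rw [hB]; exact hB0)) h11 hd h11' hd'
    u (-v)
  have hpe : (u ^ 2 + 5 * (-v) ^ 2).toNat = p := by
    rw [neg_sq, ← huv]; rfl
  rw [hpe] at hht
  refine HasHt.sq_eq (by omega) hO hO' n3 (by rw [hA]; exact h4) (by rw [hA, hB]; exact h1)
    (by rw [hA, hB]; exact h2) (by rw [hA, hB]; exact hAB) (by rw [hB]; exact hB0) hht ?_
  have e := congrArg (PowerSeries.map PadicInt.toZMod) hG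
  have e0 : PadicInt.toZMod (u - v * (i * r) : ℤ_[p]) = 0 := by
    obtain ⟨c, hc⟩ := hβ
    rw [hc, map_mul, map_natCast, CharP.cast_eq_zero, zero_mul]
  rw [map_mul, map_mul, PowerSeries.map_C, e0, map_zero, zero_mul, zero_mul] at e
  rw [← e]
  ext n
  simp [PowerSeries.coeff_derivative, map]

end frobenius

end JPair

namespace PowerSeries

variable {p : ℕ} [Fact p.Prime]

theorem expand_prime_eq_pow (hp0 : p ≠ 0) (f : PowerSeries (ZMod p)) :
    expand p hp0 f = f ^ p := by
  have h := MvPowerSeries.map_frobenius_expand p hp0 (f := f)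
  rw [ZMod.frobenius_zmod, MvPowerSeries.map_id] at h
  exact h

theorem derivative_expand {R : Type*} [CommRing R] {n : ℕ} (hn : n ≠ 0) (f : PowerSeries R) :
    derivative R (expand n hn f) = C (n : R) * X ^ (n - 1) * expand n hn (derivative R f) := by
  ext m
  have e : C (n : R) * X ^ (n - 1) * expand n hn (derivative R f) =
      C (n : R) * (expand n hn (derivative R f) * X ^ (n - 1)) := by ring
  rw [e, coeff_derivative, coeff_C_mul, coeff_mul_X_pow']
  by_cases h : n ∣ m + 1
  · obtain ⟨q, hq⟩ := h
    obtain ⟨q, rfl⟩ : ∃ q', q = q' + 1 := by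
      refine ⟨q - 1, ?_⟩
      have : q ≠ 0 := by rintro rfl; omega
      omega
    have hm : m - (n - 1) = n * q := by
      rw [mul_add] at hq; omega
    have hm' : n - 1 ≤ m := by rw [mul_add] at hq; omega
    rw [hq, coeff_expand_mul, if_pos hm', hm, coeff_expand_mul, coeff_derivative]
    have : (m : R) + 1 = n * (q + 1) := by
      have := congrArg (Nat.cast : ℕ → R) hq
      push_cast at this; exact this
    rw [this]; ring
  · rw [coeff_expand_of_not_dvd n hn f h, zero_mul]
    split_ifs with h1
    · rw [coeff_expand_of_not_dvd n hn, mul_zero]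
      rintro ⟨q, hq⟩
      apply h
      exact ⟨q + 1, by rw [mul_add]; omega⟩
    · rw [mul_zero]

theorem exists_eq_C_mul_of_map_toZMod {f : PowerSeries ℤ_[p]} (h : map PadicInt.toZMod f = 0) :
    ∃ g, f = C (p : ℤ_[p]) * g := by
  have h1 : ∀ n, ∃ c, coeff n f = p * c := by
    intro n
    have := congrArg (coeff n) h
    rw [coeff_map, map_zero, ← RingHom.mem_ker, PadicInt.ker_toZMod,
      PadicInt.maximalIdeal_eq_span_p, Ideal.mem_span_singleton] at this
    exact this
  choose g hg using h1
  refine ⟨mk g, ?_⟩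
  ext n
  rw [coeff_C_mul, coeff_mk, hg]

end PowerSeries

namespace JPair

open PowerSeries

variable {p : ℕ} [Fact p.Prime]

theorem HasLog.expand {R : Type*} [CommRing R] {A B : R} {P : JPair A B} {ω : PowerSeries R}
    (h : P.HasLog ω) (n : ℕ) (hn : n ≠ 0) :
    (P.expand n hn).HasLog (C (n : R) * X ^ (n - 1) * PowerSeries.expand n hn ω) := by
  unfold HasLog at *
  simp only [JPair.expand]
  rw [derivative_expand, h, map_mul]; ring

theorem HasLog.exists_eq_derivative {A B : ℤ_[p]} {P : JPair A B} {ψ h : PowerSeries ℤ_[p]}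
    (hp : p ≠ 2) (hP : P.HasLog ψ) (hA : A = 4) (hg : P.g = C (p : ℤ_[p]) * h) :
    ∃ k, ψ = C (p : ℤ_[p]) * derivative _ h - 2 * C (p : ℤ_[p]) ^ 3 * (h ^ 2 * derivative _ h) +
      C (p : ℤ_[p]) ^ 4 * k := by
  subst hA
  have h2 : IsUnit (2 : ℤ_[p]) := by
    rw [PadicInt.isUnit_iff]
    by_contra hn
    have := (PadicInt.norm_natCast_lt_one_iff (n := 2) (p := p)).1
      (lt_of_le_of_ne (PadicInt.norm_le_one _) (by exact_mod_cast hn))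
    exact hp ((Nat.prime_dvd_prime_iff_eq Fact.out Nat.prime_two).1 this)
  have hu : IsUnit (P.Y + 1 + 2 * C (p : ℤ_[p]) ^ 2 * h ^ 2) := by
    rw [isUnit_iff_constantCoeff]
    have h0 : p * constantCoeff h = 0 := by
      have := P.g0
      rwa [hg, map_mul, constantCoeff_C] at this
    have : constantCoeff h = 0 := by
      rcases mul_eq_zero.1 h0 with h | h
      · exact absurd h (by exact_mod_cast (Fact.out : p.Prime).ne_zero)
      · exact h
    simp only [map_add, P.Y0, map_one, map_mul, map_pow, this]
    norm_num
    exact h2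
  obtain ⟨E, hE⟩ := hu.exists_right_inv
  have hY := P.eqn
  have hl := hP
  unfold HasLog at hl
  rw [hg] at hY hl
  rw [Derivation.leibniz, derivative_C, smul_zero, add_zero, smul_eq_mul] at hl
  rw [map_ofNat] at hY
  set c : PowerSeries ℤ_[p] := C (p : ℤ_[p])
  have hY1 : P.Y = 1 + 2 * c ^ 2 * h ^ 2 + c ^ 4 * ((C B - 4) * h ^ 4 * E) := by
    have : (P.Y - 1 - 2 * c ^ 2 * h ^ 2) * (P.Y + 1 + 2 * c ^ 2 * h ^ 2) =
        c ^ 4 * (C B - 4) * h ^ 4 := by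
      linear_combination hY
    linear_combination E * this - (P.Y - 1 - 2 * c ^ 2 * h ^ 2) * hE
  generalize (C B - 4) * h ^ 4 * E = K at hY1
  rw [hY1] at hl
  refine ⟨ψ * (4 * h ^ 4 - K * (1 - 2 * c ^ 2 * h ^ 2)), ?_⟩
  linear_combination (-1 + 2 * c ^ 2 * h ^ 2) * hl

theorem HasLog.pow_dvd_coeff {A B : ℤ_[p]} {P : JPair A B} {ψ h : PowerSeries ℤ_[p]}
    (hp : 3 < p) (hP : P.HasLog ψ) (hA : A = 4) (hg : P.g = C (p : ℤ_[p]) * h) {k : ℕ}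
    (hk : k ≤ 3) : (p : ℤ_[p]) ^ (k + 1) ∣ coeff (p ^ k - 1) ψ := by
  obtain ⟨K, hK⟩ := hP.exists_eq_derivative (by omega) hA hg
  have hN : p ^ k - 1 + 1 = p ^ k := Nat.sub_add_cancel (Nat.one_le_pow _ _ (by omega))
  have hN' : (((p ^ k - 1 : ℕ) : ℤ_[p]) + 1) = p ^ k := by exact_mod_cast hN
  have e1 : coeff (p ^ k - 1) (derivative _ h) = coeff (p ^ k) h * (p : ℤ_[p]) ^ k := by
    rw [coeff_derivative, hN, hN']
  have e2 : (3 : ℤ_[p]) * coeff (p ^ k - 1) (h ^ 2 * derivative _ h) =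
      coeff (p ^ k) (h ^ 3) * (p : ℤ_[p]) ^ k := by
    have : (3 : PowerSeries ℤ_[p]) * (h ^ 2 * derivative ℤ_[p] h) = derivative ℤ_[p] (h ^ 3) := by
      rw [Derivation.leibniz_pow]; simp
    have h2 := congrArg (coeff (p ^ k - 1)) this
    rw [coeff_derivative, hN, hN', ← map_ofNat C, coeff_C_mul] at h2
    exact h2
  have h3 : IsUnit (3 : ℤ_[p]) := by
    rw [PadicInt.isUnit_iff]
    by_contra hn
    have := (PadicInt.norm_natCast_lt_one_iff (n := 3) (p := p)).1
      (lt_of_le_of_ne (PadicInt.norm_le_one _) (by exact_mod_cast hn))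
    have := Nat.le_of_dvd (by norm_num) this
    omega
  obtain ⟨t, ht⟩ := h3.exists_right_inv
  have e3 : coeff (p ^ k - 1) (h ^ 2 * derivative _ h) = t * coeff (p ^ k) (h ^ 3) * p ^ k := by
    linear_combination t * e2 - coeff (p ^ k - 1) (h ^ 2 * derivative _ h) * ht
  have e4 : ψ = C (p : ℤ_[p]) * derivative _ h -
      C (2 * (p : ℤ_[p]) ^ 3) * (h ^ 2 * derivative _ h) + C ((p : ℤ_[p]) ^ 4) * K := by
    rw [hK]; simp only [map_mul, map_pow, map_ofNat]
  rw [e4, map_add, map_sub, coeff_C_mul, coeff_C_mul, coeff_C_mul, e1, e3]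
  refine dvd_add (dvd_sub ?_ ?_) ?_
  · exact ⟨coeff (p ^ k) h, by ring⟩
  · exact ⟨2 * p ^ 2 * t * coeff (p ^ k) (h ^ 3), by ring⟩
  · exact Dvd.dvd.mul_right (pow_dvd_pow _ (by omega)) _

theorem exists_sign_congr (hp : 19 < p) {u v : ℤ} (huv : (p : ℤ) = u ^ 2 + 5 * v ^ 2)
    {r i : ℤ_[p]} (hr : r ^ 2 = 5) (hi : i ^ 2 = -1) {P : JPair 4 (2 + r)}
    {ω : PowerSeries ℤ_[p]} (hP : P.HasLog ω) (hP1 : PowerSeries.coeff 1 P.g = 1)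
    (hα : IsUnit (u + v * (i * r))) :
    ∃ ε : ℤ_[p], ε ^ 2 = 1 ∧ ∀ k < 3, (p : ℤ_[p]) ^ (k + 1) ∣
      coeff (p ^ (k + 1) - 1) ω - ε * (u + v * (i * r)) * coeff (p ^ k - 1) ω := by
  have hp0 : p ≠ 0 := by omega
  have hαβ : (u + v * (i * r)) * (u - v * (i * r)) = (p : ℤ_[p]) := by
    have : (p : ℤ_[p]) = u ^ 2 + 5 * v ^ 2 := by exact_mod_cast congrArg (Int.cast : ℤ → ℤ_[p]) huv
    linear_combination -this - v ^ 2 * r ^ 2 * hi + v ^ 2 * hr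
  have hβ : (p : ℤ_[p]) ∣ u - v * (i * r) := by
    obtain ⟨t, ht⟩ := hα.exists_right_inv
    exact ⟨t, by linear_combination t * hαβ - (u - v * (i * r)) * ht⟩
  obtain ⟨G, hG, hsq⟩ := exists_hasLog_frobenius hp huv hr hi hP hP1 hβ
  set π := (PadicInt.toZMod : ℤ_[p] →+* ZMod p)
  have hF : ∃ (ε : ℤ_[p]) (F : JPair 4 (2 + r)), ε ^ 2 = 1 ∧
      F.HasLog (C ε * (C (p : ℤ_[p]) * X ^ (p - 1) * PowerSeries.expand p hp0 ω)) ∧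
      (G.map π).g = (F.map π).g := by
    have hl := hP.expand p hp0
    have hg : ((P.expand p hp0).map π).g = (P.map π).g ^ p := by
      rw [← expand_prime_eq_pow hp0]
      simp [map, JPair.expand, map_expand]
    rcases sq_eq_sq_iff_eq_or_eq_neg.1 hsq with h | h
    · exact ⟨1, P.expand p hp0, one_pow _, by simpa using hl, by rw [hg, h]⟩
    · refine ⟨-1, (P.expand p hp0).neg, by norm_num, by simpa using hl.neg, ?_⟩
      rw [h, ← hg]; simp [map, neg]
  obtain ⟨ε, F, hε, hFl, hGF⟩ := hF
  have n2 : (2 : ZMod p) ≠ 0 := prime_cast_ne_zero 2 Nat.prime_two (by omega)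
  have hY : (G.map π).Y = (F.map π).Y := eq_Y_of_sq_eq n2 (by rw [hGF])
  have he := hG.add hFl.neg
  have hz : PowerSeries.map π (G.add F.neg).g = 0 := by
    have h1 := congrArg (PowerSeries.map π) (add_g G F.neg)
    apply ((isUnit_den G F.neg).map (PowerSeries.map π)).mul_right_cancel
    rw [← map_mul, h1, zero_mul]
    simp only [map, neg] at hGF hY ⊢
    rw [map_add, map_mul, map_mul, hGF, hY, map_neg]; ring
  obtain ⟨h, hh⟩ := exists_eq_C_mul_of_map_toZMod hz
  refine ⟨ε, hε, fun k hk => ?_⟩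
  have hd := he.pow_dvd_coeff (by omega) rfl hh (k := k + 1) (by omega)
  have e1 : coeff (p ^ (k + 1) - 1) (C ε * (C (p : ℤ_[p]) * X ^ (p - 1) * PowerSeries.expand p hp0 ω)) =
      ε * p * coeff (p ^ k - 1) ω := by
    have : C ε * (C (p : ℤ_[p]) * X ^ (p - 1) * PowerSeries.expand p hp0 ω) =
        C (ε * p) * (PowerSeries.expand p hp0 ω * X ^ (p - 1)) := by
      rw [map_mul]; ring
    have hpk : 1 ≤ p ^ k := Nat.one_le_pow _ _ (by omega)
    have h3 : p ≤ p * p ^ k := Nat.le_mul_of_pos_right _ hpk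
    have h4 : p ^ (k + 1) - 1 - (p - 1) = p * (p ^ k - 1) := by
      rw [pow_succ', Nat.mul_sub, mul_one]; omega
    rw [this, coeff_C_mul, coeff_mul_X_pow', if_pos (by rw [pow_succ']; omega), h4,
      coeff_expand_mul]
  rw [map_add, map_neg, e1, coeff_C_mul] at hd
  have hpp : (p : ℤ_[p]) ≠ 0 := by exact_mod_cast hp0
  have h5 : (p : ℤ_[p]) * p ^ (k + 1) ∣ p * (coeff (p ^ (k + 1) - 1) ω -
      ε * (u + v * (i * r)) * coeff (p ^ k - 1) ω) := by
    rw [← pow_succ']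
    refine (hd.mul_left (u + v * (i * r))).trans (dvd_of_eq ?_)
    linear_combination coeff (p ^ (k + 1) - 1) ω * hαβ
  exact (mul_dvd_mul_iff_left hpp).1 h5

end JPair

/-- The coefficients of the shifted Legendre polynomials. -/
def legendreCoeff (m k : ℕ) : ℕ := m.choose k * (m + k).choose k

theorem legendreCoeff_zero (m : ℕ) : legendreCoeff m 0 = 1 := by simp [legendreCoeff]

theorem legendreCoeff_eq_zero {m k : ℕ} (h : m < k) : legendreCoeff m k = 0 := by
  rw [legendreCoeff, Nat.choose_eq_zero_of_lt h, zero_mul]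

theorem legendreCoeff_succ_right (m k : ℕ) :
    (legendreCoeff m (k + 1) : ℤ) * (k + 1) ^ 2 = (m - k) * (m + k + 1) * legendreCoeff m k := by
  have h1 : ((m.choose (k + 1) : ℕ) : ℤ) * (k + 1) = m.choose k * (m - k) := by
    rcases le_or_gt k m with h | h
    · have := Nat.choose_succ_right_eq m k
      zify [h] at this; exact this
    · rw [Nat.choose_eq_zero_of_lt h, Nat.choose_eq_zero_of_lt (by omega)]; simp
  have h2 : (((m + (k + 1)).choose (k + 1) : ℕ) : ℤ) * (k + 1) =
      (m + k + 1) * (m + k).choose k := by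
    have := Nat.add_one_mul_choose_eq (m + k) k
    zify at this
    rw [← add_assoc]
    linear_combination -this
  unfold legendreCoeff
  push_cast
  linear_combination ((m + (k + 1)).choose (k + 1) : ℤ) * (k + 1) * h1 +
    (m.choose k : ℤ) * (m - k) * h2

theorem legendreCoeff_succ_left (m k : ℕ) :
    ((m : ℤ) + 1 - k) * legendreCoeff (m + 1) k = (m + 1 + k) * legendreCoeff m k := by
  induction k with
  | zero => simp [legendreCoeff_zero]
  | succ k ih =>
    have h1 := legendreCoeff_succ_right (m + 1) k
    have h2 := legendreCoeff_succ_right m k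
    have h0 : ((k : ℤ) + 1) ^ 2 ≠ 0 := by positivity
    apply mul_right_cancel₀ h0
    push_cast at h1 h2 ⊢
    linear_combination (m - k : ℤ) * h1 - (m + 1 + (k + 1)) * h2 + (m - k) * (m + 1 + k + 1) * ih

theorem legendreCoeff_recurrence (m k : ℕ) :
    ((m : ℤ) + 2) * legendreCoeff (m + 2) (k + 1) =
      (2 * m + 3) * (legendreCoeff (m + 1) (k + 1) + 2 * legendreCoeff (m + 1) k) -
        (m + 1) * legendreCoeff m (k + 1) := by
  have h1 := legendreCoeff_succ_right (m + 1) k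
  have h2 := legendreCoeff_succ_right m k
  have h3 := legendreCoeff_succ_right (m + 2) k
  have h4 := legendreCoeff_succ_left m k
  have h5 := legendreCoeff_succ_left (m + 1) k
  have h0 : ((k : ℤ) + 1) ^ 2 ≠ 0 := by positivity
  apply mul_right_cancel₀ h0
  push_cast at *
  linear_combination (m + 2 : ℤ) * h3 - (2 * m + 3 : ℤ) * h1 + (m + 1 : ℤ) * h2 +
    (m + 2 : ℤ) * (m + k + 3) * h5 - (m + 1 : ℤ) * (m - k) * h4

/-- The Legendre polynomial of degree `m` at `1 + 2 * y`. -/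
def shiftedLegendreEval {R : Type*} [CommRing R] (y : R) (m : ℕ) : R :=
  ∑ k ∈ range (m + 1), (legendreCoeff m k : R) * y ^ k

section legendre

variable {R : Type*} [CommRing R] (y : R)

theorem shiftedLegendreEval_eq {m M : ℕ} (h : m < M) :
    shiftedLegendreEval y m = ∑ k ∈ range M, (legendreCoeff m k : R) * y ^ k := by
  refine sum_subset (range_subset_range.2 h) fun k _ hk => ?_
  rw [legendreCoeff_eq_zero (by simpa using hk)]; simp

theorem shiftedLegendreEval_recurrence (m : ℕ) :
    ((m : R) + 2) * shiftedLegendreEval y (m + 2) =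
      (2 * m + 3) * (1 + 2 * y) * shiftedLegendreEval y (m + 1) -
        (m + 1) * shiftedLegendreEval y m := by
  rw [shiftedLegendreEval_eq y (show m + 2 < m + 2 + 1 + 1 by omega),
    shiftedLegendreEval_eq y (show m < m + 2 + 1 + 1 by omega)]
  have e : (1 + 2 * y) * shiftedLegendreEval y (m + 1) =
      ∑ k ∈ range (m + 2 + 1 + 1), (legendreCoeff (m + 1) k : R) * y ^ k +
      2 * ∑ k ∈ range (m + 2 + 1), (legendreCoeff (m + 1) k : R) * y ^ (k + 1) := by
    rw [add_mul, one_mul, shiftedLegendreEval_eq y (show m + 1 < m + 2 + 1 + 1 by omega)]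
    congr 1
    rw [← shiftedLegendreEval_eq y (show m + 1 < m + 2 + 1 + 1 by omega),
      shiftedLegendreEval_eq y (show m + 1 < m + 2 + 1 by omega), mul_sum, mul_sum]
    exact sum_congr rfl fun k _ => by ring
  rw [mul_assoc, e]
  simp only [sum_range_succ' _ (m + 2 + 1), legendreCoeff_zero]
  have : ∀ k, ((m : R) + 2) * legendreCoeff (m + 2) (k + 1) =
      (2 * m + 3) * (legendreCoeff (m + 1) (k + 1) + 2 * legendreCoeff (m + 1) k) -
        (m + 1) * legendreCoeff m (k + 1) := fun k => by
    exact_mod_cast congrArg (Int.cast : ℤ → R) (legendreCoeff_recurrence m k)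
  have h2 : ∑ k ∈ range (m + 2 + 1), (((m : R) + 2) * legendreCoeff (m + 2) (k + 1)) * y ^ (k + 1)
      = ∑ k ∈ range (m + 2 + 1), ((2 * (m : R) + 3) * (legendreCoeff (m + 1) (k + 1) +
        2 * legendreCoeff (m + 1) k) - (m + 1) * legendreCoeff m (k + 1)) * y ^ (k + 1) :=
    sum_congr rfl fun k _ => by rw [this]
  simp only [sub_mul, mul_add, add_mul, sum_sub_distrib, sum_add_distrib, mul_assoc,
    ← mul_sum] at h2 ⊢
  simp only [Nat.cast_one, one_mul, pow_zero, mul_one]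
  linear_combination h2

/-- The generating function of the Legendre polynomials. -/
def legendreSeries : PowerSeries R := PowerSeries.mk (shiftedLegendreEval y)

open PowerSeries

theorem legendreSeries_deriv :
    (1 - 2 * C (1 + 2 * y) * X + X ^ 2) * derivative R (legendreSeries y) =
      (C (1 + 2 * y) - X) * legendreSeries y := by
  have e : (1 - 2 * C (1 + 2 * y) * X + X ^ 2) * derivative R (legendreSeries y) =
    derivative R (legendreSeries y) - C (2 * (1 + 2 * y)) * (X * derivative R (legendreSeries y)) +
    X * (X * derivative R (legendreSeries y)) := by
    rw [map_mul, map_ofNat]; ring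
  rw [e, sub_mul]
  have s0 : shiftedLegendreEval y 0 = 1 := by simp [shiftedLegendreEval, legendreCoeff_zero]
  have s1 : shiftedLegendreEval y 1 = 1 + 2 * y := by
    simp [shiftedLegendreEval, legendreCoeff, sum_range_succ]
  have hrec := shiftedLegendreEval_recurrence y
  generalize 1 + 2 * y = ξ at *
  ext n
  rcases n with _ | _ | n
  · simp only [map_add, map_sub, coeff_C_mul, coeff_derivative, legendreSeries, coeff_mk,
      coeff_zero_X_mul, s0, s1]
    simp
  · have := hrec 0
    simp only [map_add, map_sub, coeff_C_mul, coeff_succ_X_mul, coeff_derivative, legendreSeries,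
      coeff_mk, coeff_zero_X_mul, s0, s1, zero_add] at this ⊢
    push_cast at this ⊢
    linear_combination this
  · have := hrec (n + 1)
    simp only [map_add, map_sub, coeff_C_mul, coeff_succ_X_mul, coeff_derivative, legendreSeries,
      coeff_mk] at this ⊢
    push_cast at this ⊢
    linear_combination this

theorem legendreSeries_sq [IsDomain R] [CharZero R] :
    legendreSeries y ^ 2 * (1 - 2 * C (1 + 2 * y) * X + X ^ 2) = 1 := by
  have h := legendreSeries_deriv y
  apply derivative.ext
  · have c2 : derivative R 2 = 0 := by
      rw [← map_ofNat (C : R →+* _), derivative_C]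
    simp only [Derivation.leibniz, Derivation.leibniz_pow, map_add, map_sub, smul_eq_mul,
      nsmul_eq_mul, derivative_C, derivative_X, Derivation.map_one_eq_zero, c2] at h ⊢
    push_cast
    linear_combination 2 * legendreSeries y * h
  · simp [legendreSeries, shiftedLegendreEval, legendreCoeff_zero]

end legendre

namespace JPair

open PowerSeries

variable {R : Type*} [CommRing R] [IsDomain R] [CharZero R]

theorem exists_base {B y : R} (h : 4 * y = -B) : ∃ (P : JPair 4 B) (ω : PowerSeries R),
    P.HasLog ω ∧ coeff 1 P.g = 1 ∧ ∀ m, coeff (4 * m) ω = shiftedLegendreEval y m := by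
  obtain ⟨E, hE, hE1⟩ : ∃ E : PowerSeries R, (1 - X ^ 2) * E = 1 ∧ constantCoeff E = 1 := by
    have h : constantCoeff (1 - X ^ 2 : PowerSeries R) = ((1 : Rˣ) : R) := by simp
    have h2 := PowerSeries.mul_invOfUnit _ 1 h
    refine ⟨_, h2, ?_⟩
    have h3 := congrArg constantCoeff h2
    rwa [map_mul, h, Units.val_one, one_mul, map_one] at h3
  have hT := congrArg (PowerSeries.expand 4 (by norm_num)) (legendreSeries_sq y)
  set T := PowerSeries.expand 4 (by norm_num) (legendreSeries y) with hTdef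
  have hT1 : constantCoeff T = 1 := by
    rw [hTdef, constantCoeff_expand]
    simp [legendreSeries, shiftedLegendreEval, legendreCoeff_zero]
  have hD : PowerSeries.expand 4 (by norm_num) (1 - 2 * C (1 + 2 * y) * X + X ^ 2) =
      1 + (C B - 2) * X ^ 4 + X ^ 8 := by
    have : C (1 + 2 * y) * 2 = (2 - C B : PowerSeries R) := by
      have h2 : (1 + 2 * y) * 2 = 2 - B := by linear_combination h
      rw [← map_ofNat C 2, ← map_mul, h2, map_sub]
    simp only [map_add, map_sub, map_mul, map_pow, expand_X, expand_C, map_one, map_ofNat] at this ⊢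
    linear_combination -X ^ 4 * this
  rw [map_mul, map_pow, map_one, hD, ← hTdef] at hT
  have hE' : derivative R E = 2 * X * E ^ 2 := by
    have := congrArg (derivative R) hE
    simp only [Derivation.leibniz, Derivation.leibniz_pow, map_sub, smul_eq_mul, nsmul_eq_mul,
      derivative_X, Derivation.map_one_eq_zero] at this
    push_cast at this
    linear_combination E * this - derivative R E * hE
  refine ⟨⟨X * E, E ^ 2 * T * (1 + (C B - 2) * X ^ 4 + X ^ 8), by simp, by simp [hE1, hT1], ?_⟩,
    (1 + X ^ 2) * T, ?_, ?_, fun m => ?_⟩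
  · have h4 : (C (4 : R) : PowerSeries R) = 4 := map_ofNat C 4
    rw [h4]
    have e1 : (1 - X ^ 2) ^ 2 * E ^ 2 = 1 := by rw [← mul_pow, hE, one_pow]
    have e2 : (1 - X ^ 2) ^ 4 * E ^ 4 = 1 := by rw [← mul_pow, hE, one_pow]
    linear_combination E ^ 4 * (1 + (C B - 2) * X ^ 4 + X ^ 8) * hT + e2 + 4 * X ^ 2 * E ^ 2 * e1
  · rw [HasLog]
    simp only [Derivation.leibniz, smul_eq_mul, derivative_X, hE']
    linear_combination -(1 + X ^ 2) * E ^ 2 * hT - E * hE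
  · exact (coeff_succ_X_mul 0 E).trans ((coeff_zero_eq_constantCoeff_apply E).trans hE1)
  · rw [add_mul, one_mul, map_add]
    have : coeff (4 * m) (X ^ 2 * T) = 0 := by
      rcases m with _ | m
      · simp
      · rw [show 4 * (m + 1) = 4 * m + 2 + 2 by ring, coeff_X_pow_mul, hTdef,
          coeff_expand_of_not_dvd _ _ _ (by omega)]
    rw [this, add_zero, hTdef, coeff_expand_mul]
    simp [legendreSeries]

end JPair

section clausen

open Polynomial

/-- The polynomial whose value at `y` is the Legendre polynomial at `1 + 2 * y`. -/
noncomputable def legendrePoly (m : ℕ) : ℤ[X] :=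
  ∑ k ∈ range (m + 1), C (legendreCoeff m k : ℤ) * X ^ k

/-- The polynomial whose composite with `y + y²` is the square of `legendrePoly m`. -/
noncomputable def clausenPoly (m : ℕ) : ℤ[X] :=
  ∑ k ∈ range (m + 1), C (legendreCoeff m k * (2 * k).choose k : ℤ) * X ^ k

theorem coeff_legendrePoly (m k : ℕ) : (legendrePoly m).coeff k = legendreCoeff m k := by
  simp only [legendrePoly, finsetSum_coeff, coeff_C_mul_X_pow]
  rw [sum_ite_eq]
  split_ifs with h
  · rfl
  · rw [legendreCoeff_eq_zero (by simpa using h)]; simp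

theorem coeff_clausenPoly (m k : ℕ) :
    (clausenPoly m).coeff k = legendreCoeff m k * (2 * k).choose k := by
  simp only [clausenPoly, finsetSum_coeff, coeff_C_mul_X_pow]
  rw [sum_ite_eq]
  split_ifs with h
  · rfl
  · rw [legendreCoeff_eq_zero (by simpa using h)]; simp

theorem coeff_X_mul_derivative (f : ℤ[X]) (n : ℕ) :
    (X * derivative f).coeff n = n * f.coeff n := by
  rcases n with _ | n
  · simp
  · rw [coeff_X_mul, coeff_derivative]; push_cast; ring

theorem legendrePoly_ode (m : ℕ) :
    (X + X ^ 2) * derivative (derivative (legendrePoly m)) + (1 + 2 * X) *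
      derivative (legendrePoly m) = ((m * (m + 1) : ℕ) : ℤ[X]) * legendrePoly m := by
  set L := legendrePoly m with hL
  have e : X * ((X + X ^ 2) * derivative (derivative L) + (1 + 2 * X) * derivative L -
      ((m * (m + 1) : ℕ) : ℤ[X]) * L) = X * derivative (X * derivative L) +
      X * (X * derivative (X * derivative L) + X * derivative L -
        C ((m * (m + 1) : ℕ) : ℤ) * L) := by
    simp only [derivative_mul, derivative_X, map_natCast]; ring
  rw [← sub_eq_zero]
  apply mul_left_cancel₀ (X_ne_zero (R := ℤ))
  rw [e, mul_zero]
  ext n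
  rcases n with _ | n
  · simp
  · have := legendreCoeff_succ_right m n
    rw [coeff_add, coeff_X_mul_derivative, coeff_X_mul_derivative, coeff_X_mul]
    simp only [coeff_add, coeff_sub, coeff_X_mul_derivative, coeff_C_mul,
      coeff_legendrePoly, hL, coeff_zero]
    push_cast
    linear_combination this

theorem clausenPoly_ode (m : ℕ) :
    X ^ 2 * (1 + 4 * X) * derivative (derivative (derivative (clausenPoly m))) +
      (3 * X + 18 * X ^ 2) * derivative (derivative (clausenPoly m)) +
      (1 + (12 - 4 * ((m * (m + 1) : ℕ) : ℤ[X])) * X) * derivative (clausenPoly m) -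
      2 * ((m * (m + 1) : ℕ) : ℤ[X]) * clausenPoly m = 0 := by
  set h := clausenPoly m with hh
  set N : ℤ[X] := ((m * (m + 1) : ℕ) : ℤ[X]) with hN
  have e : X * (X ^ 2 * (1 + 4 * X) * derivative (derivative (derivative h)) +
      (3 * X + 18 * X ^ 2) * derivative (derivative h) +
      (1 + (12 - 4 * N) * X) * derivative h - 2 * N * h) =
      X * derivative (X * derivative (X * derivative h)) +
      X * (C 4 * (X * derivative (X * derivative (X * derivative h))) +
        C 6 * (X * derivative (X * derivative h)) +
        C (2 - 4 * (m * (m + 1) : ℕ) : ℤ) * (X * derivative h) -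
        C (2 * (m * (m + 1) : ℕ) : ℤ) * h) := by
    simp only [derivative_mul, derivative_X, derivative_add, derivative_one, map_mul, map_sub,
      map_natCast, map_ofNat, ← hN]
    ring
  apply mul_left_cancel₀ (X_ne_zero (R := ℤ))
  rw [e, mul_zero]
  ext n
  rcases n with _ | n
  · simp
  · have h1 := legendreCoeff_succ_right m n
    have h2 : ((2 * (n + 1)).choose (n + 1) : ℤ) * (n + 1) = 2 * (2 * n + 1) * (2 * n).choose n := by
      have := Nat.succ_mul_centralBinom_succ n
      simp only [Nat.centralBinom] at this
      zify at this
      linear_combination this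
    rw [coeff_add, coeff_X_mul_derivative, coeff_X_mul_derivative, coeff_X_mul_derivative, 
      coeff_X_mul]
    simp only [coeff_add, coeff_sub, coeff_X_mul_derivative, coeff_C_mul,
      coeff_clausenPoly, hh, coeff_zero]
    push_cast
    linear_combination ((2 * (n + 1)).choose (n + 1) : ℤ) * (n + 1) * h1 +
      (legendreCoeff m n : ℤ) * (m - n) * (m + n + 1) * h2

theorem eq_zero_of_symmSquare_ode {u N : ℤ[X]} (h0 : u.coeff 0 = 0)
    (h : (X + X ^ 2) ^ 2 * derivative (derivative (derivative u)) +
      3 * (X + X ^ 2) * (1 + 2 * X) * derivative (derivative u) +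
      (1 + 6 * (X + X ^ 2) - 4 * N * (X + X ^ 2)) * derivative u -
      2 * N * (1 + 2 * X) * u = 0) : u = 0 := by
  have key : ∃ a b c d : ℤ[X], X * derivative (X * derivative (X * derivative u)) =
      X * (a * u + b * (X * derivative u) + c * (X * derivative (X * derivative u)) +
        d * (X * derivative (X * derivative (X * derivative u)))) := by
    refine ⟨2 * N * (1 + 2 * X), -((2 + X) * 2 - 3 * (3 + 2 * X) + (6 - 4 * N) * (1 + X)),
      -((2 + X) * (-3) + 3 * (3 + 2 * X)), -(2 + X), ?_⟩
    simp only [derivative_mul, derivative_X, derivative_add, derivative_one]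
    linear_combination X * h
  obtain ⟨a, b, c, d, key⟩ := key
  have step : ∀ (n : ℕ) (f : ℤ[X]), X ^ n ∣ f → X ^ n ∣ X * derivative f := fun n f hf => by
    rw [X_pow_dvd_iff] at *
    intro k hk
    rw [coeff_X_mul_derivative, hf k hk, mul_zero]
  have all : ∀ n : ℕ, X ^ n ∣ u := fun n => by
    induction n with
    | zero => simp
    | succ n ih =>
      rcases Nat.eq_zero_or_pos n with rfl | hn
      · rw [zero_add, pow_one, X_dvd_iff]; exact h0
      have h1 := step n _ ih
      have h2 := step n _ h1
      have h3 := step n _ h2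
      have h4 : X ^ (n + 1) ∣ X * derivative (X * derivative (X * derivative u)) := by
        rw [key, pow_succ']
        exact mul_dvd_mul_left _ (dvd_add (dvd_add (dvd_add (ih.mul_left _) (h1.mul_left _))
          (h2.mul_left _)) (h3.mul_left _))
      rw [X_pow_dvd_iff] at *
      intro k hk
      rcases Nat.lt_succ_iff_lt_or_eq.1 hk with hk | rfl
      · exact ih k hk
      · have := h4 k hk
        simp only [coeff_X_mul_derivative] at this
        have hk0 : (k : ℤ) ≠ 0 := by exact_mod_cast hn.ne'
        exact (mul_eq_zero.1 ((mul_eq_zero.1 ((mul_eq_zero.1 this).resolve_left hk0)).resolve_left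
          hk0)).resolve_left hk0
  ext n
  exact X_pow_dvd_iff.1 (all (n + 1)) n (Nat.lt_succ_self n)

theorem legendrePoly_sq (m : ℕ) :
    legendrePoly m ^ 2 = (clausenPoly m).comp (X + X ^ 2) := by
  rw [← sub_eq_zero]
  apply eq_zero_of_symmSquare_ode (N := ((m * (m + 1) : ℕ) : ℤ[X]))
  · have h1 : (legendrePoly m).coeff 0 = 1 := by
      rw [coeff_legendrePoly, legendreCoeff_zero]; rfl
    have h2 : (clausenPoly m).coeff 0 = 1 := by
      rw [coeff_clausenPoly, legendreCoeff_zero]; rfl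
    rw [coeff_zero_eq_eval_zero] at *
    simp [eval_comp, h1, h2]
  have hL := legendrePoly_ode m
  have hL' := congrArg derivative hL
  have hh := congrArg (fun q : ℤ[X] => q.comp (X + X ^ 2)) (clausenPoly_ode m)
  generalize legendrePoly m = L at *
  generalize clausenPoly m = h at *
  generalize m * (m + 1) = N at *
  have d2 : derivative (2 : ℤ[X]) = 0 := derivative_ofNat 2
  simp only [derivative_mul, derivative_X, derivative_add, derivative_one, derivative_zero,
    derivative_natCast, add_comp, sub_comp, mul_comp, X_comp, pow_comp, one_comp, ofNat_comp,
    natCast_comp, derivative_comp, derivative_sub, derivative_pow, zero_comp, d2, map_natCast,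
    Nat.cast_ofNat, map_ofNat] at hh hL' ⊢
  generalize h.comp (X + X ^ 2) = w0 at *
  generalize (derivative h).comp (X + X ^ 2) = w1 at *
  generalize (derivative (derivative h)).comp (X + X ^ 2) = w2 at *
  generalize (derivative (derivative (derivative h))).comp (X + X ^ 2) = w3 at *
  generalize derivative (derivative (derivative L)) = l3 at *
  generalize derivative (derivative L) = l2 at *
  generalize derivative L = l1 at *
  linear_combination (-(1 + 2 * X)) * hh + 2 * L * (X + X ^ 2) * hL' + (6 * l1 * (X + X ^ 2) + 2 * L * (1 + 2 * X)) * hL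

theorem shiftedLegendreEval_sq {R : Type*} [CommRing R] (y : R) (m : ℕ) :
    shiftedLegendreEval y m ^ 2 =
      ∑ k ∈ range (m + 1), (legendreCoeff m k * (2 * k).choose k : R) * (y * (1 + y)) ^ k := by
  have h := congrArg (eval₂ (Int.castRingHom R) y) (legendrePoly_sq m)
  rw [eval₂_comp, eval₂_pow] at h
  simp only [legendrePoly, clausenPoly, eval₂_finsetSum, eval₂_mul, eval₂_C, eval₂_pow, eval₂_X,
    eval₂_add] at h
  simp only [eq_intCast] at h
  push_cast at h
  rw [shiftedLegendreEval, h]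
  exact sum_congr rfl fun k _ => by ring

end clausen

/-- The shifted factorial `(Y + 1)(Y + 2)⋯(Y + r)`. -/
def shiftedFactorial {S : Type*} [CommRing S] (Y : S) (r : ℕ) : S :=
  ∏ j ∈ range r, (Y + (j + 1))

section shiftedFactorial

variable {S T : Type*} [CommRing S] [CommRing T]

theorem shiftedFactorial_succ (Y : S) (r : ℕ) :
    shiftedFactorial Y (r + 1) = shiftedFactorial Y r * (Y + (r + 1)) := prod_range_succ _ _

theorem map_shiftedFactorial (f : S →+* T) (Y : S) (r : ℕ) :
    f (shiftedFactorial Y r) = shiftedFactorial (f Y) r := by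
  simp [shiftedFactorial]

theorem shiftedFactorial_zero_left (r : ℕ) : shiftedFactorial (0 : S) r = (r.factorial : S) := by
  rw [shiftedFactorial, ← prod_range_add_one_eq_factorial]
  push_cast
  simp

variable {p : ℕ} [Fact p.Prime]

theorem shiftedFactorial_zmod :
    shiftedFactorial (Polynomial.X : Polynomial (ZMod p)) (p - 1) = Polynomial.X ^ (p - 1) - 1 := by
  have hp := (Fact.out : p.Prime)
  have hp2 := hp.two_le
  have hmon : shiftedFactorial (Polynomial.X : Polynomial (ZMod p)) (p - 1) =
      ∏ j ∈ range (p - 1), (Polynomial.X + Polynomial.C ((j : ZMod p) + 1)) := by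
    simp [shiftedFactorial]
  have hdeg : (shiftedFactorial (Polynomial.X : Polynomial (ZMod p)) (p - 1)).degree =
      (p - 1 : ℕ) := by
    rw [hmon, Polynomial.degree_prod]
    simp only [Polynomial.degree_X_add_C]
    simp
  have hmon' : (shiftedFactorial (Polynomial.X : Polynomial (ZMod p)) (p - 1)).Monic := by
    rw [hmon]; exact Polynomial.monic_prod_of_monic _ _ fun j _ => Polynomial.monic_X_add_C _
  have hcard : (univ.erase (0 : ZMod p)).card = p - 1 := by
    rw [card_erase_of_mem (mem_univ _), card_univ, ZMod.card]
  apply Polynomial.eq_of_degree_sub_lt_of_eval_finset_eq (univ.erase (0 : ZMod p))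
  · rw [hcard, ← hdeg]
    have h1 : (Polynomial.X ^ (p - 1) - 1 : Polynomial (ZMod p)).degree = (p - 1 : ℕ) := by
      rw [← map_one Polynomial.C]
      exact Polynomial.degree_X_pow_sub_C (by omega) _
    apply Polynomial.degree_sub_lt_left
    · rw [hdeg, h1]
    · exact hmon'.ne_zero
    · rw [hmon', ← map_one Polynomial.C, Polynomial.leadingCoeff_X_pow_sub_C (by omega)]
  · intro a ha
    have ha : a ≠ 0 := by simpa using ha
    have h1 : Polynomial.eval a (shiftedFactorial (Polynomial.X : Polynomial (ZMod p)) (p - 1)) =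
        shiftedFactorial a (p - 1) := by
      have := map_shiftedFactorial (Polynomial.evalRingHom a) Polynomial.X (p - 1)
      simpa using this
    have hv : (-a).val ≠ 0 := by
      rw [Ne, ZMod.val_eq_zero]; simpa using ha
    have hv2 := ZMod.val_lt (-a)
    have h2 : shiftedFactorial a (p - 1) = 0 := by
      refine prod_eq_zero (i := (-a).val - 1) (mem_range.2 (by omega)) ?_
      have h3 : ((((-a).val - 1 : ℕ) : ZMod p) + 1) = ((-a).val : ℕ) := by
        rw [← Nat.cast_succ, Nat.succ_eq_add_one, Nat.sub_add_cancel (by omega)]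
      rw [h3, ZMod.natCast_zmod_val, add_neg_cancel]
    rw [h1, h2]
    simp [ZMod.pow_card_sub_one_eq_one ha]

theorem shiftedFactorial_neg (h2 : p ≠ 2) (Y : S) :
    shiftedFactorial (-p - Y) (p - 1) = shiftedFactorial Y (p - 1) := by
  have hp := (Fact.out : p.Prime)
  have h1 : ∀ j ∈ range (p - 1), (-(p : S) - Y + (j + 1)) = (-1) * (Y + ((p - 1 - 1 - j : ℕ) + 1)) := by
    intro j hj
    have hj := mem_range.1 hj
    have : ((p - 1 - 1 - j : ℕ) : S) + 1 + (j + 1) = p := by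
      rw [← Nat.cast_succ, ← Nat.cast_succ, ← Nat.cast_add]
      congr 1; omega
    linear_combination this
  rw [shiftedFactorial, prod_congr rfl h1, prod_mul_distrib,
    prod_range_reflect (fun j : ℕ => Y + ((j : S) + 1)), prod_const, card_range,
    (hp.even_sub_one h2).neg_one_pow, one_mul, shiftedFactorial]

theorem exists_shiftedFactorial_X (hp5 : 3 < p) : ∃ (c1 c2 : ℤ) (g : Polynomial ℤ),
    shiftedFactorial (Polynomial.X : Polynomial ℤ) (p - 1) = ((p - 1).factorial : Polynomial ℤ) +
      (p : Polynomial ℤ) * (c1 : Polynomial ℤ) * Polynomial.X +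
        (p : Polynomial ℤ) * (c2 : Polynomial ℤ) * Polynomial.X ^ 2 +
        Polynomial.X ^ 3 * g := by
  set V : Polynomial ℤ := shiftedFactorial Polynomial.X (p - 1) with hV
  have hred : V.map (Int.castRingHom (ZMod p)) = Polynomial.X ^ (p - 1) - 1 := by
    rw [← shiftedFactorial_zmod]
    have := map_shiftedFactorial (Polynomial.mapRingHom (Int.castRingHom (ZMod p))) Polynomial.X
      (p - 1)
    simpa using this
  have hc : ∀ k, 0 < k → k < p - 1 → (p : ℤ) ∣ V.coeff k := fun k h0 hk => by
    rw [← ZMod.intCast_zmod_eq_zero_iff_dvd]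
    have := congrArg (fun q => q.coeff k) hred
    simpa [Polynomial.coeff_map, Polynomial.coeff_X_pow, Polynomial.coeff_one, h0.ne',
      hk.ne] using this
  obtain ⟨c1, hc1⟩ := hc 1 (by omega) (by omega)
  obtain ⟨c2, hc2⟩ := hc 2 (by omega) (by omega)
  have h0 : V.coeff 0 = (p - 1).factorial := by
    have := map_shiftedFactorial (Polynomial.evalRingHom (0 : ℤ)) Polynomial.X (p - 1)
    rw [Polynomial.coe_evalRingHom, Polynomial.eval_X, shiftedFactorial_zero_left] at this
    rw [Polynomial.coeff_zero_eq_eval_zero, hV, this]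
  refine ⟨c1, c2, V.divX.divX.divX, ?_⟩
  have e0 := V.X_mul_divX_add
  have e1 := V.divX.X_mul_divX_add
  have e2 := V.divX.divX.X_mul_divX_add
  simp only [Polynomial.coeff_divX, zero_add] at e1 e2
  rw [h0] at e0
  rw [hc1] at e1
  rw [show 1 + 1 = 2 from rfl, hc2] at e2
  have eC : ∀ n : ℤ, (Polynomial.C n : Polynomial ℤ) = n := fun n => by
    simpa using Polynomial.C_eq_intCast (R := ℤ) n
  rw [eC] at e0 e1 e2
  push_cast at e0 e1 e2
  linear_combination -e0 - Polynomial.X * e1 - Polynomial.X ^ 2 * e2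

theorem pow_three_dvd_shiftedFactorial_sub (hp5 : 3 < p) (y : S) :
    (p : S) ^ 3 ∣ shiftedFactorial (p * y) (p - 1) - ((p - 1).factorial : S) := by
  have hp := (Fact.out : p.Prime)
  obtain ⟨c1, c2, g, hg⟩ := exists_shiftedFactorial_X hp5
  have hcp : (p : ℤ) ∣ c1 := by
    have h1 := shiftedFactorial_neg (by omega : p ≠ 2) (0 : ℤ)
    have h2 := map_shiftedFactorial (Polynomial.evalRingHom (-(p : ℤ))) Polynomial.X (p - 1)
    rw [hg] at h2
    simp only [map_add, map_mul, map_natCast, map_intCast, map_pow, Polynomial.coe_evalRingHom,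
      Polynomial.eval_X] at h2
    rw [shiftedFactorial_zero_left, sub_zero, ← h2] at h1
    have hp0 : (p : ℤ) ^ 2 ≠ 0 := by exact_mod_cast (pow_pos hp.pos 2).ne'
    refine ⟨c2 - Polynomial.eval (-(p : ℤ)) g, ?_⟩
    apply mul_left_cancel₀ hp0
    push_cast at h1
    linear_combination -h1
  obtain ⟨c, rfl⟩ := hcp
  have h2 := map_shiftedFactorial (Polynomial.aeval (R := ℤ) (p * y)).toRingHom Polynomial.X (p - 1)
  rw [hg] at h2
  simp only [map_add, map_mul, map_natCast, map_intCast, map_pow, AlgHom.toRingHom_eq_coe,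
    RingHom.coe_coe, Polynomial.aeval_X] at h2
  rw [← h2]
  refine ⟨c * y + c2 * y ^ 2 + y ^ 3 * Polynomial.aeval (p * y) g, ?_⟩
  push_cast
  ring

end shiftedFactorial

/-- The numerator of the term ratio of `∑ (4k)!/k!⁴ t^k` at the argument `y`, deformed by `ν`. -/
def hypNum {S : Type*} [CommRing S] (y ν : S) : S :=
  8 * (4 * y + 1 - ν) * (2 * y + 1) * (4 * y + 3 + ν)

/-- The term of index `r` of the hypergeometric sequence shifted by `Y` and deformed by `ν`. -/
noncomputable def hypTerm {S : Type*} [CommRing S] (Y ν : S) (r : ℕ) : S :=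
  (∏ j ∈ range r, hypNum (Y + j) ν) * Ring.inverse (shiftedFactorial Y r) ^ 3

/-- The part prime to `p` of a full period of numerators. -/
def hypBlock {S : Type*} [CommRing S] (p : ℕ) (y ν : S) : S :=
  8 ^ (p - 1) * (∏ r ∈ (range p).erase ((p - 1) / 4), (4 * (p * y + r) + 1 - p * ν)) *
    (∏ r ∈ (range p).erase ((p - 1) / 2), (2 * (p * y + r) + 1)) *
    (∏ r ∈ (range p).erase (3 * ((p - 1) / 4)), (4 * (p * y + r) + 3 + p * ν))

section hypBlock

variable {S T : Type*} [CommRing S] [CommRing T] {p : ℕ}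

theorem map_hypNum (f : S →+* T) (y ν : S) : f (hypNum y ν) = hypNum (f y) (f ν) := by
  simp [hypNum, map_ofNat]

theorem map_hypBlock (f : S →+* T) (y ν : S) :
    f (hypBlock p y ν) = hypBlock p (f y) (f ν) := by
  simp [hypBlock, map_ofNat]

theorem prod_hypNum (h4 : p % 4 = 1) (y ν : S) :
    ∏ r ∈ range p, hypNum (p * y + r) (p * ν) = p ^ 3 * hypNum y ν * hypBlock p y ν := by
  have e1 : 4 * (((p - 1) / 4 : ℕ) : S) + 1 = p := by
    exact_mod_cast congrArg (Nat.cast : ℕ → S) (show 4 * ((p - 1) / 4) + 1 = p by omega)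
  have e2 : 2 * (((p - 1) / 2 : ℕ) : S) + 1 = p := by
    exact_mod_cast congrArg (Nat.cast : ℕ → S) (show 2 * ((p - 1) / 2) + 1 = p by omega)
  have e3 : 4 * ((3 * ((p - 1) / 4) : ℕ) : S) + 3 = 3 * p := by
    exact_mod_cast congrArg (Nat.cast : ℕ → S)
      (show 4 * (3 * ((p - 1) / 4)) + 3 = 3 * p by omega)
  simp only [hypNum, prod_mul_distrib]
  rw [prod_const, card_range,
    ← mul_prod_erase (range p) _ (mem_range.2 (show (p - 1) / 4 < p by omega)),
    ← mul_prod_erase (range p) _ (mem_range.2 (show (p - 1) / 2 < p by omega)),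
    ← mul_prod_erase (range p) _ (mem_range.2 (show 3 * ((p - 1) / 4) < p by omega)),
    hypBlock]
  have e4 : (8 : S) ^ p = 8 * 8 ^ (p - 1) := by
    rw [← pow_succ']; congr 1; omega
  have f1 : 4 * (p * y + ((p - 1) / 4 : ℕ)) + 1 - p * ν = p * (4 * y + 1 - ν) := by
    linear_combination e1
  have f2 : 2 * (p * y + ((p - 1) / 2 : ℕ)) + 1 = p * (2 * y + 1) := by
    linear_combination e2
  have f3 : 4 * (p * y + (3 * ((p - 1) / 4) : ℕ)) + 3 + p * ν = p * (4 * y + 3 + ν) := by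
    linear_combination e3
  rw [f1, f2, f3, e4]
  ring

theorem shiftedFactorial_add (Y : S) (a b : ℕ) :
    shiftedFactorial Y (a + b) = shiftedFactorial Y a * shiftedFactorial (Y + a) b := by
  simp only [shiftedFactorial, prod_range_add]
  congr 1
  exact prod_congr rfl fun j _ => by push_cast; ring

theorem shiftedFactorial_four_mul (Y : S) (n : ℕ) :
    shiftedFactorial (4 * Y) (4 * n) =
      (∏ r ∈ range n, hypNum (Y + r) 0) * shiftedFactorial Y n := by
  induction n with
  | zero => simp [shiftedFactorial]
  | succ n ih =>
    rw [show 4 * (n + 1) = 4 * n + 1 + 1 + 1 + 1 by ring]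
    simp only [shiftedFactorial_succ, ih, prod_range_succ, hypNum]
    push_cast
    ring

theorem hypBlock_mul (hp : p ≠ 0) (h4 : p % 4 = 1) (y : S) :
    hypBlock p y 0 * shiftedFactorial (p * y) (p - 1) =
      shiftedFactorial (p * (4 * y)) (p - 1) * shiftedFactorial (p * (4 * y + 1)) (p - 1) *
      shiftedFactorial (p * (4 * y + 2)) (p - 1) * shiftedFactorial (p * (4 * y + 3)) (p - 1) := by
  suffices h : hypBlock p (Polynomial.X : Polynomial ℤ) 0 *
      shiftedFactorial (p * Polynomial.X) (p - 1) =
      shiftedFactorial (p * (4 * Polynomial.X)) (p - 1) *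
      shiftedFactorial (p * (4 * Polynomial.X + 1)) (p - 1) *
      shiftedFactorial (p * (4 * Polynomial.X + 2)) (p - 1) *
      shiftedFactorial (p * (4 * Polynomial.X + 3)) (p - 1) by
    have := congrArg (Polynomial.aeval (R := ℤ) y).toRingHom h
    simp only [map_mul, map_hypBlock, map_shiftedFactorial, map_add, map_zero, map_natCast,
      map_ofNat, map_one] at this
    simpa using this
  generalize hy : (Polynomial.X : Polynomial ℤ) = y
  have hne : ∀ a b : ℕ, b ≠ 0 → (a : Polynomial ℤ) * y + b ≠ 0 := fun a b hb h => by
    have := congrArg (Polynomial.eval 0) h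
    rw [← hy] at this
    simp [hb] at this
  have h1 := shiftedFactorial_four_mul ((p : Polynomial ℤ) * y) p
  have h2 := prod_hypNum h4 y 0
  rw [mul_zero] at h2
  have step : ∀ Z : Polynomial ℤ, shiftedFactorial (p * Z) p =
      shiftedFactorial (p * Z) (p - 1) * (p * (Z + 1)) := fun Z => by
    obtain ⟨q, rfl⟩ : ∃ q, p = q + 1 := ⟨p - 1, by omega⟩
    rw [shiftedFactorial_succ, Nat.add_sub_cancel]
    push_cast
    ring
  have h3 : shiftedFactorial (4 * ((p : Polynomial ℤ) * y)) (4 * p) =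
      shiftedFactorial (p * (4 * y)) p * shiftedFactorial (p * (4 * y + 1)) p *
      shiftedFactorial (p * (4 * y + 2)) p * shiftedFactorial (p * (4 * y + 3)) p := by
    have a0 : (p : Polynomial ℤ) * (4 * y) = 4 * (p * y) := by ring
    have a1 : (p : Polynomial ℤ) * (4 * y + 1) = 4 * (p * y) + (p : ℕ) := by ring
    have a2 : (p : Polynomial ℤ) * (4 * y + 2) = 4 * (p * y) + (p + p : ℕ) := by push_cast; ring
    have a3 : (p : Polynomial ℤ) * (4 * y + 3) = 4 * (p * y) + (p + p + p : ℕ) := by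
      push_cast; ring
    rw [a0, a1, a2, a3, show 4 * p = p + p + p + p by ring, shiftedFactorial_add _ (p + p + p),
      shiftedFactorial_add _ (p + p), shiftedFactorial_add _ p]
  rw [h2, h3, step, step, step, step, step] at h1
  have hp' : (p : Polynomial ℤ) ≠ 0 := by exact_mod_cast hp
  have hR : hypNum y 0 ≠ 0 := by
    have a1 := hne 4 1 (by norm_num)
    have a2 := hne 2 1 (by norm_num)
    have a3 := hne 4 3 (by norm_num)
    push_cast at a1 a2 a3
    have h8 : (8 : Polynomial ℤ) ≠ 0 := by norm_num
    rw [hypNum, sub_zero, add_zero]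
    exact mul_ne_zero (mul_ne_zero (mul_ne_zero h8 a1) a2) a3
  have h11 := hne 1 1 one_ne_zero
  push_cast at h11
  apply mul_left_cancel₀ (mul_ne_zero (mul_ne_zero (pow_ne_zero 4 hp') hR) h11)
  have hR' : hypNum y 0 * (1 * y + 1) = (4 * y + 1) * (4 * y + 2) * (4 * y + 3) * (4 * y + 4) := by
    rw [hypNum]; ring
  linear_combination -h1 + (p : Polynomial ℤ) ^ 4 *
    (shiftedFactorial (p * (4 * y)) (p - 1) * shiftedFactorial (p * (4 * y + 1)) (p - 1) *
      shiftedFactorial (p * (4 * y + 2)) (p - 1) * shiftedFactorial (p * (4 * y + 3)) (p - 1)) *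
      -hR'

end hypBlock

section hypTerm

variable {S : Type*} [CommRing S] {p : ℕ}

theorem hypTerm_zero (Y ν : S) : hypTerm Y ν 0 = 1 := by
  simp [hypTerm, shiftedFactorial]

theorem hypTerm_succ (Y ν : S) (r : ℕ) (h : IsUnit (Y + (r + 1))) :
    hypTerm Y ν (r + 1) * (Y + (r + 1)) ^ 3 = hypTerm Y ν r * hypNum (Y + r) ν := by
  rw [hypTerm, hypTerm, prod_range_succ, shiftedFactorial_succ,
    Ring.mul_inverse_rev, mul_pow]
  have h1 : Ring.inverse (Y + (r + 1)) ^ 3 * (Y + (r + 1)) ^ 3 = 1 := by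
    rw [← mul_pow, Ring.inverse_mul_cancel _ h, one_pow]
  linear_combination (∏ j ∈ range r, hypNum (Y + j) ν) * hypNum (Y + r) ν *
    Ring.inverse (shiftedFactorial Y r) ^ 3 * h1

/-- The units needed for Dwork-type congruences: integers prime to `p` stay units after
perturbation by multiples of `p`. -/
def UnitsPerturb (S : Type*) [CommRing S] (p : ℕ) : Prop :=
  ∀ (n : ℕ) (x : S), ¬ p ∣ n → IsUnit ((n : S) + p * x)

theorem UnitsPerturb.isUnit_shiftedFactorial (hu : UnitsPerturb S p) (y : S) {r : ℕ} (hr : r < p) :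
    IsUnit (shiftedFactorial (p * y) r) := by
  induction r with
  | zero => simp [shiftedFactorial]
  | succ r ih =>
    rw [shiftedFactorial_succ]
    refine (ih (by omega)).mul ?_
    have := hu (r + 1) y (Nat.not_dvd_of_pos_of_lt (by omega) hr)
    push_cast at this
    rwa [add_comm]

theorem hypNum_congr {I : Ideal S} {a ν : S} (h : ν ∈ I) : hypNum a ν - hypNum a 0 ∈ I := by
  rw [← Ideal.Quotient.eq, map_hypNum, map_hypNum, Ideal.Quotient.eq_zero_iff_mem.2 h, map_zero]

theorem hypTerm_congr {I : Ideal S} {Y ν : S} (h : ν ∈ I) (r : ℕ) :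
    hypTerm Y ν r - hypTerm Y 0 r ∈ I := by
  rw [hypTerm, hypTerm, ← Ideal.Quotient.eq]
  simp only [map_mul, map_prod]
  congr 1
  exact prod_congr rfl fun j _ => Ideal.Quotient.eq.2 (hypNum_congr h)

theorem hypBlock_congr [Fact p.Prime] (hp5 : 3 < p) (h4 : p % 4 = 1) (hu : UnitsPerturb S p)
    {ν : S} (hν : (p : S) ^ 3 ∣ p * ν) (y : S) :
    (p : S) ^ 3 ∣ hypBlock p y ν - shiftedFactorial (p * y) (p - 1) ^ 3 := by
  have hp := (Fact.out : p.Prime)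
  rw [← Ideal.mem_span_singleton, ← Ideal.Quotient.eq]
  set I := Ideal.span {(p : S) ^ 3}
  set π := Ideal.Quotient.mk I
  have hV : ∀ x : S, π (shiftedFactorial (p * x) (p - 1)) = π ((p - 1).factorial : S) := fun x =>
    Ideal.Quotient.eq.2 (Ideal.mem_span_singleton.2 (pow_three_dvd_shiftedFactorial_sub hp5 x))
  have hf : IsUnit (π ((p - 1).factorial : S)) := by
    rw [← hV 0]
    exact (hu.isUnit_shiftedFactorial 0 (by omega)).map π
  have h1 : π (hypBlock p y ν) = π (hypBlock p y 0) := by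
    have : (p : S ⧸ I) * π ν = 0 := by
      rw [← map_natCast π, ← map_mul]
      exact Ideal.Quotient.eq_zero_iff_mem.2 (Ideal.mem_span_singleton.2 hν)
    rw [map_hypBlock, map_hypBlock, hypBlock, hypBlock]
    simp only [this, map_zero, mul_zero]
  have h2 := congrArg π (hypBlock_mul hp.ne_zero h4 y)
  simp only [map_mul, hV] at h2
  rw [h1, map_pow, hV]
  apply hf.mul_right_cancel
  rw [h2]; ring

/-- **Dwork lift.** A sequence satisfying the hypergeometric recursion up to index `M` lifts to a
sequence satisfying the recursion with shift `p e` up to index `p M`, and the lift is congruent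
to the product of the original sequence with a shifted hypergeometric term. -/
theorem exists_dwork_lift [Fact p.Prime] (hp5 : 3 < p) (h4 : p % 4 = 1) (hu : UnitsPerturb S p)
    {ν e : S} (hν : (p : S) ^ 3 ∣ p * ν) {α : ℕ → S} {M : ℕ}
    (hα : ∀ m, m + 1 < M → α (m + 1) * (m + 1 + e) ^ 3 = α m * hypNum (m + e) ν) :
    ∃ A : ℕ → S, A 0 = α 0 ∧
      (∀ n, n + 1 < p * M → A (n + 1) * (n + 1 + p * e) ^ 3 = A n * hypNum (n + p * e) (p * ν)) ∧
      ∀ m < M, ∀ r < p, (p : S) ^ 3 ∣ A (p * m + r) - α m * hypTerm (p * (m + e)) 0 r := by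
  have hp := (Fact.out : p.Prime)
  set W : ℕ → S := fun m => ∏ l ∈ range m, (hypBlock p (l + e) ν *
    Ring.inverse (shiftedFactorial (p * (l + e)) (p - 1)) ^ 3) with hW
  set A : ℕ → S := fun n => α (n / p) * W (n / p) * hypTerm (p * ((n / p : ℕ) + e)) (p * ν) (n % p)
    with hA
  have hAe : ∀ m r, r < p → A (p * m + r) = α m * W m * hypTerm (p * (m + e)) (p * ν) r := by
    intro m r hr
    simp only [hA]
    rw [Nat.mul_add_div hp.pos, Nat.div_eq_of_lt hr, add_zero, Nat.mul_add_mod,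
      Nat.mod_eq_of_lt hr]
  refine ⟨A, ?_, ?_, ?_⟩
  · have := hAe 0 0 hp.pos
    rw [mul_zero, add_zero] at this
    rw [this, hypTerm_zero]
    simp [hW]
  · intro n hn
    obtain ⟨m, r, hr, rfl⟩ : ∃ m r, r < p ∧ n = p * m + r :=
      ⟨n / p, n % p, Nat.mod_lt _ hp.pos, (Nat.div_add_mod n p).symm⟩
    by_cases hr1 : r + 1 < p
    · have h1 := hu (r + 1) (m + e) (Nat.not_dvd_of_pos_of_lt (by omega) hr1)
      have h2 := hypTerm_succ (p * (m + e)) (p * ν) r (by push_cast at h1; rwa [add_comm])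
      rw [add_assoc, hAe m r hr, hAe m (r + 1) hr1]
      have e1 : (((p * m + r : ℕ) : S) + 1 + p * e) = p * (m + e) + (r + 1) := by push_cast; ring
      have e2 : (((p * m + r : ℕ) : S) + p * e) = p * (m + e) + r := by push_cast; ring
      rw [e1, e2]
      linear_combination α m * W m * h2
    · obtain rfl : r = p - 1 := by omega
      have hm : m + 1 < M := by
        by_contra hcon
        have : p * M ≤ p * (m + 1) := Nat.mul_le_mul_left p (by omega)
        rw [mul_add, mul_one] at this
        omega
      have hV := hu.isUnit_shiftedFactorial (m + e : S) (show p - 1 < p by omega)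
      have h1 := prod_hypNum h4 (m + e : S) ν
      have h2 : range p = range (p - 1 + 1) := by congr 1; omega
      rw [h2, prod_range_succ] at h1
      have e0 : p * m + (p - 1) + 1 = p * (m + 1) + 0 := by rw [mul_add]; omega
      rw [e0, hAe _ _ hr, hAe _ _ hp.pos, hypTerm_zero]
      have e1 : (((p * m + (p - 1) : ℕ) : S) + 1 + p * e) = p * (m + 1 + e) := by
        rw [← Nat.cast_succ, Nat.succ_eq_add_one, e0]; push_cast; ring
      have e2 : (((p * m + (p - 1) : ℕ) : S) + p * e) = p * (m + e) + (p - 1 : ℕ) := by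
        push_cast; ring
      have hWs : W (m + 1) = W m * (hypBlock p (m + e) ν *
        Ring.inverse (shiftedFactorial (p * (m + e)) (p - 1)) ^ 3) := prod_range_succ _ _
      rw [e1, e2, hWs, hypTerm]
      linear_combination (W m * hypBlock p (m + e) ν *
        Ring.inverse (shiftedFactorial (p * (m + e)) (p - 1)) ^ 3 * p ^ 3) * hα m hm -
        α m * W m * Ring.inverse (shiftedFactorial (p * (m + e)) (p - 1)) ^ 3 * h1
  · intro m _ r hr
    rw [hAe m r hr, ← Ideal.mem_span_singleton, ← Ideal.Quotient.eq]
    set π := Ideal.Quotient.mk (Ideal.span {(p : S) ^ 3})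
    have h1 : π (W m) = 1 := by
      rw [hW, map_prod]
      refine prod_eq_one fun l _ => ?_
      have h2 : π (hypBlock p (l + e) ν) = π (shiftedFactorial (p * (l + e)) (p - 1) ^ 3) :=
        Ideal.Quotient.eq.2 (Ideal.mem_span_singleton.2 (hypBlock_congr hp5 h4 hu hν _))
      rw [map_mul, h2, ← map_mul, ← mul_pow, Ring.mul_inverse_cancel _
        (hu.isUnit_shiftedFactorial _ (by omega)), one_pow, map_one]
    have h2 : π (hypTerm (p * (m + e)) (p * ν) r) = π (hypTerm (p * (m + e)) 0 r) :=
      Ideal.Quotient.eq.2 (hypTerm_congr (Ideal.mem_span_singleton.2 hν) r)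
    rw [map_mul, map_mul, h1, h2, mul_one, map_mul]

end hypTerm

section Taylor

variable {p : ℕ} [Fact p.Prime]

theorem PadicInt.isUnit_natCast {n : ℕ} (h : ¬ p ∣ n) : IsUnit (n : ℤ_[p]) := by
  rw [PadicInt.isUnit_iff, PadicInt.norm_natCast_eq_one_iff]
  exact (Nat.Prime.coprime_iff_not_dvd Fact.out).2 h

theorem exists_hypTerm_aeval {r : ℕ} (hr : r < p) : ∃ G : Polynomial ℤ_[p],
    ∀ (S : Type) [CommRing S] [Algebra ℤ_[p] S], UnitsPerturb S p → ∀ y : S,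
      (p : S) ^ 3 ∣ hypTerm (p * y) 0 r - Polynomial.aeval (p * y) G := by
  induction r with
  | zero => exact ⟨1, fun S _ _ _ y => by simp [hypTerm_zero]⟩
  | succ r ih =>
    obtain ⟨G, hG⟩ := ih (by omega)
    have hk : ¬ p ∣ r + 1 := Nat.not_dvd_of_pos_of_lt (by omega) hr
    obtain ⟨k, hk'⟩ := (PadicInt.isUnit_natCast hk).exists_left_inv
    refine ⟨G * (8 * (4 * (.X + (r : Polynomial ℤ_[p])) + 1) * (2 * (.X + (r : Polynomial ℤ_[p])) + 1) *
      (4 * (.X + (r : Polynomial ℤ_[p])) + 3)) *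
      (.C k - .C k ^ 2 * .X + .C k ^ 3 * .X ^ 2) ^ 3, fun S _ _ hS y => ?_⟩
    have hu : IsUnit ((p * y : S) + (r + 1)) := by
      have := hS (r + 1) y hk
      push_cast at this
      rwa [add_comm]
    have h1 := hypTerm_succ (p * y) 0 r hu
    set w := Ring.inverse ((p * y : S) + (r + 1)) with hw
    have hw1 : w * (p * y + (r + 1)) = 1 := Ring.inverse_mul_cancel _ hu
    have h2 : hypTerm (p * y) 0 (r + 1) = hypTerm (p * y) 0 r * hypNum (p * y + r) 0 * w ^ 3 := by
      rw [← h1, mul_assoc, ← mul_pow, mul_comm (_ + _) w, hw1, one_pow, mul_one]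
    set κ : S := algebraMap ℤ_[p] S k with hκ
    have hκ1 : κ * (r + 1) = 1 := by
      have := congrArg (algebraMap ℤ_[p] S) hk'
      simpa using this
    rw [← Ideal.mem_span_singleton, ← Ideal.Quotient.eq]
    set π := Ideal.Quotient.mk (Ideal.span {(p : S) ^ 3}) with hπ
    have h3 : π (hypTerm (p * y) 0 r) = π (Polynomial.aeval (p * y) G) :=
      Ideal.Quotient.eq.2 (Ideal.mem_span_singleton.2 (hG S hS y))
    have h4 : π w = π (κ - κ ^ 2 * (p * y) + κ ^ 3 * (p * y) ^ 2) := by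
      refine Ideal.Quotient.eq.2 (Ideal.mem_span_singleton.2 ⟨-w * κ ^ 3 * y ^ 3, ?_⟩)
      generalize (r : S) = ρ at *
      linear_combination (κ - κ ^ 2 * (p * y) + κ ^ 3 * (p * y) ^ 2) * hw1 -
        (w - w * κ * (p * y) + w * κ ^ 2 * (p * y) ^ 2) * hκ1
    rw [h2, map_mul, map_mul, map_pow, h3, h4, ← map_pow, ← map_mul, ← map_mul]
    congr 1
    simp only [map_mul, map_add, map_sub, map_pow, Polynomial.aeval_X, Polynomial.aeval_C,
      map_natCast, map_ofNat, map_one, hypNum, ← hκ]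
    ring

/-- Uniform second order Taylor expansion of the shifted hypergeometric terms modulo `p³`. -/
theorem exists_hypTerm_taylor : ∃ f0 f1 f2 : ℕ → ℤ_[p], ∀ r < p,
    ∀ (S : Type) [CommRing S] [Algebra ℤ_[p] S], UnitsPerturb S p → ∀ y : S,
      (p : S) ^ 3 ∣ hypTerm (p * y) 0 r - (algebraMap ℤ_[p] S (f0 r) +
        p * algebraMap ℤ_[p] S (f1 r) * y + p ^ 2 * algebraMap ℤ_[p] S (f2 r) * y ^ 2) := by
  choose! G hG using fun r (hr : r < p) => exists_hypTerm_aeval hr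
  refine ⟨fun r => (G r).coeff 0, fun r => (G r).coeff 1, fun r => (G r).coeff 2,
    fun r hr S _ _ hS y => ?_⟩
  have e0 := (G r).X_mul_divX_add
  have e1 := (G r).divX.X_mul_divX_add
  have e2 := (G r).divX.divX.X_mul_divX_add
  simp only [Polynomial.coeff_divX, zero_add] at e1 e2
  have e := congrArg (Polynomial.aeval ((p : S) * y)) e0
  rw [← e1, ← e2] at e
  simp only [map_add, map_mul, Polynomial.aeval_X, Polynomial.aeval_C] at e
  have h := hG r hr S hS y
  rw [← e] at h
  refine (dvd_add h (dvd_mul_right _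
    (y ^ 3 * Polynomial.aeval ((p : S) * y) (G r).divX.divX.divX))).trans (dvd_of_eq ?_)
  ring

end Taylor

/-- `ℤ_p[ε]/(ε³)`. -/
abbrev CubeNil (p : ℕ) [Fact p.Prime] : Type := AdjoinRoot (Polynomial.X ^ 3 : Polynomial ℤ_[p])

namespace CubeNil

variable {p : ℕ} [Fact p.Prime]

/-- The generator `ε` of `ℤ_p[ε]/(ε³)`. -/
noncomputable def eps : CubeNil p := AdjoinRoot.root _

theorem eps_pow_three : (eps : CubeNil p) ^ 3 = 0 := by
  have := AdjoinRoot.eval₂_root (Polynomial.X ^ 3 : Polynomial ℤ_[p])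
  simpa [eps] using this

theorem exists_rep (x : CubeNil p) : ∃ a b c : ℤ_[p],
    x = algebraMap _ _ a + algebraMap _ _ b * eps + algebraMap _ _ c * eps ^ 2 := by
  obtain ⟨g, rfl⟩ := AdjoinRoot.mk_surjective x
  refine ⟨g.coeff 0, g.coeff 1, g.coeff 2, ?_⟩
  have e0 := g.X_mul_divX_add
  have e1 := g.divX.X_mul_divX_add
  have e2 := g.divX.divX.X_mul_divX_add
  simp only [Polynomial.coeff_divX, zero_add] at e1 e2
  have e := congrArg (AdjoinRoot.mk (Polynomial.X ^ 3 : Polynomial ℤ_[p])) e0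
  rw [← e1, ← e2] at e
  simp only [map_add, map_mul, AdjoinRoot.mk_X, AdjoinRoot.mk_C] at e
  rw [← e]
  have := eps_pow_three (p := p)
  simp only [eps, AdjoinRoot.algebraMap_eq] at this ⊢
  linear_combination (AdjoinRoot.mk (Polynomial.X ^ 3 : Polynomial ℤ_[p]) g.divX.divX.divX) * this

theorem dvd_coeff {d a b c : ℤ_[p]} (h : algebraMap ℤ_[p] (CubeNil p) d ∣
    algebraMap _ _ a + algebraMap _ _ b * eps + algebraMap _ _ c * eps ^ 2) :
    d ∣ a ∧ d ∣ b ∧ d ∣ c := by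
  obtain ⟨x, hx⟩ := h
  obtain ⟨g, rfl⟩ := AdjoinRoot.mk_surjective x
  have h1 : AdjoinRoot.mk (Polynomial.X ^ 3 : Polynomial ℤ_[p])
      (.C a + .C b * .X + .C c * .X ^ 2) = AdjoinRoot.mk _ (.C d * g) := by
    simp only [map_add, map_mul, map_pow, AdjoinRoot.mk_X, AdjoinRoot.mk_C]
    simpa [eps, AdjoinRoot.algebraMap_eq] using hx
  rw [AdjoinRoot.mk_eq_mk, Polynomial.X_pow_dvd_iff] at h1
  have g0 := h1 0 (by norm_num)
  have g1 := h1 1 (by norm_num)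
  have g2 := h1 2 (by norm_num)
  simp [Polynomial.coeff_X, Polynomial.coeff_C] at g0 g1 g2
  exact ⟨⟨_, sub_eq_zero.1 g0⟩, ⟨_, sub_eq_zero.1 g1⟩, ⟨_, sub_eq_zero.1 g2⟩⟩

theorem eq_zero_of_algebraMap_mul {d : ℤ_[p]} (hd : d ≠ 0) {x : CubeNil p}
    (h : algebraMap ℤ_[p] (CubeNil p) d * x = 0) : x = 0 := by
  obtain ⟨g, rfl⟩ := AdjoinRoot.mk_surjective x
  rw [AdjoinRoot.algebraMap_eq, ← AdjoinRoot.mk_C, ← map_mul, AdjoinRoot.mk_eq_zero,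
    Polynomial.X_pow_dvd_iff] at h
  rw [AdjoinRoot.mk_eq_zero, Polynomial.X_pow_dvd_iff]
  intro i hi
  have := h i hi
  rw [Polynomial.coeff_C_mul] at this
  exact (mul_eq_zero.1 this).resolve_left hd

theorem eq_zero_of_add_mul {N : ℕ} (hN : N ≠ 0) {κ x : CubeNil p} (hκ : κ ^ 3 = 0)
    (h : (N + κ) * x = 0) : x = 0 := by
  apply eq_zero_of_algebraMap_mul (d := (N : ℤ_[p]) ^ 3) (by exact_mod_cast pow_ne_zero 3 hN)
  rw [map_pow, map_natCast]
  linear_combination ((N : CubeNil p) ^ 2 - N * κ + κ ^ 2) * h - hκ * x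

theorem isUnit_add_nilpotent {R : Type*} [CommRing R] {a κ : R} (ha : IsUnit a) (hκ : κ ^ 3 = 0) :
    IsUnit (a + κ) := by
  obtain ⟨b, hb⟩ := ha.exists_left_inv
  refine IsUnit.of_mul_eq_one (b - b ^ 2 * κ + b ^ 3 * κ ^ 2) ?_
  linear_combination (1 - b * κ + b ^ 2 * κ ^ 2) * hb + b ^ 3 * hκ

theorem unitsPerturb_padicInt : UnitsPerturb ℤ_[p] p := by
  intro n x hn
  have h := PadicInt.isUnit_natCast hn
  by_contra hcon
  have h1 : (n : ℤ_[p]) + p * x ∈ IsLocalRing.maximalIdeal ℤ_[p] := hcon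
  have h2 : (p : ℤ_[p]) * x ∈ IsLocalRing.maximalIdeal ℤ_[p] :=
    Ideal.mul_mem_right _ _ (by rw [PadicInt.maximalIdeal_eq_span_p]; exact Ideal.mem_span_singleton_self _)
  exact ((Ideal.add_mem_iff_left _ h2).1 h1) h

theorem unitsPerturb : UnitsPerturb (CubeNil p) p := by
  intro n x hn
  obtain ⟨a, b, c, rfl⟩ := exists_rep x
  have h1 := (unitsPerturb_padicInt n a hn).map (algebraMap ℤ_[p] (CubeNil p))
  have h2 : ((p : CubeNil p) * (algebraMap ℤ_[p] (CubeNil p) b * eps + algebraMap _ _ c * eps ^ 2)) ^ 3 = 0 := by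
    rw [show algebraMap ℤ_[p] (CubeNil p) b * eps + algebraMap _ _ c * eps ^ 2 =
      (algebraMap ℤ_[p] (CubeNil p) b + algebraMap _ _ c * eps) * eps by ring, mul_pow, mul_pow,
      eps_pow_three, mul_zero, mul_zero]
  have := isUnit_add_nilpotent h1 h2
  convert this using 1
  simp only [map_add, map_mul, map_natCast]
  ring

theorem isUnit_natCast_add {n : ℕ} (hn : ¬ p ∣ n) {κ : CubeNil p} (hκ : κ ^ 3 = 0) :
    IsUnit ((n : CubeNil p) + κ) := by
  have := unitsPerturb n (0 : CubeNil p) hn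
  rw [mul_zero, add_zero] at this
  exact isUnit_add_nilpotent this hκ

end CubeNil

theorem sum_range_mul_eq {S : Type*} [AddCommMonoid S] (g : ℕ → S) (p M : ℕ) :
    ∑ n ∈ range (p * M), g n = ∑ m ∈ range M, ∑ r ∈ range p, g (p * m + r) := by
  induction M with
  | zero => simp
  | succ M ih => rw [mul_add, mul_one, sum_range_add, ih, sum_range_succ]

theorem pow_three_dvd_one_add_pow_sub {S : Type*} [CommRing S] {h : S} (hh : 2 * h = 1) (z : S)
    (m : ℕ) : z ^ 3 ∣ (1 + z) ^ m - (1 + m * (z - h * z ^ 2) + h * m ^ 2 * (z - h * z ^ 2) ^ 2) := by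
  induction m with
  | zero => simp
  | succ m ih =>
    obtain ⟨c, hc⟩ := ih
    refine ⟨c * (1 + z) + h * m * (m - 1) + h * m ^ 2 * ((1 + z) * (-1 + h ^ 2 * z)) -
      h * (m + 1) ^ 2 * (-1 + h ^ 2 * z), ?_⟩
    push_cast
    linear_combination (1 + z) * hc + (-h * m ^ 2 * z ^ 3 * (1 + z) + h * (m + 1) ^ 2 * z ^ 3 -
      m * z ^ 2) * hh

theorem legendreTerm_succ {S : Type*} [CommRing S] (m k : ℕ) :
    (((-64) ^ (k + 1) * (legendreCoeff m (k + 1) * (2 * (k + 1)).choose (k + 1) : ℕ) : S)) * (k + 1) ^ 3 =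
      ((-64) ^ k * (legendreCoeff m k * (2 * k).choose k : ℕ) : S) * hypNum (k : S) (4 * m + 1) := by
  have h1 := legendreCoeff_succ_right m k
  have h2 := Nat.succ_mul_centralBinom_succ k
  rw [Nat.centralBinom_eq_two_mul_choose, Nat.centralBinom_eq_two_mul_choose] at h2
  have h1' := congrArg (Int.cast : ℤ → S) h1
  have h2' := congrArg (Nat.cast : ℕ → S) h2
  push_cast at h1' h2' ⊢
  rw [hypNum]
  generalize ((2 * (k + 1)).choose (k + 1) : S) = A at *
  generalize ((2 * k).choose k : S) = B at *
  generalize (legendreCoeff m k : S) = C at *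
  generalize (legendreCoeff m (k + 1) : S) = D at *
  rw [pow_succ]
  linear_combination (-64) * (-64) ^ k * (A * (k + 1)) * h1' +
    (-64) * (-64) ^ k * ((m - k) * (m + k + 1) * C) * h2'

section

variable {p : ℕ} [Fact p.Prime]

/-- The truncated sums of a sequence and of its Dwork lift are proportional modulo `p³`
when the first and second order corrections vanish modulo `p³`. -/
theorem sum_lift_congr {A α f0 f1 f2 : ℕ → ℤ_[p]} {M : ℕ} {h t : ℤ_[p]} (hh : 2 * h = 1)
    (hA : ∀ m < M, ∀ r < p, (p : ℤ_[p]) ^ 3 ∣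
      A (p * m + r) - α m * (f0 r + p * f1 r * m + p ^ 2 * f2 r * m ^ 2))
    (ht : (p : ℤ_[p]) ∣ t ^ (p - 1) - 1) {l : ℤ_[p]}
    (hl : l = (t ^ (p - 1) - 1) - h * (t ^ (p - 1) - 1) ^ 2)
    (h1 : (p : ℤ_[p]) ^ 3 ∣ p * ∑ r ∈ range p, f1 r * t ^ r + l * ∑ r ∈ range p, f0 r * t ^ r)
    (h2 : (p : ℤ_[p]) ^ 3 ∣ p ^ 2 * ∑ r ∈ range p, f2 r * t ^ r +
      p * l * ∑ r ∈ range p, f1 r * t ^ r + h * l ^ 2 * ∑ r ∈ range p, f0 r * t ^ r) :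
    (p : ℤ_[p]) ^ 3 ∣ ∑ n ∈ range (p * M), A n * t ^ n -
      (∑ r ∈ range p, f0 r * t ^ r) * ∑ m ∈ range M, α m * t ^ m := by
  have hp := (Fact.out : p.Prime)
  set F0 := ∑ r ∈ range p, f0 r * t ^ r with hF0
  set F1 := ∑ r ∈ range p, f1 r * t ^ r with hF1
  set F2 := ∑ r ∈ range p, f2 r * t ^ r with hF2
  rw [sum_range_mul_eq, mul_sum, ← sum_sub_distrib]
  refine dvd_sum fun m hm => ?_
  set z := t ^ (p - 1) - 1 with hz
  have e1 : (p : ℤ_[p]) ^ 3 ∣ ∑ r ∈ range p, A (p * m + r) * t ^ (p * m + r) -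
      α m * t ^ (p * m) * (F0 + p * F1 * m + p ^ 2 * F2 * m ^ 2) := by
    have : α m * t ^ (p * m) * (F0 + p * F1 * m + p ^ 2 * F2 * m ^ 2) =
        ∑ r ∈ range p, α m * (f0 r + p * f1 r * m + p ^ 2 * f2 r * m ^ 2) * t ^ (p * m + r) := by
      rw [hF0, hF1, hF2]
      simp only [mul_sum, sum_mul, ← sum_add_distrib, pow_add]
      exact sum_congr rfl fun r _ => by ring
    rw [this, ← sum_sub_distrib]
    refine dvd_sum fun r hr => ?_
    rw [← sub_mul]
    exact (hA m (mem_range.1 hm) r (mem_range.1 hr)).mul_right _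
  have e2 : t ^ (p * m) = t ^ m * (1 + z) ^ m := by
    have : 1 + z = t ^ (p - 1) := by rw [hz]; ring
    rw [this, ← mul_pow, ← pow_succ', Nat.sub_add_cancel hp.one_le, ← pow_mul]
  have e3 : (p : ℤ_[p]) ^ 3 ∣ (1 + z) ^ m - (1 + m * l + h * m ^ 2 * l ^ 2) := by
    rw [hl]
    exact (pow_dvd_pow_of_dvd ht 3).trans (pow_three_dvd_one_add_pow_sub hh z m)
  obtain ⟨l', hl'⟩ : (p : ℤ_[p]) ∣ l := by
    rw [hl]; exact dvd_sub ht (ht.trans (Dvd.intro_left _ (by ring : h * z * z = h * z ^ 2)))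
  obtain ⟨c1, h1⟩ := h1
  obtain ⟨c2, h2⟩ := h2
  obtain ⟨c3, e3⟩ := e3
  obtain ⟨c4, e1⟩ := e1
  rw [e2] at e1
  refine ⟨c4 + α m * t ^ m * (c3 * (F0 + p * F1 * m + p ^ 2 * F2 * m ^ 2) + m * c1 + m ^ 2 * c2 +
    m ^ 3 * (l' * F2 + h * l' ^ 2 * F1 + h * m * l' ^ 2 * p * F2)), ?_⟩
  subst hl'
  linear_combination e1 + α m * t ^ m * (F0 + p * F1 * m + p ^ 2 * F2 * m ^ 2) * e3 +
    α m * t ^ m * m * h1 + α m * t ^ m * m ^ 2 * h2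

/-- The Dwork congruence between the hypergeometric polynomials of levels `p^k` and `p^(k+1)`. -/
theorem legendreTerm_lift_congr (hp5 : 3 < p) (h4 : p % 4 = 1) {f0 f1 f2 : ℕ → ℤ_[p]}
    (hf : ∀ r < p, ∀ (S : Type) [CommRing S] [Algebra ℤ_[p] S], UnitsPerturb S p → ∀ y : S,
      (p : S) ^ 3 ∣ hypTerm (p * y) 0 r - (algebraMap ℤ_[p] S (f0 r) +
        p * algebraMap ℤ_[p] S (f1 r) * y + p ^ 2 * algebraMap ℤ_[p] S (f2 r) * y ^ 2))
    {a b : ℕ} (ha : 4 * a + 1 = p ^ 2) (hb : 4 * b + 1 = p ^ 3) (m r : ℕ) (hr : r < p) :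
    (p : ℤ_[p]) ^ 3 ∣ (-64) ^ (p * m + r) * (legendreCoeff b (p * m + r) *
      (2 * (p * m + r)).choose (p * m + r) : ℕ) -
      ((-64) ^ m * (legendreCoeff a m * (2 * m).choose m : ℕ)) *
        (f0 r + p * f1 r * m + p ^ 2 * f2 r * m ^ 2) := by
  obtain ⟨A, hA0, hA1, hA2⟩ := exists_dwork_lift hp5 h4 (CubeNil.unitsPerturb_padicInt (p := p))
    (ν := (p : ℤ_[p]) ^ 2) (e := 0) (M := m + 1) (dvd_of_eq (by ring))
    (α := fun m => (-64) ^ m * (legendreCoeff a m * (2 * m).choose m : ℕ)) (by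
      intro k _
      have := legendreTerm_succ (S := ℤ_[p]) a k
      have hν : (4 * (a : ℤ_[p]) + 1) = p ^ 2 := by exact_mod_cast congrArg (Nat.cast : ℕ → ℤ_[p]) ha
      rw [hν] at this
      simpa using this)
  have hAb : ∀ n < p * (m + 1), A n = (-64) ^ n * (legendreCoeff b n * (2 * n).choose n : ℕ) := by
    intro n
    induction n with
    | zero => intro _; rw [hA0]; simp [legendreCoeff_zero]
    | succ n ih =>
      intro hn
      have h1 := hA1 n hn
      have h2 := legendreTerm_succ (S := ℤ_[p]) b n
      have hν : (4 * (b : ℤ_[p]) + 1) = p * p ^ 2 := by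
        rw [← pow_succ']; exact_mod_cast congrArg (Nat.cast : ℕ → ℤ_[p]) hb
      rw [hν] at h2
      rw [mul_zero, add_zero, add_zero, ih (by omega), ← h2] at h1
      exact mul_right_cancel₀ (pow_ne_zero 3 (Nat.cast_add_one_ne_zero n)) h1
  have h1 := hA2 m (by omega) r hr
  rw [hAb _ (by rw [mul_add, mul_one]; omega), add_zero] at h1
  have h2 := hf r hr ℤ_[p] CubeNil.unitsPerturb_padicInt (m : ℤ_[p])
  simp only [Algebra.algebraMap_self, RingHom.id_apply] at h2
  have h3 := dvd_add h1 (h2.mul_left ((-64) ^ m * (legendreCoeff a m * (2 * m).choose m : ℕ)))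
  refine h3.trans (dvd_of_eq ?_)
  ring

end

namespace PowerSeries

variable {S : Type*} [CommRing S]

/-- The Euler derivation `X d/dX`. -/
noncomputable def euler : Derivation S S⟦X⟧ S⟦X⟧ := (X : S⟦X⟧) • derivative S

theorem euler_apply (f : S⟦X⟧) : euler f = X * derivative S f := rfl

theorem euler_mul (f g : S⟦X⟧) : euler (f * g) = euler f * g + f * euler g := by
  rw [Derivation.leibniz]; simp only [smul_eq_mul]; ring

theorem coeff_euler (f : S⟦X⟧) (n : ℕ) : coeff n (euler f) = n * coeff n f := by
  rw [euler_apply]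
  cases n with
  | zero => simp
  | succ n => rw [coeff_succ_X_mul, coeff_derivative]; push_cast; ring

theorem euler_C (a : S) : euler (C a : S⟦X⟧) = 0 := by
  ext n; rw [coeff_euler, coeff_C]; split_ifs with h <;> simp [h]

theorem euler_C_mul (a : S) (f : S⟦X⟧) : euler (C a * f) = C a * euler f := by
  rw [euler_mul, euler_C]; ring

theorem X_pow_dvd_euler {f : S⟦X⟧} {M : ℕ} (h : X ^ M ∣ f) : X ^ M ∣ euler f := by
  rw [X_pow_dvd_iff] at h ⊢
  intro m hm
  rw [coeff_euler, h m hm, mul_zero]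

/-- The Euler derivation twisted by the exponent `κ`. -/
noncomputable def twist (κ : S) (f : S⟦X⟧) : S⟦X⟧ := euler f + C κ * f

theorem twist_mul (κ : S) (z f : S⟦X⟧) : twist κ (z * f) = euler z * f + z * twist κ f := by
  rw [twist, twist, euler_mul]; ring

theorem twist_add (κ : S) (f g : S⟦X⟧) : twist κ (f + g) = twist κ f + twist κ g := by
  rw [twist, twist, twist, map_add]; ring

theorem twist_sub (κ : S) (f g : S⟦X⟧) : twist κ (f - g) = twist κ f - twist κ g := by
  rw [twist, twist, twist, map_sub]; ring

theorem twist_C_mul (κ a : S) (f : S⟦X⟧) : twist κ (C a * f) = C a * twist κ f := by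
  rw [twist_mul, euler_C]; ring

theorem twist_sum (κ : S) {ι : Type*} (s : Finset ι) (f : ι → S⟦X⟧) :
    twist κ (∑ i ∈ s, f i) = ∑ i ∈ s, twist κ (f i) := by
  simp only [twist, map_sum, mul_sum, sum_add_distrib]

theorem coeff_twist (κ : S) (f : S⟦X⟧) (n : ℕ) : coeff n (twist κ f) = (n + κ) * coeff n f := by
  rw [twist, map_add, coeff_euler, coeff_C_mul]; ring

theorem X_pow_dvd_twist (κ : S) {f : S⟦X⟧} {M : ℕ} (h : X ^ M ∣ f) : X ^ M ∣ twist κ f :=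
  dvd_add (X_pow_dvd_euler h) (h.mul_left _)

/-- The third order differential operator attached to the level 6 family. -/
noncomputable def picardFuchs (κ : S) (x f : S⟦X⟧) : S⟦X⟧ :=
  (1 + 14 * x + 81 * x ^ 2) * twist κ (twist κ (twist κ f)) +
    (21 * x + 243 * x ^ 2) * twist κ (twist κ f) + (13 * x + 243 * x ^ 2) * twist κ f +
    (3 * x + 81 * x ^ 2) * f

theorem picardFuchs_sub (κ : S) (x f g : S⟦X⟧) :
    picardFuchs κ x (f - g) = picardFuchs κ x f - picardFuchs κ x g := by
  simp only [picardFuchs, twist_sub]; ring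

theorem picardFuchs_C_mul (κ a : S) (x f : S⟦X⟧) :
    picardFuchs κ x (C a * f) = C a * picardFuchs κ x f := by
  simp only [picardFuchs, twist_C_mul]; ring

theorem picardFuchs_sum (κ : S) (x : S⟦X⟧) {ι : Type*} (s : Finset ι) (f : ι → S⟦X⟧) :
    picardFuchs κ x (∑ i ∈ s, f i) = ∑ i ∈ s, picardFuchs κ x (f i) := by
  simp only [picardFuchs, twist_sum, mul_sum, sum_add_distrib]

theorem picardFuchs_of_twist {κ : S} {x e w : S⟦X⟧} {M : ℕ} (h : X ^ M ∣ twist κ e - w * e) :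
    X ^ M ∣ picardFuchs κ x e - ((1 + 14 * x + 81 * x ^ 2) *
      (euler (euler w) + 3 * w * euler w + w ^ 3) + (21 * x + 243 * x ^ 2) * (euler w + w ^ 2) +
      (13 * x + 243 * x ^ 2) * w + (3 * x + 81 * x ^ 2)) * e := by
  have h2 : X ^ M ∣ twist κ (twist κ e) - (euler w + w ^ 2) * e := by
    have := dvd_add (X_pow_dvd_twist κ h) (h.mul_left w)
    rw [twist_sub, twist_mul] at this
    refine this.trans (dvd_of_eq ?_); ring
  have h3 : X ^ M ∣ twist κ (twist κ (twist κ e)) -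
      (euler (euler w) + 3 * w * euler w + w ^ 3) * e := by
    have := dvd_add (X_pow_dvd_twist κ h2) (h.mul_left (euler w + w ^ 2))
    rw [twist_sub, twist_mul, map_add, pow_two, euler_mul] at this
    refine this.trans (dvd_of_eq ?_); ring
  have := dvd_add (dvd_add (h3.mul_left (1 + 14 * x + 81 * x ^ 2))
    (h2.mul_left (21 * x + 243 * x ^ 2))) (h.mul_left (13 * x + 243 * x ^ 2))
  refine this.trans (dvd_of_eq ?_)
  rw [picardFuchs]; ring

theorem X_pow_dvd_picardFuchs_sum {κ κ' : S} (hκ' : κ' ^ 3 = 0) {x t Λ μ G e : S⟦X⟧} {M : ℕ}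
    (ht : X ∣ t)
    (he : ∀ n : ℕ, X ^ M ∣ twist κ (e * t ^ n) - (C (n + κ') * Λ - μ) * (e * t ^ n))
    (hG : ∀ y : S, (1 + 14 * x + 81 * x ^ 2) *
      (euler (euler (C y * Λ - μ)) + 3 * (C y * Λ - μ) * euler (C y * Λ - μ) +
        (C y * Λ - μ) ^ 3) +
      (21 * x + 243 * x ^ 2) * (euler (C y * Λ - μ) + (C y * Λ - μ) ^ 2) +
      (13 * x + 243 * x ^ 2) * (C y * Λ - μ) + (3 * x + 81 * x ^ 2) =
      G * (C (y ^ 3) - C (hypNum y 0) * t))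
    {a : ℕ → S} (ha : ∀ n, n + 1 < M → a (n + 1) * (n + 1 + κ') ^ 3 = a n * hypNum (n + κ') 0) :
    X ^ M ∣ picardFuchs κ x (∑ n ∈ range M, C (a n) * (e * t ^ n)) := by
  have h1 : ∀ n, X ^ M ∣ picardFuchs κ x (C (a n) * (e * t ^ n)) -
      G * (C (a n * (n + κ') ^ 3) * (e * t ^ n) - C (a n * hypNum (n + κ') 0) *
        (e * t ^ (n + 1))) := by
    intro n
    have := (picardFuchs_of_twist (x := x) (he n)).mul_left (C (a n))
    rw [hG] at this
    refine this.trans (dvd_of_eq ?_)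
    rw [picardFuchs_C_mul, map_mul, map_mul]
    ring
  have h2 : ∀ N ≤ M, X ^ M ∣ picardFuchs κ x (∑ n ∈ range N, C (a n) * (e * t ^ n)) +
      (if N = 0 then 0 else G * (C (a (N - 1) * hypNum ((N - 1 : ℕ) + κ') 0) * (e * t ^ N))) := by
    intro N
    induction N with
    | zero => intro _; simp [picardFuchs, twist]
    | succ N ih =>
      intro hN
      have h3 := dvd_add (ih (by omega)) (h1 N)
      refine h3.trans (dvd_of_eq ?_)
      rw [picardFuchs_sum, picardFuchs_sum, sum_range_succ]
      rcases Nat.eq_zero_or_pos N with rfl | hN0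
      · simp [hκ']
      · obtain ⟨n, rfl⟩ : ∃ n, N = n + 1 := ⟨N - 1, by omega⟩
        have := ha n (by omega)
        rw [if_neg (by omega), if_neg (by omega), Nat.add_sub_cancel, Nat.add_sub_cancel,
          ← this]
        push_cast
        ring
  rcases Nat.eq_zero_or_pos M with rfl | hM0
  · simp
  have h3 := h2 M le_rfl
  rw [if_neg (by omega)] at h3
  exact (dvd_add_left ((((pow_dvd_pow_of_dvd ht M).mul_left e).mul_left _).mul_left _)).1 h3

theorem X_pow_dvd_of_picardFuchs {κ : S} {x w : S⟦X⟧} {M : ℕ} (hx : X ∣ x)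
    (hreg : ∀ N : ℕ, 0 < N → N < M → ∀ z : S, (N + κ) * z = 0 → z = 0)
    (h : X ^ M ∣ picardFuchs κ x w) (h0 : coeff 0 w = 0) : X ^ M ∣ w := by
  have key : ∀ N, 0 < N → N ≤ M → X ^ N ∣ w := by
    intro N
    induction N with
    | zero => intro h; omega
    | succ N ih =>
      intro _ hN
      rcases Nat.eq_zero_or_pos N with rfl | hN0
      · rw [zero_add, pow_one, X_dvd_iff, ← coeff_zero_eq_constantCoeff_apply, h0]
      have h1 := ih hN0 (by omega)
      have h2 := X_pow_dvd_twist κ h1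
      have h3 := X_pow_dvd_twist κ h2
      have h4 := X_pow_dvd_twist κ h3
      have h5 : X ^ (N + 1) ∣ twist κ (twist κ (twist κ w)) := by
        have e1 := (pow_dvd_pow X hN).trans h
        have aux : ∀ f : S⟦X⟧, X ^ N ∣ f → X ^ (N + 1) ∣ x * f := fun f hf => by
          rw [pow_succ, mul_comm x]; exact mul_dvd_mul hf hx
        have e2 := dvd_sub e1 (aux _ (dvd_add (dvd_add (h4.mul_left (14 + 81 * x))
          (h3.mul_left (21 + 243 * x))) (dvd_add (h2.mul_left (13 + 243 * x))
          (h1.mul_left (3 + 81 * x)))))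
        refine e2.trans (dvd_of_eq ?_)
        rw [picardFuchs]; ring
      have h6 := (X_pow_dvd_iff.1 h5) N (by omega)
      rw [coeff_twist, coeff_twist, coeff_twist] at h6
      have h7 := hreg N hN0 (by omega) _ (hreg N hN0 (by omega) _ (hreg N hN0 (by omega) _ h6))
      rw [X_pow_dvd_iff] at h1 ⊢
      intro m hm
      rcases Nat.lt_succ_iff_lt_or_eq.1 hm with hm | rfl
      · exact h1 m hm
      · exact h7
  rcases Nat.eq_zero_or_pos M with rfl | hM0
  · simp
  exact key M hM0 le_rfl

end PowerSeries

namespace PowerSeries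

variable {S : Type*} [CommRing S]

theorem euler_pow {t L : S⟦X⟧} (h : euler t = L * t) (n : ℕ) : euler (t ^ n) = n * L * t ^ n := by
  induction n with
  | zero => simp
  | succ n ih => rw [pow_succ, euler_mul, ih, h]; push_cast; ring

theorem euler_natCast (n : ℕ) : euler (n : S⟦X⟧) = 0 := by
  rw [← map_natCast (C (R := S)) n, euler_C]

theorem euler_one : euler (1 : S⟦X⟧) = 0 := by simpa using euler_natCast (S := S) 1

theorem euler_ofNat (n : ℕ) [n.AtLeastTwo] : euler (ofNat(n) : S⟦X⟧) = 0 := euler_natCast n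

theorem euler_inverse {y P : S⟦X⟧} (hy : euler y = y) (hP : (1 + y) * P = 1) :
    euler P = P ^ 2 - P := by
  have h := congrArg euler hP
  rw [euler_mul, map_add, euler_one, hy] at h
  linear_combination P * h - (P + euler P) * hP

theorem euler_ofNat_mul {n : ℕ} [n.AtLeastTwo] {x : S⟦X⟧} (hx : euler x = x) :
    euler (ofNat(n) * x) = ofNat(n) * x := by
  rw [euler_mul, euler_ofNat, hx]; ring

section

variable {x P : S⟦X⟧}

theorem twist_term_left {η : S} {M : ℕ} {v : S⟦X⟧} (hx : euler x = x) (hP : (1 + 27 * x) * P = 1)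
    (hv : X ^ M ∣ (1 + 27 * x) * euler v + C (12 * η) * (27 * x) * v) (n : ℕ) :
    X ^ M ∣ twist (3 * η) (v * P * (x * P ^ 4) ^ n) -
      (C (n + 3 * η) * (4 * P - 3) - (1 - P)) * (v * P * (x * P ^ 4) ^ n) := by
  have h1 : euler P = P ^ 2 - P := euler_inverse (euler_ofNat_mul hx) hP
  have h2 : euler (P ^ 4) = ((4 : ℕ) : S⟦X⟧) * (P - 1) * P ^ 4 := euler_pow (by rw [h1]; ring) 4
  have h3 : euler (x * P ^ 4) = (4 * P - 3) * (x * P ^ 4) := by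
    rw [euler_mul, hx, h2]; push_cast; ring
  have h4 := euler_pow h3 n
  refine (hv.mul_left (P ^ 2 * (x * P ^ 4) ^ n)).trans (dvd_of_eq ?_)
  rw [twist, euler_mul, euler_mul, h4, h1]
  simp only [map_add, map_mul, map_natCast, map_ofNat]
  linear_combination (euler v * P * (x * P ^ 4) ^ n + 12 * C η * P * (x * P ^ 4) ^ n * v) * hP

theorem twist_term_right {η : S} {M : ℕ} {v : S⟦X⟧} (hx : euler x = x) (hP : (1 + 3 * x) * P = 1)
    (hv : X ^ M ∣ (1 + 3 * x) * euler v + C (4 * η) * (3 * x) * v) (n : ℕ) :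
    X ^ M ∣ twist (3 * η) (v * P * (x ^ 3 * P ^ 4) ^ n) -
      (C (n + η) * (4 * P - 1) - (1 - P)) * (v * P * (x ^ 3 * P ^ 4) ^ n) := by
  have h1 : euler P = P ^ 2 - P := euler_inverse (euler_ofNat_mul hx) hP
  have h2 : euler (P ^ 4) = ((4 : ℕ) : S⟦X⟧) * (P - 1) * P ^ 4 := euler_pow (by rw [h1]; ring) 4
  have h20 : euler (x ^ 3) = ((3 : ℕ) : S⟦X⟧) * 1 * x ^ 3 := euler_pow (by rw [hx]; ring) 3
  have h3 : euler (x ^ 3 * P ^ 4) = (4 * P - 1) * (x ^ 3 * P ^ 4) := by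
    rw [euler_mul, h20, h2]; push_cast; ring
  have h4 := euler_pow h3 n
  refine (hv.mul_left (P ^ 2 * (x ^ 3 * P ^ 4) ^ n)).trans (dvd_of_eq ?_)
  rw [twist, euler_mul, euler_mul, h4, h1]
  simp only [map_add, map_mul, map_natCast, map_ofNat]
  linear_combination (euler v * P * (x ^ 3 * P ^ 4) ^ n + 4 * C η * P * (x ^ 3 * P ^ 4) ^ n * v) * hP

theorem picardFuchs_symbol_left (hx : euler x = x) (hP : (1 + 27 * x) * P = 1) (y : S) :
    (1 + 14 * x + 81 * x ^ 2) *
      (euler (euler (C y * (4 * P - 3) - (1 - P))) + 3 * (C y * (4 * P - 3) - (1 - P)) *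
        euler (C y * (4 * P - 3) - (1 - P)) + (C y * (4 * P - 3) - (1 - P)) ^ 3) +
      (21 * x + 243 * x ^ 2) * (euler (C y * (4 * P - 3) - (1 - P)) +
        (C y * (4 * P - 3) - (1 - P)) ^ 2) +
      (13 * x + 243 * x ^ 2) * (C y * (4 * P - 3) - (1 - P)) + (3 * x + 81 * x ^ 2) =
      (1 - 81 * x) * (1 + 27 * x) * (C (y ^ 3) - C (hypNum y 0) * (x * P ^ 4)) := by
  have h1 : euler P = P ^ 2 - P := euler_inverse (euler_ofNat_mul hx) hP
  have h2 : euler (P ^ 2) = 2 * (P - 1) * P ^ 2 := by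
    simpa using euler_pow (show euler P = (P - 1) * P by rw [h1]; ring) 2
  simp only [map_sub, map_add, euler_mul, euler_C, euler_one, euler_ofNat, h1, h2, hypNum, map_mul,
    map_pow, map_ofNat, map_one, map_zero]
  generalize C y = Y at *
  grind

theorem picardFuchs_symbol_right (hx : euler x = x) (hP : (1 + 3 * x) * P = 1) (y : S) :
    (1 + 14 * x + 81 * x ^ 2) *
      (euler (euler (C y * (4 * P - 1) - (1 - P))) + 3 * (C y * (4 * P - 1) - (1 - P)) *
        euler (C y * (4 * P - 1) - (1 - P)) + (C y * (4 * P - 1) - (1 - P)) ^ 3) +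
      (21 * x + 243 * x ^ 2) * (euler (C y * (4 * P - 1) - (1 - P)) +
        (C y * (4 * P - 1) - (1 - P)) ^ 2) +
      (13 * x + 243 * x ^ 2) * (C y * (4 * P - 1) - (1 - P)) + (3 * x + 81 * x ^ 2) =
      27 * (1 - x) * (1 + 3 * x) * (C (y ^ 3) - C (hypNum y 0) * (x ^ 3 * P ^ 4)) := by
  have h1 : euler P = P ^ 2 - P := euler_inverse (euler_ofNat_mul hx) hP
  have h2 : euler (P ^ 2) = 2 * (P - 1) * P ^ 2 := by
    simpa using euler_pow (show euler P = (P - 1) * P by rw [h1]; ring) 2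
  simp only [map_sub, map_add, euler_mul, euler_C, euler_one, euler_ofNat, h1, h2, hypNum, map_mul,
    map_pow, map_ofNat, map_one, map_zero]
  generalize C y = Y at *
  grind

end

/-- The level three modular transformation of the deformed hypergeometric series. -/
theorem three_isogeny {η : S} (hη : η ^ 3 = 0) {M : ℕ}
    (hreg : ∀ N : ℕ, 0 < N → N < M → ∀ z : S, (N + 3 * η) * z = 0 → z = 0)
    {x P P' v v' : S⟦X⟧} (hx : euler x = x) (hX : X ∣ x) (hP : (1 + 27 * x) * P = 1)
    (hP' : (1 + 3 * x) * P' = 1) (hv0 : coeff 0 v = 1) (hv0' : coeff 0 v' = 1)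
    (hv : X ^ M ∣ (1 + 27 * x) * euler v + C (12 * η) * (27 * x) * v)
    (hv' : X ^ M ∣ (1 + 3 * x) * euler v' + C (4 * η) * (3 * x) * v')
    {a a' : ℕ → S} (ha0 : a 0 = 1) (ha0' : a' 0 = 1)
    (ha : ∀ n, n + 1 < M → a (n + 1) * (n + 1 + 3 * η) ^ 3 = a n * hypNum (n + 3 * η) 0)
    (ha' : ∀ n, n + 1 < M → a' (n + 1) * (n + 1 + η) ^ 3 = a' n * hypNum (n + η) 0) :
    X ^ M ∣ ∑ n ∈ range M, C (a n) * (v * P * (x * P ^ 4) ^ n) -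
      ∑ n ∈ range M, C (a' n) * (v' * P' * (x ^ 3 * P' ^ 4) ^ n) := by
  rcases Nat.eq_zero_or_pos M with rfl | hM
  · simp
  have c0 : constantCoeff x = 0 := X_dvd_iff.1 hX
  have cP : constantCoeff P = 1 := by
    have := congrArg constantCoeff hP; simpa [c0] using this
  have cP' : constantCoeff P' = 1 := by
    have := congrArg constantCoeff hP'; simpa [c0] using this
  refine X_pow_dvd_of_picardFuchs (κ := 3 * η) hX hreg ?_ ?_
  · rw [picardFuchs_sub]
    refine dvd_sub ?_ ?_
    · exact X_pow_dvd_picardFuchs_sum (by rw [mul_pow, hη, mul_zero]) (hX.mul_right _)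
        (twist_term_left hx hP hv) (picardFuchs_symbol_left hx hP) ha
    · exact X_pow_dvd_picardFuchs_sum hη ((dvd_pow hX (by norm_num)).mul_right _)
        (twist_term_right hx hP' hv') (picardFuchs_symbol_right hx hP') ha'
  · rw [coeff_zero_eq_constantCoeff_apply] at hv0 hv0' ⊢
    obtain ⟨N, rfl⟩ : ∃ N, M = N + 1 := ⟨M - 1, by omega⟩
    simp [map_sum, sum_range_succ', c0, cP, cP', hv0, hv0', ha0, ha0']

end PowerSeries

namespace PowerSeries

section

variable {S T : Type*} [CommRing S] [CommRing T]

/-- The ideal of power series whose coefficients below `N` are divisible by `c`. -/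
def congrIdeal (c : S) (N : ℕ) : Ideal S⟦X⟧ where
  carrier := {f | ∀ m < N, c ∣ coeff m f}
  add_mem' hf hg m hm := by rw [map_add]; exact dvd_add (hf m hm) (hg m hm)
  zero_mem' m _ := by simp
  smul_mem' a f hf m hm := by
    rw [smul_eq_mul, coeff_mul]
    refine dvd_sum fun ij hij => (hf _ ?_).mul_left _
    have := mem_antidiagonal.1 hij
    omega

theorem mem_congrIdeal_of_X_pow_dvd {c : S} {N : ℕ} {f : S⟦X⟧} (h : X ^ N ∣ f) :
    f ∈ congrIdeal c N := fun m hm => by rw [(X_pow_dvd_iff.1 h) m hm]; exact dvd_zero c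

theorem mem_congrIdeal_of_C_dvd {c : S} {N : ℕ} {f : S⟦X⟧} (h : C c ∣ f) :
    f ∈ congrIdeal c N := fun m _ => by
  obtain ⟨g, rfl⟩ := h
  rw [coeff_C_mul]; exact dvd_mul_right _ _

theorem C_dvd_iff {c : S} {f : S⟦X⟧} : C c ∣ f ↔ ∀ m, c ∣ coeff m f := by
  constructor
  · rintro ⟨g, rfl⟩ m
    rw [coeff_C_mul]; exact dvd_mul_right _ _
  · intro h
    choose g hg using h
    exact ⟨mk g, by ext m; rw [coeff_C_mul, coeff_mk, hg]⟩

theorem map_mem_congrIdeal {c : S} {N : ℕ} {f : S⟦X⟧} (g : S →+* T) (h : f ∈ congrIdeal c N) :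
    map g f ∈ congrIdeal (g c) N := fun m hm => by
  rw [coeff_map]; exact map_dvd g (h m hm)

theorem euler_expand {n : ℕ} (hn : n ≠ 0) (f : S⟦X⟧) :
    euler (expand n hn f) = n * expand n hn (euler f) := by
  ext m
  rw [coeff_euler, ← map_natCast (C (R := S)) n, coeff_C_mul, coeff_expand, coeff_expand]
  split_ifs with h
  · obtain ⟨k, rfl⟩ := h
    rw [Nat.mul_div_cancel_left _ (by omega), coeff_euler]; push_cast; ring
  · simp

theorem X_pow_dvd_expand {n M : ℕ} (hn : n ≠ 0) {f : S⟦X⟧} (h : X ^ M ∣ f) :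
    X ^ (n * M) ∣ expand n hn f := by
  obtain ⟨g, rfl⟩ := h
  rw [map_mul, map_pow, expand_X, ← pow_mul]
  exact dvd_mul_right _ _

theorem X_pow_dvd_euler_log {c κ : S} {M : ℕ} {l P : S⟦X⟧} (hP : (1 + C c * X) * P = 1)
    (h0 : coeff 0 l = 0)
    (hl : ∀ m, 0 < m → m < M → (m : S) * coeff m l = κ * (-1) ^ (m + 1) * c ^ m) :
    X ^ M ∣ euler l - C κ * (1 - P) := by
  have h1 : X ^ M ∣ (1 + C c * X) * euler l - C κ * (C c * X) := by
    rw [X_pow_dvd_iff]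
    intro m hm
    have e : (1 + C c * X) * euler l - C κ * (C c * X) =
        euler l + X * (C c * euler l - C (κ * c)) := by rw [map_mul]; ring
    rw [e]
    rcases m with _ | m
    · rw [map_add, coeff_euler]; simp
    · rw [map_add, coeff_succ_X_mul, map_sub, coeff_C_mul, coeff_euler, coeff_euler, coeff_C,
        hl _ (by omega) hm]
      rcases m with _ | m
      · simp
      · rw [hl _ (by omega) (by omega), if_neg (by omega)]; ring
  refine (h1.mul_left P).trans (dvd_of_eq ?_)
  linear_combination (euler l - C κ) * hP

end

section

variable {p : ℕ} [Fact p.Prime]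

theorem mem_congrIdeal_of_euler {f l : ℤ_[p]⟦X⟧} (h0 : coeff 0 f = 0) (hl : C (p : ℤ_[p]) ∣ l)
    (h : euler f - f * euler l ∈ congrIdeal ((p : ℤ_[p]) ^ 4) (p ^ 2)) :
    f ∈ congrIdeal ((p : ℤ_[p]) ^ 3) (p ^ 2) := by
  have hp := (Fact.out : p.Prime)
  have hp0 : (p : ℤ_[p]) ≠ 0 := by exact_mod_cast hp.ne_zero
  obtain ⟨g, rfl⟩ := hl
  intro m
  induction m using Nat.strong_induction_on with
  | _ m ih =>
    intro hm
    rcases Nat.eq_zero_or_pos m with rfl | hm0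
    · rw [h0]; exact dvd_zero _
    have h1 := h m hm
    rw [map_sub, coeff_euler, coeff_mul] at h1
    have h2 : (p : ℤ_[p]) ^ 4 ∣ ∑ ij ∈ antidiagonal m,
        coeff ij.1 f * coeff ij.2 (euler (C (p : ℤ_[p]) * g)) := by
      refine dvd_sum fun ij hij => ?_
      have hij := mem_antidiagonal.1 hij
      rw [coeff_euler, coeff_C_mul]
      rcases Nat.eq_zero_or_pos ij.2 with h2 | h2
      · simp [h2]
      · obtain ⟨c, hc⟩ := ih ij.1 (by omega) (by omega)
        rw [hc]
        exact ⟨c * ij.2 * coeff ij.2 g, by ring⟩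
    have h3 := (dvd_sub_left h2).1 h1
    by_cases hpm : p ∣ m
    · obtain ⟨k, rfl⟩ := hpm
      have hk : ¬ p ∣ k := by
        refine Nat.not_dvd_of_pos_of_lt (Nat.pos_of_ne_zero fun h => by simp [h] at hm0) ?_
        rw [pow_two] at hm
        exact Nat.lt_of_mul_lt_mul_left hm
      have h4 : (p : ℤ_[p]) * p ^ 3 ∣ p * (k * coeff (p * k) f) := by
        refine (dvd_of_eq (by ring)).trans (h3.trans (dvd_of_eq ?_)); push_cast; ring
      exact (PadicInt.isUnit_natCast hk).dvd_mul_left.1 ((mul_dvd_mul_iff_left hp0).1 h4)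
    · exact (pow_dvd_pow _ (by norm_num)).trans
        ((PadicInt.isUnit_natCast hpm).dvd_mul_left.1 h3)

theorem exists_natCast_mul_eq {m : ℕ} (h0 : 0 < m) (hm : m < p ^ 2) :
    ∃ j : ℤ_[p], m * j = p := by
  have hp := (Fact.out : p.Prime)
  by_cases hpm : p ∣ m
  · obtain ⟨k, rfl⟩ := hpm
    have hk : ¬ p ∣ k := by
      refine Nat.not_dvd_of_pos_of_lt (Nat.pos_of_ne_zero fun h => by simp [h] at h0) ?_
      rw [pow_two] at hm
      exact Nat.lt_of_mul_lt_mul_left hm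
    obtain ⟨j, hj⟩ := (PadicInt.isUnit_natCast hk).exists_right_inv
    exact ⟨j, by push_cast; linear_combination (p : ℤ_[p]) * hj⟩
  · obtain ⟨j, hj⟩ := (PadicInt.isUnit_natCast hpm).exists_right_inv
    exact ⟨p * j, by linear_combination (p : ℤ_[p]) * hj⟩

theorem exists_log_series (hp2 : p ≠ 2) (c : ℤ_[p]) : ∃ l₁ l₂ l : ℤ_[p]⟦X⟧,
    coeff 0 l₁ = 0 ∧ coeff 0 l₂ = 0 ∧
    (∀ m, 0 < m → m < p → (m : ℤ_[p]) * coeff m l₁ = 1 * (-1) ^ (m + 1) * c ^ m) ∧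
    (∀ m, 0 < m → m < p ^ 2 → (m : ℤ_[p]) * coeff m l₂ = p * (-1) ^ (m + 1) * c ^ m) ∧
    l₂ = expand p (Fact.out : p.Prime).ne_zero l₁ + l ∧ C (p : ℤ_[p]) ∣ l := by
  have hp := (Fact.out : p.Prime)
  have hex1 : ∀ m, ∃ j : ℤ_[p], 0 < m ∧ m < p → m * j = 1 := fun m => by
    by_cases h : 0 < m ∧ m < p
    · obtain ⟨j, hj⟩ := (PadicInt.isUnit_natCast
        (Nat.not_dvd_of_pos_of_lt h.1 h.2)).exists_right_inv
      exact ⟨j, fun _ => hj⟩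
    · exact ⟨0, fun h' => absurd h' h⟩
  have hex2 : ∀ m, ∃ j : ℤ_[p], 0 < m ∧ m < p ^ 2 → m * j = p := fun m => by
    by_cases h : 0 < m ∧ m < p ^ 2
    · obtain ⟨j, hj⟩ := exists_natCast_mul_eq (p := p) h.1 h.2
      exact ⟨j, fun _ => hj⟩
    · exact ⟨0, fun h' => absurd h' h⟩
  choose j1 hj1 using hex1
  choose j2 hj2 using hex2
  set l1 : ℤ_[p]⟦X⟧ := mk fun m => if 0 < m ∧ m < p then j1 m * (-1) ^ (m + 1) * c ^ m else 0 with hl1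
  set l2 : ℤ_[p]⟦X⟧ :=
    mk fun m => if 0 < m ∧ m < p ^ 2 then j2 m * (-1) ^ (m + 1) * c ^ m else 0 with hl2
  refine ⟨l1, l2, l2 - expand p hp.ne_zero l1, by simp [hl1], by simp [hl2], ?_, ?_, by ring, ?_⟩
  · intro m h0 h1
    rw [hl1, coeff_mk, if_pos ⟨h0, h1⟩, ← hj1 m ⟨h0, h1⟩]; ring
  · intro m h0 h1
    rw [hl2, coeff_mk, if_pos ⟨h0, h1⟩, ← hj2 m ⟨h0, h1⟩]; ring
  · rw [C_dvd_iff]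
    intro m
    rw [map_sub, coeff_expand, hl1, hl2, coeff_mk, coeff_mk]
    by_cases hpm : p ∣ m
    · obtain ⟨k, rfl⟩ := hpm
      rw [if_pos (dvd_mul_right _ _), Nat.mul_div_cancel_left _ hp.pos]
      have e1 : (0 < p * k ∧ p * k < p ^ 2) ↔ (0 < k ∧ k < p) := by
        rw [pow_two, Nat.mul_lt_mul_left hp.pos, Nat.mul_pos_iff_of_pos_left hp.pos]
      by_cases hk : 0 < k ∧ k < p
      · rw [if_pos (e1.2 hk), if_pos hk]
        have h1 := hj1 k hk
        have h2 := hj2 _ (e1.2 hk)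
        have hp0 : (p : ℤ_[p]) ≠ 0 := by exact_mod_cast hp.ne_zero
        have h3 : j2 (p * k) = j1 k := by
          have hk0 : (k : ℤ_[p]) ≠ 0 := by exact_mod_cast hk.1.ne'
          push_cast at h2
          apply mul_left_cancel₀ (mul_ne_zero hp0 hk0)
          linear_combination h2 - p * h1
        have h4 : (-1 : ℤ_[p]) ^ (p * k + 1) = (-1) ^ (k + 1) := by
          rw [pow_succ, pow_succ, pow_mul, (hp.odd_of_ne_two hp2).neg_one_pow]
        have h5 : (p : ℤ_[p]) ∣ c ^ p - c := by
          rw [← Ideal.mem_span_singleton, ← PadicInt.maximalIdeal_eq_span_p,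
            ← PadicInt.ker_toZMod, RingHom.mem_ker]
          simp
        have h6 : (p : ℤ_[p]) ∣ c ^ (p * k) - c ^ k := by
          rw [pow_mul]; exact h5.trans (sub_dvd_pow_sub_pow _ _ k)
        rw [h3, h4]
        refine (h6.mul_left (j1 k * (-1) ^ (k + 1))).trans (dvd_of_eq ?_)
        ring
      · rw [if_neg (fun h => hk (e1.1 h)), if_neg hk]; simp
    · rw [if_neg hpm, sub_zero]
      split_ifs with h
      · have h1 := hj2 m h
        have : (p : ℤ_[p]) ∣ j2 m :=
          (PadicInt.isUnit_natCast hpm).dvd_mul_left.1 ((dvd_of_eq h1.symm))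
        exact (this.mul_right _).mul_right _
      · exact dvd_zero _

/-- Logarithmic series for `1 + cX`, and the congruence `(1 + cX)^p / (1 + cX^p) ≡ exp l`. -/
theorem exists_log_series_congr (hp3 : 3 < p) (c : ℤ_[p]) {h : ℤ_[p]} (hh : 2 * h = 1)
    {P : ℤ_[p]⟦X⟧} (hP : (1 + C c * X) * P = 1) : ∃ l₁ l₂ l : ℤ_[p]⟦X⟧,
    coeff 0 l₁ = 0 ∧ coeff 0 l₂ = 0 ∧
    X ^ p ∣ euler l₁ - (1 - P) ∧ X ^ (p ^ 2) ∣ euler l₂ - C (p : ℤ_[p]) * (1 - P) ∧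
    l₂ = expand p (Fact.out : p.Prime).ne_zero l₁ + l ∧ C (p : ℤ_[p]) ∣ l ∧
    (1 + C c * X) ^ p * expand p (Fact.out : p.Prime).ne_zero P - (1 + l + C h * l ^ 2) ∈
      congrIdeal ((p : ℤ_[p]) ^ 3) (p ^ 2) := by
  have hp := (Fact.out : p.Prime)
  obtain ⟨l₁, l₂, l, h1, h2, h3, h4, h5, h6⟩ := exists_log_series (by omega : p ≠ 2) c
  have h7 := X_pow_dvd_euler_log hP h1 h3
  have h8 := X_pow_dvd_euler_log hP h2 h4
  rw [map_one, one_mul] at h7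
  refine ⟨l₁, l₂, l, h1, h2, h7, h8, h5, h6, ?_⟩
  set φ := expand (R := ℤ_[p]) p hp.ne_zero with hφ
  have hy : euler (C c * X : ℤ_[p]⟦X⟧) = C c * X := by
    rw [euler_C_mul, euler_apply, derivative_X, mul_one]
  have hEP := euler_inverse hy hP
  have e1 : X ^ (p ^ 2) ∣ euler l - (p : ℤ_[p]⟦X⟧) * (φ P - P) := by
    have := dvd_sub h8 ((pow_two p ▸ X_pow_dvd_expand hp.ne_zero h7 :
      X ^ (p ^ 2) ∣ expand p hp.ne_zero (euler l₁ - (1 - P))).mul_left (p : ℤ_[p]⟦X⟧))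
    refine this.trans (dvd_of_eq ?_)
    have e := congrArg euler h5
    rw [map_add, euler_expand] at e
    rw [e, ← hφ, map_sub, map_sub, map_one, map_natCast]
    ring
  set q := (1 + C c * X) ^ p * φ P with hq
  have e2 : euler q = (p : ℤ_[p]⟦X⟧) * (φ P - P) * q := by
    have a1 : euler (1 + C c * X) = (1 - P) * (1 + C c * X : ℤ_[p]⟦X⟧) := by
      rw [map_add, euler_one, hy]; linear_combination hP
    have a2 := euler_pow a1 p
    rw [hq, euler_mul, a2, hφ, euler_expand, hEP, ← hφ, map_sub, map_pow]
    ring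
  obtain ⟨h6', hh6⟩ : ∃ h6 : ℤ_[p], 6 * h6 = 1 := by
    have : ¬ p ∣ 6 := fun hd => by
      rcases (Nat.Prime.dvd_mul hp).1 (show p ∣ 2 * 3 from hd) with h | h
      · have := Nat.le_of_dvd (by norm_num) h; omega
      · have := Nat.le_of_dvd (by norm_num) h; omega
    simpa using (PadicInt.isUnit_natCast (p := p) this).exists_right_inv
  set E := 1 + l + C h * l ^ 2 + C h6' * l ^ 3 with hE
  have hh' : 2 * C h = (1 : ℤ_[p]⟦X⟧) := by rw [← map_ofNat (C (R := ℤ_[p])), ← map_mul, hh, map_one]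
  have hh6' : 3 * C h6' = (C h : ℤ_[p]⟦X⟧) := by
    rw [← map_ofNat (C (R := ℤ_[p])), ← map_mul]
    congr 1
    linear_combination h * hh6 - 3 * h6' * hh
  have e3 : euler E = euler l * (1 + l + C h * l ^ 2) := by
    have b2 : euler (l ^ 2) = 2 * l * euler l := by rw [pow_two, euler_mul]; ring
    have b3 : euler (l ^ 3) = 3 * l ^ 2 * euler l := by rw [pow_succ, euler_mul, b2]; ring
    rw [hE, map_add, map_add, map_add, euler_one, euler_C_mul, euler_C_mul, b2, b3]
    linear_combination l * euler l * hh' + l ^ 2 * euler l * hh6'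
  have hpl : C ((p : ℤ_[p]) ^ 3) ∣ l ^ 3 := by rw [map_pow]; exact pow_dvd_pow_of_dvd h6 3
  have e4 : q - E ∈ congrIdeal ((p : ℤ_[p]) ^ 3) (p ^ 2) := by
    refine mem_congrIdeal_of_euler (l := l) ?_ h6 ?_
    · have hl0 : constantCoeff l = 0 := by
        have := congrArg (coeff 0) h5
        rw [map_add, coeff_zero_eq_constantCoeff_apply, coeff_zero_eq_constantCoeff_apply,
          constantCoeff_expand, ← coeff_zero_eq_constantCoeff_apply,
          ← coeff_zero_eq_constantCoeff_apply, h1, h2] at this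
        rw [← coeff_zero_eq_constantCoeff_apply]; simpa using this.symm
      have hP0 : constantCoeff P = 1 := by
        have := congrArg constantCoeff hP; simpa using this
      rw [coeff_zero_eq_constantCoeff_apply, hq, hE]
      simp [hl0, hφ, constantCoeff_expand, hP0]
    · have : euler (q - E) - (q - E) * euler l =
          -q * (euler l - p * (φ P - P)) + C h6' * l ^ 3 * euler l := by
        rw [map_sub, e2, e3, hE]; ring
      rw [this]
      refine add_mem (mem_congrIdeal_of_X_pow_dvd (e1.mul_left _)) (mem_congrIdeal_of_C_dvd ?_)
      have b1 : C (p : ℤ_[p]) ∣ euler l := by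
        obtain ⟨g, hg⟩ := h6
        rw [hg, euler_C_mul]; exact dvd_mul_right _ _
      rw [pow_succ, map_mul]
      exact mul_dvd_mul (hpl.mul_left _) b1
  have e5 : q - (1 + l + C h * l ^ 2) = (q - E) + C h6' * l ^ 3 := by rw [hE]; ring
  rw [e5]
  exact add_mem e4 (mem_congrIdeal_of_C_dvd (hpl.mul_left _))

end

end PowerSeries

section

variable {S : Type*} [CommRing S]

/-- The quadratic truncation of the exponential series, with `h` in place of `1/2`. -/
def truncExp (h a : S) : S := 1 + a + h * a ^ 2

theorem truncExp_add {h π a b : S} (hh : 2 * h = 1) (hπ : π ^ 3 = 0) (ha : π ∣ a) (hb : π ∣ b) :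
    truncExp h (a + b) = truncExp h a * truncExp h b := by
  obtain ⟨a, rfl⟩ := ha
  obtain ⟨b, rfl⟩ := hb
  simp only [truncExp]
  linear_combination (a * b * π ^ 2) * hh -
    (h * a * b ^ 2 + h * a ^ 2 * b + h ^ 2 * π * a ^ 2 * b ^ 2) * hπ

theorem truncExp_zero (h : S) : truncExp h 0 = 1 := by simp [truncExp]

theorem truncExp_natCast_mul {h π a : S} (hh : 2 * h = 1) (hπ : π ^ 3 = 0) (ha : π ∣ a) (n : ℕ) :
    truncExp h (n * a) = truncExp h a ^ n := by
  induction n with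
  | zero => simp [truncExp_zero]
  | succ n ih =>
    rw [pow_succ, ← ih, ← truncExp_add hh hπ (ha.mul_left _) ha]
    congr 1; push_cast; ring

theorem truncExp_mul_neg {h π a : S} (hh : 2 * h = 1) (hπ : π ^ 3 = 0) (ha : π ∣ a) :
    truncExp h a * truncExp h (-a) = 1 := by
  rw [← truncExp_add hh hπ ha ((dvd_neg).2 ha), add_neg_cancel, truncExp_zero]

theorem map_truncExp {T : Type*} [CommRing T] (f : S →+* T) (h a : S) :
    f (truncExp h a) = truncExp (f h) (f a) := by simp [truncExp]

/-- The summation of a lifted sequence `A (p m + r) = α m (f₀ r + π f₁ r y + π² f₂ r y²)`,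
`y = m + e`, against powers of `t`, in a ring where `π³ = 0`. -/
theorem sum_lift_twist {h π e lam t t' : S} {p M : ℕ} (hh : 2 * h = 1) (hπ : π ^ 3 = 0)
    (hlam : π ∣ lam) (ht : t ^ p = t' * truncExp h lam) {A α f0 f1 f2 : ℕ → S}
    (hA : ∀ m < M, ∀ r < p, A (p * m + r) =
      α m * (f0 r + π * f1 r * (m + e) + π ^ 2 * f2 r * (m + e) ^ 2)) :
    truncExp h (e * lam) * ∑ n ∈ range (p * M), A n * t ^ n =
      (∑ r ∈ range p, f0 r * t ^ r) * (∑ m ∈ range M, α m * t' ^ m) +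
      (π * (∑ r ∈ range p, f1 r * t ^ r) + lam * ∑ r ∈ range p, f0 r * t ^ r) *
        (∑ m ∈ range M, α m * (m + e) * t' ^ m) +
      (π ^ 2 * (∑ r ∈ range p, f2 r * t ^ r) + π * lam * (∑ r ∈ range p, f1 r * t ^ r) +
        h * lam ^ 2 * ∑ r ∈ range p, f0 r * t ^ r) *
        (∑ m ∈ range M, α m * (m + e) ^ 2 * t' ^ m) := by
  set F0 := ∑ r ∈ range p, f0 r * t ^ r with hF0
  set F1 := ∑ r ∈ range p, f1 r * t ^ r with hF1
  set F2 := ∑ r ∈ range p, f2 r * t ^ r with hF2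
  rw [sum_range_mul_eq]
  have e1 : ∀ m ∈ range M, ∑ r ∈ range p, A (p * m + r) * t ^ (p * m + r) =
      α m * (t' ^ m * truncExp h (m * lam)) * (F0 + π * (m + e) * F1 + π ^ 2 * (m + e) ^ 2 * F2) := by
    intro m hm
    rw [truncExp_natCast_mul hh hπ hlam, ← mul_pow, ← ht, ← pow_mul, hF0, hF1, hF2, mul_sum, mul_sum,
      ← sum_add_distrib, ← sum_add_distrib, mul_sum]
    refine sum_congr rfl fun r hr => ?_
    rw [hA m (mem_range.1 hm) r (mem_range.1 hr), pow_add]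
    ring
  rw [sum_congr rfl e1]
  clear_value F0 F1 F2
  rw [mul_sum, mul_sum, mul_sum, mul_sum, ← sum_add_distrib, ← sum_add_distrib]
  refine sum_congr rfl fun m _ => ?_
  have e2 := truncExp_add hh hπ (hlam.mul_left e) (hlam.mul_left (m : S))
  have e3 : truncExp h ((m + e) * lam) * (F0 + π * (m + e) * F1 + π ^ 2 * (m + e) ^ 2 * F2) =
      F0 + (π * F1 + lam * F0) * (m + e) +
        (π ^ 2 * F2 + π * lam * F1 + h * lam ^ 2 * F0) * (m + e) ^ 2 := by
    obtain ⟨a, rfl⟩ := hlam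
    simp only [truncExp]
    linear_combination ((m + e) ^ 3 * a * F2 + h * (m + e) ^ 3 * a ^ 2 * F1 +
      h * π * (m + e) ^ 4 * a ^ 2 * F2) * hπ
  rw [show (m + e) * lam = e * lam + m * lam by ring, e2] at e3
  linear_combination (α m * t' ^ m) * e3

end

namespace PowerSeries

variable {S : Type*} [CommRing S]

theorem map_euler {T : Type*} [CommRing T] (g : S →+* T) (f : S⟦X⟧) :
    map g (euler f) = euler (map g f) := by
  ext n; simp [coeff_euler]

theorem euler_truncExp {h a : S⟦X⟧} (hh : 2 * h = 1) (hh' : euler h = 0)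
    (ha : a ^ 2 * euler a = 0) : euler (truncExp h a) = euler a * truncExp h a := by
  have : euler (a ^ 2) = 2 * a * euler a := by rw [pow_two, euler_mul]; ring
  rw [truncExp, map_add, map_add, euler_one, euler_mul, hh', this]
  linear_combination a * euler a * hh - h * ha

end PowerSeries

namespace CubeNil

open PowerSeries

variable {p : ℕ} [Fact p.Prime]

/-- The coefficient sequences of the Frobenius method at levels `p` and `p²`, and the
Dwork congruence between them. -/
theorem exists_frobenius_pair (hp3 : 3 < p) (h4 : p % 4 = 1) {f0 f1 f2 : ℕ → ℤ_[p]}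
    (hf : ∀ r < p, ∀ (S : Type) [CommRing S] [Algebra ℤ_[p] S], UnitsPerturb S p → ∀ y : S,
      (p : S) ^ 3 ∣ hypTerm (p * y) 0 r - (algebraMap ℤ_[p] S (f0 r) +
        p * algebraMap ℤ_[p] S (f1 r) * y + p ^ 2 * algebraMap ℤ_[p] S (f2 r) * y ^ 2)) {e : CubeNil p}
    (he : e ^ 3 = 0) :
    ∃ a α : ℕ → CubeNil p, a 0 = 1 ∧ α 0 = 1 ∧
      (∀ n, n + 1 < p ^ 2 → a (n + 1) * (n + 1 + p * e) ^ 3 =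
        a n * hypNum (n + p * e) 0) ∧
      (∀ n, n + 1 < p → α (n + 1) * (n + 1 + e) ^ 3 = α n * hypNum (n + e) 0) ∧
      ∀ m < p, ∀ r < p, (p : CubeNil p) ^ 3 ∣ a (p * m + r) -
        α m * (algebraMap ℤ_[p] _ (f0 r) + p * algebraMap ℤ_[p] _ (f1 r) * (m + e) +
          p ^ 2 * algebraMap ℤ_[p] _ (f2 r) * (m + e) ^ 2) := by
  set α : ℕ → CubeNil p := fun m => hypTerm e 0 m with hα
  have hrec : ∀ n, n + 1 < p → α (n + 1) * (n + 1 + e) ^ 3 =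
      α n * hypNum (n + e) 0 := by
    intro n hn
    have hu : IsUnit (e + (n + 1)) := by
      have := isUnit_natCast_add (Nat.not_dvd_of_pos_of_lt (by omega) hn)
        he
      rw [add_comm]; exact_mod_cast this
    have := hypTerm_succ (e) 0 n hu
    rw [add_comm _ ((n : CubeNil p) + 1), add_comm _ (n : CubeNil p)] at this
    exact this
  obtain ⟨a, h0, h1, h2⟩ := exists_dwork_lift (ν := 0) hp3 h4 (unitsPerturb (p := p)) (by simp) hrec
  refine ⟨a, α, by rw [h0, hα]; exact hypTerm_zero _ _, hypTerm_zero _ _, ?_, hrec, ?_⟩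
  · intro n hn
    have := h1 n (by rwa [← pow_two])
    rw [mul_zero] at this
    exact this
  · intro m hm r hr
    have key := dvd_add (h2 m hm r hr)
      ((hf r hr (CubeNil p) unitsPerturb ((m : CubeNil p) + e)).mul_left (α m))
    refine key.trans (dvd_of_eq ?_)
    ring

/-- The factor `(1 + cX)^{-κ}` for nilpotent `κ`, up to order `M`. -/
theorem truncExp_twist {κ c q h : CubeNil p} (hκ : κ ^ 3 = 0) (hh : 2 * h = 1)
    {M : ℕ} {l P : (CubeNil p)⟦X⟧} (hP : (1 + C c * X) * P = 1)
    (hl : X ^ M ∣ euler l - C q * (1 - P)) :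
    X ^ M ∣ (1 + C c * X) * euler (truncExp (C h) (-(C κ * l))) +
      C (κ * q) * (C c * X) * truncExp (C h) (-(C κ * l)) := by
  have hh' : 2 * C h = (1 : (CubeNil p)⟦X⟧) := by
    rw [← map_ofNat (C (R := CubeNil p)), ← map_mul, hh, map_one]
  have e0 : euler (-(C κ * l)) = -(C κ * euler l) := by rw [map_neg, euler_C_mul]
  rw [euler_truncExp hh' (euler_C h) (by
    rw [e0]
    have : (C κ) ^ 3 = (0 : (CubeNil p)⟦X⟧) := by rw [← map_pow, hκ, map_zero]
    linear_combination -(l ^ 2 * euler l) * this), e0, map_mul]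
  refine (hl.mul_left (-(C κ * (1 + C c * X) * truncExp (C h) (-(C κ * l))))).trans (dvd_of_eq ?_)
  linear_combination (-(C κ * C q * truncExp (C h) (-(C κ * l)))) * hP

end CubeNil

namespace CubeNil

open PowerSeries

variable {p : ℕ} [Fact p.Prime]

theorem expand_truncExp_twist {n : ℕ} (hn : n ≠ 0) {κ h : CubeNil p} (hκ : κ ^ 3 = 0)
    (hh : 2 * h = 1) (l₁ l : (CubeNil p)⟦X⟧) :
    truncExp (C h) (-(C κ * (expand n hn l₁ + l))) =
      expand n hn (truncExp (C h) (-(C κ * l₁))) * truncExp (C h) (-(C κ * l)) := by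
  have hh' : 2 * C h = (1 : (CubeNil p)⟦X⟧) := by
    rw [← map_ofNat (C (R := CubeNil p)), ← map_mul, hh, map_one]
  have h3 : (C κ) ^ 3 = (0 : (CubeNil p)⟦X⟧) := by rw [← map_pow, hκ, map_zero]
  have e : expand n hn (truncExp (C h) (-(C κ * l₁))) =
      truncExp (C h) (-(C κ * expand n hn l₁)) := by
    have := map_truncExp (expand (R := CubeNil p) n hn).toRingHom (C h) (-(C κ * l₁))
    simpa [expand_C] using this
  rw [e, ← truncExp_add hh' h3 ((dvd_mul_right _ _).neg_right) ((dvd_mul_right _ _).neg_right)]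
  congr 1; ring

theorem pow_mul_expand_pow {x₀ c z : ℤ_[p]} {k : ℕ} (hz : x₀ ^ (p - 1) = 1 + z) {P : ℤ_[p]⟦X⟧}
    (hP : (1 + C c * X) * P = 1) :
    ((C x₀ * X) ^ k * P ^ 4) ^ p *
      ((1 + C c * X) ^ p * expand p (Fact.out : p.Prime).ne_zero P) ^ 4 =
    C (1 + z) ^ k * expand p (Fact.out : p.Prime).ne_zero ((C x₀ * X) ^ k * P ^ 4) := by
  have hp := (Fact.out : p.Prime)
  have hx : C (1 + z) * (C x₀ * X ^ p) = ((C x₀ * X) ^ p : ℤ_[p]⟦X⟧) := by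
    rw [← hz, ← mul_assoc, ← map_mul, ← pow_succ, Nat.sub_add_cancel hp.one_le, map_pow, mul_pow]
  simp only [map_mul, map_pow, expand_C, expand_X]
  have hP' : ((1 + C c * X) * P) ^ (4 * p) = 1 := by rw [hP, one_pow]
  calc _ = ((C x₀ * X) ^ p) ^ k * ((1 + C c * X) * P) ^ (4 * p) *
        expand p hp.ne_zero P ^ 4 := by
          generalize (1 + C c * X : ℤ_[p]⟦X⟧) = d
          generalize (C x₀ * X : ℤ_[p]⟦X⟧) = x
          ring
    _ = _ := by rw [hP', ← hx]; ring

theorem frobenius_sum_congr {h : ℤ_[p]} (hh : 2 * h = 1) {k : ℕ} {x₀ c z : ℤ_[p]}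
    (hz : x₀ ^ (p - 1) = 1 + z) (hpz : (p : ℤ_[p]) ∣ z) {P l l₁ : ℤ_[p]⟦X⟧}
    (hP : (1 + C c * X) * P = 1) (hl : C (p : ℤ_[p]) ∣ l)
    (hlq : (1 + C c * X) ^ p * expand p (Fact.out : p.Prime).ne_zero P - (1 + l + C h * l ^ 2) ∈
      congrIdeal ((p : ℤ_[p]) ^ 3) (p ^ 2)) {f0 f1 f2 : ℕ → ℤ_[p]} {a α : ℕ → CubeNil p}
    {e η : CubeNil p} (he : e ^ 3 = 0) (hek : e * k = η)
    (ha : ∀ m < p, ∀ r < p, (p : CubeNil p) ^ 3 ∣ a (p * m + r) -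
        α m * (algebraMap ℤ_[p] _ (f0 r) + p * algebraMap ℤ_[p] _ (f1 r) * (m + e) +
          p ^ 2 * algebraMap ℤ_[p] _ (f2 r) * (m + e) ^ 2))
    {T F0 F1 F2 lam : ℤ_[p]⟦X⟧} (hT : T = (C x₀ * X) ^ k * P ^ 4)
    (hF0 : F0 = ∑ r ∈ range p, C (f0 r) * T ^ r) (hF1 : F1 = ∑ r ∈ range p, C (f1 r) * T ^ r)
    (hF2 : F2 = ∑ r ∈ range p, C (f2 r) * T ^ r)
    (hlam : lam = C (k * (z - h * z ^ 2)) - 4 * l)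
    {ι : ℤ_[p]⟦X⟧ →+* (CubeNil p)⟦X⟧} (hι : ι = map (algebraMap ℤ_[p] (CubeNil p)))
    {φ : (CubeNil p)⟦X⟧ →ₐ[CubeNil p] (CubeNil p)⟦X⟧}
    (hφ : φ = expand p (Fact.out : p.Prime).ne_zero)
    {v w : (CubeNil p)⟦X⟧}
    (hv : v = truncExp (C (algebraMap _ _ h))
      (-(C (4 * e) * ι (expand p (Fact.out : p.Prime).ne_zero l₁ + l))))
    (hw : w = truncExp (C (algebraMap _ _ h)) (-(C (4 * e) * ι l₁))) :
    C (truncExp (algebraMap _ _ h) (η * algebraMap _ _ (z - h * z ^ 2))) *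
        (∑ n ∈ range (p ^ 2), C (a n) * (v * ι P * ι T ^ n)) -
      ι (expand p (Fact.out : p.Prime).ne_zero (1 + C c * X) * P) *
        (ι F0 * φ (∑ m ∈ range p, C (α m) * (w * ι P * ι T ^ m)) +
         ι (C (p : ℤ_[p]) * F1 + lam * F0) *
          φ (∑ m ∈ range p, C (α m * (m + e)) * (w * ι P * ι T ^ m)) +
         ι (C (p : ℤ_[p]) ^ 2 * F2 + C (p : ℤ_[p]) * lam * F1 + C h * lam ^ 2 * F0) *
          φ (∑ m ∈ range p, C (α m * (m + e) ^ 2) * (w * ι P * ι T ^ m))) ∈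
      congrIdeal ((p : CubeNil p) ^ 3) (p ^ 2) := by
  have hp := (Fact.out : p.Prime)
  set J := congrIdeal ((p : CubeNil p) ^ 3) (p ^ 2) with hJ
  rw [← Ideal.Quotient.eq_zero_iff_mem]
  set q := Ideal.Quotient.mk J with hq
  have hιC : ∀ y : ℤ_[p], ι (C y) = C (algebraMap _ _ y) := fun y => by rw [hι, map_C]
  have hιφ : ∀ f : ℤ_[p]⟦X⟧, ι (expand p hp.ne_zero f) = φ (ι f) := fun f => by
    rw [hι, hφ, map_expand]
  have hφC : ∀ y, φ (C y) = C y := fun y => by rw [hφ, expand_C]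
  have hιJ : ∀ f ∈ congrIdeal ((p : ℤ_[p]) ^ 3) (p ^ 2), q (ι f) = 0 := fun f hf => by
    rw [hq, Ideal.Quotient.eq_zero_iff_mem, hι]
    simpa using map_mem_congrIdeal (algebraMap ℤ_[p] (CubeNil p)) hf
  set hQ := q (ι (C h)) with hhQ
  set π := q (ι (C (p : ℤ_[p]))) with hπ
  have hh1 : 2 * hQ = 1 := by
    have : (2 : ℤ_[p]⟦X⟧) * C h = 1 := by
      rw [← map_ofNat (C (R := ℤ_[p])), ← map_mul, hh, map_one]
    have := congrArg (fun f => q (ι f)) this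
    simpa only [map_mul, map_ofNat, map_one] using this
  have hπ3 : π ^ 3 = 0 := by
    rw [hπ, ← map_pow, ← map_pow, ← map_pow]
    exact hιJ _ (mem_congrIdeal_of_C_dvd dvd_rfl)
  set L := q (ι l) with hL
  have hπL : π ∣ L := map_dvd q (map_dvd ι hl)
  set Z := q (ι (C (z - h * z ^ 2))) with hZ
  have hpZ : (p : ℤ_[p]) ∣ z - h * z ^ 2 :=
    dvd_sub hpz ((dvd_pow hpz two_ne_zero).mul_left _)
  have hπZ : π ∣ Z := map_dvd q (map_dvd ι (map_dvd C hpZ))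
  have hlamQ : q (ι lam) = k * Z - 4 * L := by
    rw [hlam, map_mul, map_natCast]
    simp only [map_sub, map_mul, map_natCast, map_ofNat, hZ, hL]
  have hπlam : π ∣ q (ι lam) := by
    rw [hlamQ]; exact dvd_sub (hπZ.mul_left _) (hπL.mul_left _)
  set E := q (C e) with hE
  -- the Frobenius quotient of `T`
  have hEZ : q (ι (C (1 + z))) = truncExp hQ Z := by
    obtain ⟨b, rfl⟩ := hpz
    set b' := q (ι (C b))
    have e1 : q (ι (C ((p : ℤ_[p]) * b))) = π * b' := by simp only [map_mul, hπ, b']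
    have e2 : Z = π * b' - hQ * (π * b') ^ 2 := by
      rw [hZ, map_sub, map_mul C h, map_pow]
      simp only [map_sub, map_mul ι (C h), map_mul q, map_pow, e1, hhQ]
    rw [map_add, map_one, map_add, map_add, map_one, map_one, e1, e2, truncExp]
    linear_combination (-(hQ ^ 3 * π * b' ^ 4) + 2 * hQ ^ 2 * b' ^ 3) * hπ3
  have hEL : q (ι ((1 + C c * X) ^ p * expand p hp.ne_zero P)) = truncExp hQ L := by
    have := hιJ _ hlq
    rw [map_sub, map_sub, sub_eq_zero] at this
    rw [this, truncExp]
    simp only [map_add, map_mul, map_pow, map_one, hL, hhQ]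
  have hTQ : q (ι T) ^ p = q (φ (ι T)) * truncExp hQ (q (ι lam)) := by
    have e1 := congrArg (fun f => q (ι f)) (pow_mul_expand_pow (k := k) hz hP)
    simp only [← hT] at e1
    rw [map_mul, map_mul, map_pow ι, map_pow q, map_pow ι, map_pow q, hEL, map_mul, map_mul,
      map_pow ι, map_pow q, hEZ, hιφ] at e1
    have e2 := truncExp_natCast_mul hh1 hπ3 hπL 4
    have e3 := truncExp_natCast_mul hh1 hπ3 hπZ k
    have e4 := truncExp_mul_neg hh1 hπ3 (hπL.mul_left ((4 : ℕ) : _ ⧸ J))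
    have e5 := truncExp_add hh1 hπ3 (hπZ.mul_left (k : _ ⧸ J))
      ((hπL.mul_left ((4 : ℕ) : _ ⧸ J)).neg_right)
    rw [hlamQ, show (k : _ ⧸ J) * Z - 4 * L = k * Z + -((4 : ℕ) * L) by push_cast; ring, e5, e3]
    rw [← e2] at e1
    linear_combination truncExp hQ (-((4 : ℕ) * L)) * e1 - q (ι T) ^ p * e4
  -- the unit factors
  have hh2 : 2 * algebraMap ℤ_[p] (CubeNil p) h = 1 := by
    rw [← map_ofNat (algebraMap ℤ_[p] (CubeNil p)), ← map_mul, hh, map_one]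
  have hvw : q v = q (φ w) * truncExp hQ (-(4 * E * L)) := by
    have e1 := expand_truncExp_twist hp.ne_zero (κ := 4 * e) (by rw [mul_pow, he, mul_zero]) hh2
      (ι l₁) (ι l)
    rw [← hφ, ← hw, ← hιφ, ← map_add, ← hv] at e1
    have e2 : q (C (4 * e)) = 4 * E := by rw [map_mul, map_mul, map_ofNat, map_ofNat]
    rw [e1, map_mul, map_truncExp, ← hιC, ← hhQ, map_neg, map_mul, ← hL, e2]
  have hγ : q (C (truncExp (algebraMap _ _ h) (η * algebraMap _ _ (z - h * z ^ 2)))) =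
      truncExp hQ (q (C η) * Z) := by
    rw [map_truncExp, map_truncExp, ← hιC, ← hhQ, map_mul, map_mul, ← hιC, ← hZ]
  have hγE : truncExp hQ (q (C η) * Z) * truncExp hQ (-(4 * E * L)) =
      truncExp hQ (E * q (ι lam)) := by
    rw [← truncExp_add hh1 hπ3 (hπZ.mul_left _) ((hπL.mul_left _).neg_right), hlamQ, ← hek]
    congr 1
    rw [map_mul, map_mul, map_natCast, map_natCast]
    ring
  have hsum := sum_lift_twist (p := p) (M := p) (A := fun n => q (C (a n)))
    (α := fun m => q (C (α m))) (f0 := fun r => q (ι (C (f0 r)))) (f1 := fun r => q (ι (C (f1 r))))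
    (f2 := fun r => q (ι (C (f2 r)))) (e := E) hh1 hπ3 hπlam hTQ (by
      intro m hm r hr
      rw [← sub_eq_zero]
      obtain ⟨y, hy⟩ := ha m hm r hr
      have e1 : q (C ((p : CubeNil p) ^ 3 * y)) = 0 := by
        rw [hq, Ideal.Quotient.eq_zero_iff_mem, map_mul]
        exact mem_congrIdeal_of_C_dvd (dvd_mul_right _ _)
      rw [← hy] at e1
      rw [← e1, hπ, hE, hιC, hιC, hιC, hιC]
      simp only [map_sub, map_mul, map_add, map_pow, map_natCast])
  have hphiS : ∀ (β : ℕ → CubeNil p), q (φ (∑ m ∈ range p, C (β m) * (w * ι P * ι T ^ m))) =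
      q (φ w) * q (φ (ι P)) * ∑ m ∈ range p, q (C (β m)) * q (φ (ι T)) ^ m := by
    intro β
    simp only [map_sum, map_mul, map_pow, hφC, mul_sum]
    exact sum_congr rfl fun _ _ => by ring
  have hS : q (∑ n ∈ range (p ^ 2), C (a n) * (v * ι P * ι T ^ n)) =
      q v * q (ι P) * ∑ n ∈ range (p * p), q (C (a n)) * q (ι T) ^ n := by
    rw [← pow_two]
    simp only [map_sum, map_mul, map_pow, mul_sum]
    exact sum_congr rfl fun _ _ => by ring
  have hF : ∀ {F : ℤ_[p]⟦X⟧} {f : ℕ → ℤ_[p]}, F = ∑ r ∈ range p, C (f r) * T ^ r →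
      q (ι F) = ∑ r ∈ range p, q (ι (C (f r))) * q (ι T) ^ r := by
    rintro F f rfl
    simp only [map_sum, map_mul, map_pow]
  rw [← hF hF0, ← hF hF1, ← hF hF2] at hsum
  have hdP : q (ι (expand p hp.ne_zero (1 + C c * X))) * q (φ (ι P)) = 1 := by
    have := congrArg (fun f => q (ι (expand p hp.ne_zero f))) hP
    simp only [map_mul, map_one] at this
    rw [← hιφ]; simpa only [map_mul] using this
  have hα : ∀ (m i : ℕ), q (C (α m * (m + e) ^ i)) = q (C (α m)) * (m + E) ^ i := fun m i => by
    simp only [map_mul, map_pow, map_add, map_natCast, hE]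
  have hα1 : ∀ (m : ℕ), q (C (α m * (m + e))) = q (C (α m)) * (m + E) := fun m => by
    simp only [map_mul, map_add, map_natCast, hE]
  generalize expand p hp.ne_zero (1 + C c * X) = D at hdP ⊢
  rw [map_sub, map_mul, hγ, hS, hvw, map_mul, map_mul, map_mul, map_add, map_add, map_mul, map_mul,
    map_mul, hphiS, hphiS, hphiS]
  simp only [hα, hα1]
  rw [show q (ι (C (p : ℤ_[p]) * F1 + lam * F0)) = π * q (ι F1) + q (ι lam) * q (ι F0) by
      simp only [map_add, map_mul, hπ],
    show q (ι (C (p : ℤ_[p]) ^ 2 * F2 + C (p : ℤ_[p]) * lam * F1 + C h * lam ^ 2 * F0)) =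
      π ^ 2 * q (ι F2) + π * q (ι lam) * q (ι F1) + hQ * q (ι lam) ^ 2 * q (ι F0) by
      simp only [map_add, map_mul, map_pow, hπ, hhQ]]
  rw [← hγE] at hsum
  generalize ∑ n ∈ range (p * p), q (C (a n)) * q (ι T) ^ n = s3 at hsum ⊢
  generalize ∑ m ∈ range p, q (C (α m)) * q (φ (ι T)) ^ m = s0 at hsum ⊢
  generalize ∑ m ∈ range p, q (C (α m)) * (m + E) * q (φ (ι T)) ^ m = s1 at hsum ⊢
  generalize ∑ m ∈ range p, q (C (α m)) * (m + E) ^ 2 * q (φ (ι T)) ^ m = s2 at hsum ⊢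
  generalize truncExp hQ (-(4 * E * L)) = t1 at hsum ⊢
  generalize truncExp hQ (q (C η) * Z) = t2 at hsum ⊢
  linear_combination (q (φ w) * q (ι P)) * hsum - (q (ι P) * q (φ w) * (q (ι F0) * s0 +
    (π * q (ι F1) + q (ι lam) * q (ι F0)) * s1 + (π ^ 2 * q (ι F2) + π * q (ι lam) * q (ι F1) +
      hQ * q (ι lam) ^ 2 * q (ι F0)) * s2)) * hdP

end CubeNil

namespace PowerSeries

variable {S : Type*} [CommRing S]

theorem coeff_zero_twist (κ : S) (f : S⟦X⟧) : coeff 0 (twist κ f) = κ * coeff 0 f := by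
  rw [coeff_twist, Nat.cast_zero, zero_add]

/-- If multiplication of the terms by `y` is realised by the operator `Λ⁻¹ (D + 1 - P)`, the second
moment is a second order operator applied to the zeroth moment. -/
theorem second_moment_eq {κ : S} {M : ℕ} {P Λ ρ U S1 S2 : S⟦X⟧} (hρ : Λ * ρ = 1)
    (h1 : X ^ M ∣ twist κ U - (Λ * S1 - (1 - P) * U))
    (h2 : X ^ M ∣ twist κ S1 - (Λ * S2 - (1 - P) * S1)) :
    X ^ M ∣ S1 - ρ * (twist κ U + (1 - P) * U) ∧
    X ^ M ∣ S2 - (ρ ^ 2 * twist κ (twist κ U) + ρ * (euler ρ + 2 * ρ * (1 - P)) * twist κ U +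
      ρ * (euler (ρ * (1 - P)) + ρ * (1 - P) ^ 2) * U) := by
  have e1 : X ^ M ∣ S1 - ρ * (twist κ U + (1 - P) * U) := by
    refine (h1.mul_left (-ρ)).trans (dvd_of_eq ?_)
    linear_combination S1 * hρ
  refine ⟨e1, ?_⟩
  have e2 := X_pow_dvd_twist κ e1
  have e3 := dvd_add (h2.mul_left (-ρ)) (dvd_add (e2.mul_left ρ) (e1.mul_left (ρ * (1 - P))))
  refine e3.trans (dvd_of_eq ?_)
  rw [twist_sub, show ρ * (twist κ U + (1 - P) * U) = ρ * twist κ U + (ρ * (1 - P)) * U by ring,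
    twist_add, twist_mul κ ρ, twist_mul κ (ρ * (1 - P))]
  linear_combination S2 * hρ

theorem X_pow_dvd_twist_moment {κ e : S} {M : ℕ} {Λ μ : S⟦X⟧} {E : ℕ → S⟦X⟧} {β : ℕ → S}
    (h : ∀ m, X ^ M ∣ twist κ (E m) - (C (m + e) * Λ - μ) * E m) (N : ℕ) :
    X ^ M ∣ twist κ (∑ m ∈ range N, C (β m) * E m) -
      (Λ * (∑ m ∈ range N, C (β m * (m + e)) * E m) - μ * ∑ m ∈ range N, C (β m) * E m) := by
  rw [twist_sum, mul_sum, mul_sum, ← sum_sub_distrib, ← sum_sub_distrib]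
  refine dvd_sum fun m _ => ?_
  rw [twist_C_mul]
  refine ((h m).mul_left (C (β m))).trans (dvd_of_eq ?_)
  rw [map_mul]; ring

theorem euler_inverse_affine {P ρ : S⟦X⟧} {j : ℕ} (hP : euler P = P ^ 2 - P)
    (hρ : (4 * P - (j : S⟦X⟧)) * ρ = 1) :
    ρ * (euler ρ + 2 * ρ * (1 - P)) = (1 - P) * ρ ^ 2 * (4 * (P * ρ) + 2) := by
  have h := congrArg euler hρ
  rw [euler_mul, map_sub, euler_mul, euler_ofNat, euler_natCast, hP, euler_one] at h
  linear_combination ρ ^ 2 * h - ρ * euler ρ * hρ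

end PowerSeries

namespace CubeNil

open PowerSeries

variable {p : ℕ} [Fact p.Prime]

theorem mem_congrIdeal_of_sum (hp3 : 3 < p) {N : ℕ} {r0 r1 r2 : ℤ_[p]⟦X⟧} {U : (CubeNil p)⟦X⟧}
    (hU : coeff 0 U = 1) {φ : (CubeNil p)⟦X⟧ →ₐ[CubeNil p] (CubeNil p)⟦X⟧}
    (hφ : φ = expand p (Fact.out : p.Prime).ne_zero)
    {ι : ℤ_[p]⟦X⟧ →+* (CubeNil p)⟦X⟧} (hι : ι = map (algebraMap ℤ_[p] (CubeNil p)))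
    (h : ι r0 * φ U + ι r1 * φ (twist (3 * eps) U) +
      ι r2 * φ (twist (3 * eps) (twist (3 * eps) U)) ∈ congrIdeal ((p : CubeNil p) ^ 3) N) :
    r1 ∈ congrIdeal ((p : ℤ_[p]) ^ 3) N ∧ r2 ∈ congrIdeal ((p : ℤ_[p]) ^ 3) N := by
  suffices H : ∀ m < N, (p : ℤ_[p]) ^ 3 ∣ coeff m r0 ∧ (p : ℤ_[p]) ^ 3 ∣ coeff m r1 ∧
      (p : ℤ_[p]) ^ 3 ∣ coeff m r2 from ⟨fun m hm => (H m hm).2.1, fun m hm => (H m hm).2.2⟩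
  have hcoeff : ∀ (r : ℤ_[p]⟦X⟧) (V : (CubeNil p)⟦X⟧) (m : ℕ),
      (∀ j < m, (p : ℤ_[p]) ^ 3 ∣ coeff j r) →
      (p : CubeNil p) ^ 3 ∣ coeff m (ι r * φ V) - algebraMap _ _ (coeff m r) * coeff 0 V := by
    intro r V m hj
    rw [coeff_mul, Nat.sum_antidiagonal_eq_sum_range_succ_mk, sum_range_succ, Nat.sub_self,
      coeff_zero_eq_constantCoeff_apply, hφ, constantCoeff_expand, coeff_zero_eq_constantCoeff_apply,
      hι, coeff_map, add_sub_cancel_right]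
    refine dvd_sum fun i hi => Dvd.dvd.mul_right ?_ _
    rw [coeff_map]
    simpa using map_dvd (algebraMap ℤ_[p] (CubeNil p)) (hj i (mem_range.1 hi))
  intro m
  induction m using Nat.strong_induction_on with
  | _ m ih =>
    intro hm
    have e0 := hcoeff r0 U m fun j hj => (ih j hj (hj.trans hm)).1
    have e1 := hcoeff r1 (twist (3 * eps) U) m fun j hj => (ih j hj (hj.trans hm)).2.1
    have e2 := hcoeff r2 (twist (3 * eps) (twist (3 * eps) U)) m
      fun j hj => (ih j hj (hj.trans hm)).2.2
    have e3 := dvd_sub (h m hm) (dvd_add (dvd_add e0 e1) e2)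
    simp only [coeff_zero_twist, hU] at e2 e3
    have e4 : algebraMap ℤ_[p] (CubeNil p) ((p : ℤ_[p]) ^ 3) ∣ algebraMap _ _ (coeff m r0) +
        algebraMap _ _ (3 * coeff m r1) * eps + algebraMap _ _ (9 * coeff m r2) * eps ^ 2 := by
      rw [map_pow, map_natCast]
      refine e3.trans (dvd_of_eq ?_)
      simp only [map_add, map_mul, map_ofNat]
      ring
    obtain ⟨a0, a1, a2⟩ := dvd_coeff e4
    have h3 : IsUnit (3 : ℤ_[p]) := by
      exact_mod_cast PadicInt.isUnit_natCast (p := p) (Nat.not_dvd_of_pos_of_lt (by norm_num) hp3)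
    refine ⟨a0, h3.dvd_mul_left.1 a1, ?_⟩
    have h9 : IsUnit (9 : ℤ_[p]) := by
      have := h3.mul h3; norm_num at this; exact this
    exact h9.dvd_mul_left.1 a2

end CubeNil

namespace PowerSeries

section

variable {S : Type*} [CommRing S]

/-- The coefficient of the first moment in the Frobenius lift, with `lam` the logarithm of the
Frobenius quotient of `T`. -/
noncomputable def frobOne (n : ℕ) (π : S) (f0 f1 : ℕ → S) (T lam : S⟦X⟧) : S⟦X⟧ :=
  C π * (∑ r ∈ range n, C (f1 r) * T ^ r) + lam * ∑ r ∈ range n, C (f0 r) * T ^ r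

/-- The coefficient of the second moment in the Frobenius lift. -/
noncomputable def frobTwo (n : ℕ) (π h : S) (f0 f1 f2 : ℕ → S) (T lam : S⟦X⟧) : S⟦X⟧ :=
  C π ^ 2 * (∑ r ∈ range n, C (f2 r) * T ^ r) + C π * lam * (∑ r ∈ range n, C (f1 r) * T ^ r) +
    C h * lam ^ 2 * ∑ r ∈ range n, C (f0 r) * T ^ r

end

end PowerSeries

namespace CubeNil

open PowerSeries

variable {p : ℕ} [Fact p.Prime]

theorem exists_frobenius_side (hp3 : 3 < p) (h4 : p % 4 = 1) {h : ℤ_[p]} (hh : 2 * h = 1)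
    {f0 f1 f2 : ℕ → ℤ_[p]}
    (hf : ∀ r < p, ∀ (S : Type) [CommRing S] [Algebra ℤ_[p] S], UnitsPerturb S p → ∀ y : S,
      (p : S) ^ 3 ∣ hypTerm (p * y) 0 r - (algebraMap ℤ_[p] S (f0 r) +
        p * algebraMap ℤ_[p] S (f1 r) * y + p ^ 2 * algebraMap ℤ_[p] S (f2 r) * y ^ 2))
    {k j : ℕ} {x₀ c z : ℤ_[p]} (hz : x₀ ^ (p - 1) = 1 + z) (hpz : (p : ℤ_[p]) ∣ z)
    {P ρ T : ℤ_[p]⟦X⟧} (hP : (1 + C c * X) * P = 1) (hρ : (4 * P - (j : ℤ_[p]⟦X⟧)) * ρ = 1)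
    (hT : T = (C x₀ * X) ^ k * P ^ 4)
    {e : CubeNil p} (he : e ^ 3 = 0) (hek : e * (k : CubeNil p) = 3 * (eps : CubeNil p))
    {ι : ℤ_[p]⟦X⟧ →+* (CubeNil p)⟦X⟧} (hι : ι = map (algebraMap ℤ_[p] (CubeNil p)))
    {φ : (CubeNil p)⟦X⟧ →ₐ[CubeNil p] (CubeNil p)⟦X⟧}
    (hφ : φ = expand p (Fact.out : p.Prime).ne_zero)
    (htw : ∀ w : (CubeNil p)⟦X⟧, X ^ p ∣ (1 + C (algebraMap _ _ c) * X) * euler w +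
        C (4 * e) * (C (algebraMap _ _ c) * X) * w →
      ∀ n : ℕ, X ^ p ∣ twist (3 * eps) (w * ι P * ι T ^ n) -
        (C (n + e) * (4 * ι P - (j : (CubeNil p)⟦X⟧)) - (1 - ι P)) * (w * ι P * ι T ^ n)) :
    ∃ (l : ℤ_[p]⟦X⟧) (a α : ℕ → CubeNil p) (v w : (CubeNil p)⟦X⟧), C (p : ℤ_[p]) ∣ l ∧
      (1 + C c * X) ^ p * expand p (Fact.out : p.Prime).ne_zero P - (1 + l + C h * l ^ 2) ∈
        congrIdeal ((p : ℤ_[p]) ^ 3) (p ^ 2) ∧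
      coeff 0 v = 1 ∧ coeff 0 w = 1 ∧ a 0 = 1 ∧ α 0 = 1 ∧
      X ^ (p ^ 2) ∣ (1 + C (algebraMap _ _ c) * X) * euler v +
        C (4 * e * p) * (C (algebraMap _ _ c) * X) * v ∧
      X ^ p ∣ (1 + C (algebraMap _ _ c) * X) * euler w +
        C (4 * e) * (C (algebraMap _ _ c) * X) * w ∧
      (∀ n, n + 1 < p ^ 2 → a (n + 1) * (n + 1 + p * e) ^ 3 = a n * hypNum (n + p * e) 0) ∧
      (∀ n, n + 1 < p → α (n + 1) * (n + 1 + e) ^ 3 = α n * hypNum (n + e) 0) ∧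
      ∃ r0 r1 r2 : ℤ_[p]⟦X⟧,
        r1 = expand p (Fact.out : p.Prime).ne_zero (1 + C c * X) * P *
          (frobOne p (p : ℤ_[p]) f0 f1 T (C (k * (z - h * z ^ 2)) - 4 * l) *
            expand p (Fact.out : p.Prime).ne_zero ρ +
          frobTwo p (p : ℤ_[p]) h f0 f1 f2 T (C (k * (z - h * z ^ 2)) - 4 * l) *
            expand p (Fact.out : p.Prime).ne_zero ((1 - P) * ρ ^ 2 * (4 * (P * ρ) + 2))) ∧
        r2 = expand p (Fact.out : p.Prime).ne_zero (1 + C c * X) * P *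
          (frobTwo p (p : ℤ_[p]) h f0 f1 f2 T (C (k * (z - h * z ^ 2)) - 4 * l) *
            expand p (Fact.out : p.Prime).ne_zero (ρ ^ 2)) ∧
        C (truncExp (algebraMap _ _ h) (3 * eps * algebraMap _ _ (z - h * z ^ 2))) *
            (∑ n ∈ range (p ^ 2), C (a n) * (v * ι P * ι T ^ n)) -
          (ι r0 * φ (∑ m ∈ range p, C (α m) * (w * ι P * ι T ^ m)) +
           ι r1 * φ (twist (3 * eps) (∑ m ∈ range p, C (α m) * (w * ι P * ι T ^ m))) +
           ι r2 * φ (twist (3 * eps) (twist (3 * eps)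
            (∑ m ∈ range p, C (α m) * (w * ι P * ι T ^ m))))) ∈
          congrIdeal ((p : CubeNil p) ^ 3) (p ^ 2) := by
  have hp := (Fact.out : p.Prime)
  obtain ⟨a, α, ha0, hα0, ha, hα, haα⟩ := exists_frobenius_pair hp3 h4 hf he
  obtain ⟨l₁, l₂, l, hl1, hl2, hl1', hl2', hl12, hpl, hlq⟩ := exists_log_series_congr hp3 c hh hP
  have hh2 : 2 * algebraMap ℤ_[p] (CubeNil p) h = 1 := by
    rw [← map_ofNat (algebraMap ℤ_[p] (CubeNil p)), ← map_mul, hh, map_one]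
  have hιC : ∀ y : ℤ_[p], ι (C y) = C (algebraMap _ _ y) := fun y => by rw [hι, map_C]
  have hιX : ι X = X := by rw [hι, map_X]
  have hιφ : ∀ f : ℤ_[p]⟦X⟧, ι (expand p hp.ne_zero f) = φ (ι f) := fun f => by
    rw [hι, hφ, map_expand]
  have hιe : ∀ f : ℤ_[p]⟦X⟧, ι (euler f) = euler (ι f) := fun f => by rw [hι, map_euler]
  have hιP : (1 + C (algebraMap _ _ c) * X) * ι P = 1 := by
    have := congrArg ι hP
    simpa only [map_mul, map_add, map_one, hιC, hιX] using this
  have hconst : ∀ f : ℤ_[p]⟦X⟧, coeff 0 f = 0 → ∀ κ : CubeNil p,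
      coeff 0 (truncExp (C (algebraMap ℤ_[p] (CubeNil p) h)) (-(C κ * ι f))) = 1 := by
    intro f hf0 κ
    have : constantCoeff (ι f) = 0 := by
      rw [← coeff_zero_eq_constantCoeff_apply, hι, coeff_map, hf0, map_zero]
    rw [coeff_zero_eq_constantCoeff_apply]
    simp [truncExp, this]
  have h4e : (4 * e) ^ 3 = 0 := by rw [mul_pow, he, mul_zero]
  set v := truncExp (C (algebraMap ℤ_[p] (CubeNil p) h)) (-(C (4 * e) * ι l₂)) with hv
  set w := truncExp (C (algebraMap ℤ_[p] (CubeNil p) h)) (-(C (4 * e) * ι l₁)) with hw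
  have hvd : X ^ (p ^ 2) ∣ (1 + C (algebraMap _ _ c) * X) * euler v +
        C (4 * e * p) * (C (algebraMap _ _ c) * X) * v := by
    refine truncExp_twist h4e hh2 hιP ?_
    have := map_dvd ι hl2'
    simpa only [map_pow, hιX, map_sub, hιe, map_mul, hιC, map_natCast, map_one] using this
  have hwd : X ^ p ∣ (1 + C (algebraMap _ _ c) * X) * euler w +
        C (4 * e) * (C (algebraMap _ _ c) * X) * w := by
    have := truncExp_twist (q := 1) (M := p) (l := ι l₁) h4e hh2 hιP (by
      have := map_dvd ι hl1'
      simpa only [map_pow, hιX, map_sub, hιe, map_mul, hιC, map_one, one_mul] using this)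
    rwa [mul_one] at this
  refine ⟨l, a, α, v, w, hpl, hlq, hconst _ hl2 _, hconst _ hl1 _, ha0, hα0, hvd, hwd, ha, hα, ?_⟩
  have key := frobenius_sum_congr hh hz hpz hP hpl hlq he hek haα hT rfl rfl rfl rfl hι hφ
    (v := v) (w := w) (l₁ := l₁) (by rw [← hl12]) rfl
  set K := expand p hp.ne_zero (1 + C c * X) * P with hK
  set lam := C (k * (z - h * z ^ 2)) - 4 * l with hlam
  set o1 := frobOne p (p : ℤ_[p]) f0 f1 T lam with ho1
  set o2 := frobTwo p (p : ℤ_[p]) h f0 f1 f2 T lam with ho2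
  rw [frobOne] at ho1
  rw [frobTwo] at ho2
  rw [← ho1, ← ho2] at key
  set o0 := ∑ r ∈ range p, C (f0 r) * T ^ r with ho0
  have m1 := X_pow_dvd_twist_moment (β := α) (htw w hwd) p
  have m2 := X_pow_dvd_twist_moment (β := fun m => α m * (m + e)) (htw w hwd) p
  set U := ∑ m ∈ range p, C (α m) * (w * ι P * ι T ^ m) with hU
  set S1 := ∑ m ∈ range p, C (α m * (m + e)) * (w * ι P * ι T ^ m) with hS1
  have hS2 : ∀ m, α m * (m + e) * (m + e) = α m * (m + e) ^ 2 := fun m => by ring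
  simp only [hS2] at m2
  set S2 := ∑ m ∈ range p, C (α m * (m + e) ^ 2) * (w * ι P * ι T ^ m) with hS2
  have hρι : (4 * ι P - (j : (CubeNil p)⟦X⟧)) * ι ρ = 1 := by
    have := congrArg ι hρ
    simpa only [map_mul, map_sub, map_one, map_ofNat, map_natCast] using this
  obtain ⟨n1, n2⟩ := second_moment_eq hρι m1 m2
  have hPe : euler P = P ^ 2 - P := by
    refine euler_inverse ?_ hP
    rw [euler_C_mul, euler_apply, derivative_X, mul_one]
  have hσ := euler_inverse_affine hPe hρ
  have hσι := congrArg ι hσ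
  have hσι' : ι (ρ * (euler ρ + 2 * ρ * (1 - P))) = ι ρ * (euler (ι ρ) + 2 * ι ρ * (1 - ι P)) := by
    simp only [map_mul, map_add, map_sub, hιe, map_one, map_ofNat]
  rw [← hσι', hσι] at n2
  have hτ : ι (ρ * (euler (ρ * (1 - P)) + ρ * (1 - P) ^ 2)) =
      ι ρ * (euler (ι ρ * (1 - ι P)) + ι ρ * (1 - ι P) ^ 2) := by
    simp only [map_mul, map_add, map_sub, hιe, map_one, map_pow]
  rw [← hτ] at n2
  set σ := (1 - P) * ρ ^ 2 * (4 * (P * ρ) + 2) with hσd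
  set τ := ρ * (euler (ρ * (1 - P)) + ρ * (1 - P) ^ 2) with hτd
  have q1 := X_pow_dvd_expand hp.ne_zero n1
  have q2 := X_pow_dvd_expand hp.ne_zero n2
  rw [← hφ, ← pow_two] at q1 q2
  have j1 := (congrIdeal ((p : CubeNil p) ^ 3) (p ^ 2)).mul_mem_left (ι (K * o1))
    (mem_congrIdeal_of_X_pow_dvd q1)
  have j2 := (congrIdeal ((p : CubeNil p) ^ 3) (p ^ 2)).mul_mem_left (ι (K * o2))
    (mem_congrIdeal_of_X_pow_dvd q2)
  refine ⟨K * (o0 + o1 * expand p hp.ne_zero (ρ * (1 - P)) + o2 * expand p hp.ne_zero τ), _, _,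
    rfl, rfl, ?_⟩
  have := add_mem (add_mem key j1) j2
  convert this using 1
  simp only [map_mul, map_add, map_sub, map_one, map_pow, hιφ]
  ring

end CubeNil

namespace CubeNil

open PowerSeries

variable {p : ℕ} [Fact p.Prime]

theorem eq_zero_of_add_three_mul {N : ℕ} (hN : 0 < N) {η x : CubeNil p} (hη : η ^ 3 = 0)
    (h : (N + 3 * η) * x = 0) : x = 0 :=
  eq_zero_of_add_mul hN.ne' (by rw [mul_pow, hη, mul_zero]) h

set_option maxHeartbeats 400000 in
theorem exists_frobenius_operator_congr (hp3 : 3 < p) (h4 : p % 4 = 1) {h : ℤ_[p]} (hh : 2 * h = 1)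
    {f0 f1 f2 : ℕ → ℤ_[p]}
    (hf : ∀ r < p, ∀ (S : Type) [CommRing S] [Algebra ℤ_[p] S], UnitsPerturb S p → ∀ y : S,
      (p : S) ^ 3 ∣ hypTerm (p * y) 0 r - (algebraMap ℤ_[p] S (f0 r) +
        p * algebraMap ℤ_[p] S (f1 r) * y + p ^ 2 * algebraMap ℤ_[p] S (f2 r) * y ^ 2))
    {x₀ z : ℤ_[p]} (hz : x₀ ^ (p - 1) = 1 + z) (hpz : (p : ℤ_[p]) ∣ z)
    {P ρ T P' ρ' T' : ℤ_[p]⟦X⟧} (hP : (1 + C (27 * x₀) * X) * P = 1)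
    (hρ : (4 * P - ((3 : ℕ) : ℤ_[p]⟦X⟧)) * ρ = 1) (hT : T = (C x₀ * X) ^ 1 * P ^ 4)
    (hP' : (1 + C (3 * x₀) * X) * P' = 1)
    (hρ' : (4 * P' - ((1 : ℕ) : ℤ_[p]⟦X⟧)) * ρ' = 1) (hT' : T' = (C x₀ * X) ^ 3 * P' ^ 4) :
    ∃ l l' : ℤ_[p]⟦X⟧, C (p : ℤ_[p]) ∣ l ∧ C (p : ℤ_[p]) ∣ l' ∧
      (1 + C (27 * x₀) * X) ^ p * expand p (Fact.out : p.Prime).ne_zero P - (1 + l + C h * l ^ 2) ∈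
        congrIdeal ((p : ℤ_[p]) ^ 3) (p ^ 2) ∧
      (1 + C (3 * x₀) * X) ^ p * expand p (Fact.out : p.Prime).ne_zero P' -
        (1 + l' + C h * l' ^ 2) ∈ congrIdeal ((p : ℤ_[p]) ^ 3) (p ^ 2) ∧
      expand p (Fact.out : p.Prime).ne_zero (1 + C (27 * x₀) * X) * P *
          (frobOne p (p : ℤ_[p]) f0 f1 T (C ((1 : ℕ) * (z - h * z ^ 2)) - 4 * l) *
            expand p (Fact.out : p.Prime).ne_zero ρ +
          frobTwo p (p : ℤ_[p]) h f0 f1 f2 T (C ((1 : ℕ) * (z - h * z ^ 2)) - 4 * l) *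
            expand p (Fact.out : p.Prime).ne_zero ((1 - P) * ρ ^ 2 * (4 * (P * ρ) + 2))) -
        expand p (Fact.out : p.Prime).ne_zero (1 + C (3 * x₀) * X) * P' *
          (frobOne p (p : ℤ_[p]) f0 f1 T' (C ((3 : ℕ) * (z - h * z ^ 2)) - 4 * l') *
            expand p (Fact.out : p.Prime).ne_zero ρ' +
          frobTwo p (p : ℤ_[p]) h f0 f1 f2 T' (C ((3 : ℕ) * (z - h * z ^ 2)) - 4 * l') *
            expand p (Fact.out : p.Prime).ne_zero ((1 - P') * ρ' ^ 2 * (4 * (P' * ρ') + 2))) ∈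
        congrIdeal ((p : ℤ_[p]) ^ 3) (p ^ 2) ∧
      expand p (Fact.out : p.Prime).ne_zero (1 + C (27 * x₀) * X) * P *
          (frobTwo p (p : ℤ_[p]) h f0 f1 f2 T (C ((1 : ℕ) * (z - h * z ^ 2)) - 4 * l) *
            expand p (Fact.out : p.Prime).ne_zero (ρ ^ 2)) -
        expand p (Fact.out : p.Prime).ne_zero (1 + C (3 * x₀) * X) * P' *
          (frobTwo p (p : ℤ_[p]) h f0 f1 f2 T' (C ((3 : ℕ) * (z - h * z ^ 2)) - 4 * l') *
            expand p (Fact.out : p.Prime).ne_zero (ρ' ^ 2)) ∈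
        congrIdeal ((p : ℤ_[p]) ^ 3) (p ^ 2) := by
  have hp := (Fact.out : p.Prime)
  obtain ⟨ι, hι⟩ : ∃ ι : ℤ_[p]⟦X⟧ →+* (CubeNil p)⟦X⟧,
    ι = map (algebraMap ℤ_[p] (CubeNil p)) := ⟨_, rfl⟩
  obtain ⟨φ, hφ⟩ : ∃ φ : (CubeNil p)⟦X⟧ →ₐ[CubeNil p] (CubeNil p)⟦X⟧,
    φ = expand p hp.ne_zero := ⟨_, rfl⟩
  have hιC : ∀ y : ℤ_[p], ι (C y) = C (algebraMap _ _ y) := fun y => by rw [hι, map_C]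
  have hιX : ι X = X := by rw [hι, map_X]
  have heps := eps_pow_three (p := p)
  set x : (CubeNil p)⟦X⟧ := C (algebraMap _ _ x₀) * X with hx
  have hex : euler x = x := by rw [hx, euler_C_mul, euler_apply, derivative_X, mul_one]
  have h27 : (C (algebraMap ℤ_[p] (CubeNil p) (27 * x₀)) * X : (CubeNil p)⟦X⟧) = 27 * x := by
    rw [map_mul, map_mul, map_ofNat, map_ofNat, mul_assoc]
  have h3 : (C (algebraMap ℤ_[p] (CubeNil p) (3 * x₀)) * X : (CubeNil p)⟦X⟧) = 3 * x := by
    rw [map_mul, map_mul, map_ofNat, map_ofNat, mul_assoc]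
  have hιP : (1 + 27 * x) * ι P = 1 := by
    have := congrArg ι hP
    simpa only [map_mul ι, map_add, map_one, hιC, hιX, h27] using this
  have hιP' : (1 + 3 * x) * ι P' = 1 := by
    have := congrArg ι hP'
    simpa only [map_mul ι, map_add, map_one, hιC, hιX, h3] using this
  have hιT : ι T = x * ι P ^ 4 := by
    rw [hT, pow_one, map_mul, map_mul, hιC, hιX, map_pow]
  have hιT' : ι T' = x ^ 3 * ι P' ^ 4 := by
    rw [hT', map_mul, map_pow, map_mul, hιC, hιX, map_pow]
  obtain ⟨l, a, α, v, w, hl, hlq, hv0, hw0, ha0, hα0, hv, hw, ha, hα, r0, r1, r2, hr1, hr2, key⟩ :=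
    exists_frobenius_side hp3 h4 hh hf hz hpz hP hρ hT (e := 3 * eps)
      (by rw [mul_pow, heps, mul_zero]) (by push_cast; ring) hι hφ (by
        intro w hw n
        rw [h27] at hw
        rw [hιT]
        exact_mod_cast twist_term_left hex hιP (by
          rwa [show (4 : CubeNil p) * (3 * (eps : CubeNil p)) = 12 * (eps : CubeNil p) by ring] at hw) n)
  obtain ⟨l', a', α', v', w', hl', hlq', hv0', hw0', ha0', hα0', hv', hw', ha', hα', r0', r1', r2',
    hr1', hr2', key'⟩ :=
    exists_frobenius_side hp3 h4 hh hf hz hpz hP' hρ' hT' (e := eps)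
      heps (by push_cast; ring) hι hφ (by
        intro w hw n
        rw [h3] at hw
        rw [hιT']
        have := twist_term_right hex hιP' hw n
        rw [Nat.cast_one]
        exact this)
  refine ⟨l, l', hl, hl', hlq, hlq', ?_⟩
  rw [← hr1, ← hr2, ← hr1', ← hr2']
  rw [h27] at hv hw
  rw [h3] at hv' hw'
  have hX : X ∣ x := dvd_mul_left _ _
  obtain ⟨η, hη⟩ : ∃ η : CubeNil p, η = (p : CubeNil p) * (eps : CubeNil p) := ⟨_, rfl⟩
  have hη3 : η ^ 3 = 0 := by rw [hη, mul_pow, heps, mul_zero]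
  have e1 : 4 * (3 * (eps : CubeNil p)) * (p : CubeNil p) = 12 * η := by rw [hη]; ring
  have e2 : 4 * (eps : CubeNil p) * (p : CubeNil p) = 4 * η := by rw [hη]; ring
  have e3 : (p : CubeNil p) * (3 * (eps : CubeNil p)) = 3 * η := by rw [hη]; ring
  have e4 : 4 * (3 * (eps : CubeNil p)) = 12 * (eps : CubeNil p) := by ring
  rw [e1] at hv
  rw [e2] at hv'
  rw [e4] at hw
  rw [e3] at ha
  rw [← hη] at ha'
  have iso1 := three_isogeny hη3 (fun N hN _ z hz => eq_zero_of_add_three_mul hN hη3 hz)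
    hex hX hιP hιP' hv0 hv0' hv hv' ha0 ha0' ha ha'
  have iso2 := three_isogeny heps (fun N hN _ z hz => eq_zero_of_add_three_mul hN heps hz)
    hex hX hιP hιP' hw0 hw0' hw hw' hα0 hα0' hα hα'
  rw [← hιT, ← hιT'] at iso1 iso2
  set U := ∑ m ∈ range p, C (α m) * (w * ι P * ι T ^ m) with hU
  set U' := ∑ m ∈ range p, C (α' m) * (w' * ι P' * ι T' ^ m) with hU'
  have hUc : coeff 0 U = 1 := by
    have hT0 : constantCoeff (ι T) = 0 := by simp [hιT, hx]
    have hP0 : constantCoeff (ι P) = 1 := by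
      have := congrArg constantCoeff hιP; simpa [hx] using this
    have hw0c : constantCoeff w = 1 := by rw [← coeff_zero_eq_constantCoeff_apply, hw0]
    obtain ⟨n, rfl⟩ : ∃ n, p = n + 1 := ⟨p - 1, by omega⟩
    rw [hU, coeff_zero_eq_constantCoeff_apply, sum_range_succ']
    simp [hT0, hP0, hw0c, hα0]
  set γ := C (truncExp (algebraMap ℤ_[p] (CubeNil p) h)
    (3 * eps * algebraMap _ _ (z - h * z ^ 2))) with hγ
  set J := congrIdeal ((p : CubeNil p) ^ 3) (p ^ 2) with hJ
  have t1 := X_pow_dvd_twist (3 * eps) iso2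
  have t2 := X_pow_dvd_twist (3 * eps) t1
  have u0 := X_pow_dvd_expand hp.ne_zero iso2
  have u1 := X_pow_dvd_expand hp.ne_zero t1
  have u2 := X_pow_dvd_expand hp.ne_zero t2
  rw [← pow_two, ← hφ] at u0 u1 u2
  have k0 := J.mul_mem_left (ι r0') (mem_congrIdeal_of_X_pow_dvd u0)
  have k1 := J.mul_mem_left (ι r1') (mem_congrIdeal_of_X_pow_dvd u1)
  have k2 := J.mul_mem_left (ι r2') (mem_congrIdeal_of_X_pow_dvd u2)
  have k3 : _ ∈ J := J.mul_mem_left γ (mem_congrIdeal_of_X_pow_dvd iso1)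
  have := sub_mem k3 (add_mem (sub_mem key key') (add_mem k0 (add_mem k1 k2)))
  refine mem_congrIdeal_of_sum (r0 := r0 - r0') hp3 hUc hφ hι ?_
  convert this using 1
  simp only [map_sub, twist_sub]
  ring

end CubeNil

namespace PowerSeries

section

variable {R : Type*} [CommRing R]

theorem coe_polynomial_expand {k : ℕ} (hk : k ≠ 0) (Q : Polynomial R) :
    ((Polynomial.expand R k Q : Polynomial R) : R⟦X⟧) = expand k hk (Q : R⟦X⟧) := by
  ext i
  rw [Polynomial.coeff_coe, Polynomial.coeff_expand (Nat.pos_of_ne_zero hk), coeff_expand]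
  split_ifs <;> simp

/-- The power series `f` is a rational function with denominator `D` and numerator of degree
at most `n`, and its value at `1` is `a`. -/
def RatVal (D : Polynomial R) (n : ℕ) (f : R⟦X⟧) (a : R) : Prop :=
  D.natDegree ≤ n ∧ ∃ N : Polynomial R, N.natDegree ≤ n ∧ (D : R⟦X⟧) * f = N ∧
    D.eval 1 * a = N.eval 1

namespace RatVal

variable {D E : Polynomial R} {n m : ℕ} {f g : R⟦X⟧} {a b : R}

theorem add (hf : RatVal D n f a) (hg : RatVal D n g b) : RatVal D n (f + g) (a + b) := by
  obtain ⟨hD, N, hN, e, v⟩ := hf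
  obtain ⟨-, M, hM, e', v'⟩ := hg
  refine ⟨hD, N + M, (Polynomial.natDegree_add_le _ _).trans (max_le hN hM), ?_, ?_⟩
  · rw [mul_add, e, e', Polynomial.coe_add]
  · rw [mul_add, v, v', Polynomial.eval_add]

theorem mul (hf : RatVal D n f a) (hg : RatVal E m g b) :
    RatVal (D * E) (n + m) (f * g) (a * b) := by
  obtain ⟨hD, N, hN, e, v⟩ := hf
  obtain ⟨hE, M, hM, e', v'⟩ := hg
  refine ⟨Polynomial.natDegree_mul_le_of_le hD hE, N * M,
    Polynomial.natDegree_mul_le_of_le hN hM, ?_, ?_⟩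
  · rw [Polynomial.coe_mul, Polynomial.coe_mul, ← e, ← e']; ring
  · rw [Polynomial.eval_mul, Polynomial.eval_mul, ← v, ← v']; ring

theorem const (hD : D.natDegree ≤ n) (c : R) : RatVal D n (C c) c :=
  ⟨hD, D * Polynomial.C c, Polynomial.natDegree_mul_le_of_le hD (Polynomial.natDegree_C c).le,
    by simp, by simp⟩

theorem one (hD : D.natDegree ≤ n) : RatVal D n 1 1 := by
  simpa using const hD 1

theorem const_mul (c : R) (hf : RatVal D n f a) : RatVal D n (C c * f) (c * a) := by
  simpa using (const (D := 1) (n := 0) (by simp) c).mul hf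

theorem sub (hf : RatVal D n f a) (hg : RatVal D n g b) : RatVal D n (f - g) (a - b) := by
  convert hf.add (const_mul (-1) hg) using 1
  · simp [sub_eq_add_neg]
  · ring

theorem raise (hf : RatVal D n f a) (hE : E.natDegree ≤ m) : RatVal (D * E) (n + m) f a := by
  simpa using hf.mul (one hE)

theorem sum {ι : Type*} (s : Finset ι) {F : ι → R⟦X⟧} {A : ι → R} (hD : D.natDegree ≤ n)
    (h : ∀ i ∈ s, RatVal D n (F i) (A i)) : RatVal D n (∑ i ∈ s, F i) (∑ i ∈ s, A i) := by
  classical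
  induction s using Finset.induction_on with
  | empty => simpa using const hD 0
  | insert i s hi ih =>
    rw [sum_insert hi, sum_insert hi]
    exact (h i (mem_insert_self i s)).add (ih fun j hj => h j (mem_insert_of_mem hj))

theorem pow (hf : RatVal D n f a) (k : ℕ) : RatVal (D ^ k) (n * k) (f ^ k) (a ^ k) := by
  induction k with
  | zero => simpa using one (D := (1 : Polynomial R)) (n := 0) (by simp)
  | succ k ih => simpa only [pow_succ, mul_add, mul_one] using ih.mul hf

theorem sum_mul_pow (hf : RatVal D n f a) (M : ℕ) (c : ℕ → R) :
    RatVal (D ^ M) (n * M) (∑ r ∈ range M, C (c r) * f ^ r) (∑ r ∈ range M, c r * a ^ r) := by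
  refine sum _ (Polynomial.natDegree_pow_le_of_le M hf.1 |>.trans (by rw [mul_comm])) ?_
  intro r hr
  have hr' := (mem_range.1 hr).le
  have := ((hf.pow r).raise (E := D ^ (M - r)) (m := n * (M - r))
    (Polynomial.natDegree_pow_le_of_le _ hf.1 |>.trans (by rw [mul_comm]))).const_mul (c r)
  rwa [← pow_add, ← mul_add, Nat.add_sub_cancel' hr'] at this

theorem expand {k : ℕ} (hk : k ≠ 0) (hf : RatVal D n f a) :
    RatVal (Polynomial.expand R k D) (n * k) (expand k hk f) a := by
  obtain ⟨hD, N, hN, e, v⟩ := hf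
  refine ⟨?_, Polynomial.expand R k N, ?_, ?_, ?_⟩
  · rw [Polynomial.natDegree_expand]; gcongr
  · rw [Polynomial.natDegree_expand]; gcongr
  · rw [coe_polynomial_expand hk, coe_polynomial_expand hk, ← map_mul, e]
  · rw [Polynomial.expand_eval, Polynomial.expand_eval, one_pow, v]

theorem dvd_of_mem_congrIdeal {c : R} {M : ℕ} (hf : RatVal D n f a) (hD : IsUnit (D.eval 1))
    (h : f ∈ congrIdeal c M) (hn : n < M) : c ∣ a := by
  obtain ⟨-, N, hN, e, v⟩ := hf
  have : c ∣ N.eval 1 := by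
    rw [Polynomial.eval_eq_sum_range]
    refine dvd_sum fun i hi => ?_
    have := (congrIdeal c M).mul_mem_left (D : R⟦X⟧) h i (by have := mem_range.1 hi; omega)
    rw [e, Polynomial.coeff_coe] at this
    exact this.mul_right _
  rw [← v] at this
  exact (hD.dvd_mul_left).1 this

end RatVal

end

end PowerSeries

namespace PowerSeries

section

variable {R : Type*} [CommRing R]

theorem ratVal_frobenius_side {p : ℕ} (hp0 : p ≠ 0) {k j : ℕ} (hk : k ≤ 4) {x₀ c π h : R}
    {f0 f1 f2 : ℕ → R} {P ρ T : R⟦X⟧} (hP : (1 + C c * X) * P = 1)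
    (hρ : (4 * P - (j : R⟦X⟧)) * ρ = 1) (hT : T = (C x₀ * X) ^ k * P ^ 4) {a b : R}
    (ha : (1 + c) * a = 1) (hb : (4 * a - j) * b = 1) (κ : R) {q lam : R⟦X⟧} {w L t F0 F1 F2 : R}
    (hq : q = (1 + C c * X) ^ p * expand p hp0 P)
    (hlam : lam = C κ - 4 * ((q - 1) - C h * (q - 1) ^ 2))
    (hw : w = (1 + c) ^ p * a) (hL : L = κ - 4 * ((w - 1) - h * (w - 1) ^ 2))
    (ht : t = x₀ ^ k * a ^ 4) (hF0 : F0 = ∑ r ∈ range p, f0 r * t ^ r)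
    (hF1 : F1 = ∑ r ∈ range p, f1 r * t ^ r) (hF2 : F2 = ∑ r ∈ range p, f2 r * t ^ r) :
    ∃ E : Polynomial R, IsUnit (E.eval 1) ∧
      RatVal E (12 * p) (expand p hp0 (1 + C c * X) * P *
          (frobOne p π f0 f1 T lam * expand p hp0 ρ +
          frobTwo p π h f0 f1 f2 T lam * expand p hp0 ((1 - P) * ρ ^ 2 * (4 * (P * ρ) + 2))))
        ((π * F1 + L * F0) * b +
          (π ^ 2 * F2 + π * L * F1 + h * L ^ 2 * F0) * ((1 - a) * b ^ 2 * (4 * (a * b) + 2))) ∧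
      RatVal E (12 * p) (expand p hp0 (1 + C c * X) * P *
          (frobTwo p π h f0 f1 f2 T lam * expand p hp0 (ρ ^ 2)))
        ((π ^ 2 * F2 + π * L * F1 + h * L ^ 2 * F0) * b ^ 2) := by
  set d : Polynomial R := 1 + Polynomial.C c * Polynomial.X with hd
  set g : Polynomial R := 4 - (j : Polynomial R) * d with hg
  have dd : d.natDegree ≤ 1 := by rw [hd]; compute_degree
  have dg : g.natDegree ≤ 1 := by rw [hg, hd]; compute_degree
  have cd : (d : R⟦X⟧) = 1 + C c * X := by simp [hd]
  have cg : (g : R⟦X⟧) = 4 - (j : R⟦X⟧) * (1 + C c * X) := by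
    have h4 : ((4 : Polynomial R) : R⟦X⟧) = 4 := by
      rw [← map_ofNat Polynomial.C 4, Polynomial.coe_C, map_ofNat]
    have hj : ((j : Polynomial R) : R⟦X⟧) = j := by
      rw [← map_natCast Polynomial.C j, Polynomial.coe_C, map_natCast]
    rw [hg, Polynomial.coe_sub, Polynomial.coe_mul, cd, h4, hj]
  have vd : d.eval 1 = 1 + c := by simp [hd]
  have vg : g.eval 1 = 4 - j * (1 + c) := by
    rw [hg, Polynomial.eval_sub, Polynomial.eval_mul, vd, Polynomial.eval_natCast,
      Polynomial.eval_ofNat]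
  have ud : IsUnit (d.eval 1) := vd ▸ IsUnit.of_mul_eq_one _ ha
  have ug : IsUnit (g.eval 1) := by
    refine isUnit_of_dvd_unit ⟨b, ?_⟩ ud
    rw [vd, vg]
    linear_combination -(1 + c) * hb + 4 * b * ha
  have rP : RatVal d 1 P a := ⟨dd, 1, by simp, by simp [cd, hP], by simp [vd, ha]⟩
  have rT : RatVal (d ^ 4) 4 T t := by
    refine ⟨Polynomial.natDegree_pow_le_of_le 4 dd, (Polynomial.C x₀ * Polynomial.X) ^ k, ?_, ?_, ?_⟩
    · exact (Polynomial.natDegree_pow_le_of_le k (Polynomial.natDegree_C_mul_le x₀ _)).trans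
        (by simpa using Nat.mul_le_mul hk Polynomial.natDegree_X_le)
    · rw [hT, Polynomial.coe_pow, Polynomial.coe_pow, cd]
      push_cast
      linear_combination (C x₀ * X) ^ k * congrArg (· ^ 4) hP
    · rw [Polynomial.eval_pow, vd, ht]
      simp only [Polynomial.eval_pow, Polynomial.eval_mul, Polynomial.eval_C, Polynomial.eval_X]
      linear_combination x₀ ^ k * congrArg (· ^ 4) ha
  have rd : RatVal (1 : Polynomial R) 1 (1 + C c * X) (1 + c) :=
    ⟨by simp, d, dd, by simp [cd], by simp [vd]⟩
  have rdp : RatVal (1 : Polynomial R) p ((1 + C c * X) ^ p) ((1 + c) ^ p) := by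
    simpa using rd.pow p
  set d' := Polynomial.expand R p d with hd'
  set g' := Polynomial.expand R p g with hg'
  have dd' : d'.natDegree ≤ p := by
    rw [hd', Polynomial.natDegree_expand]; nlinarith
  have dg' : g'.natDegree ≤ p := by
    rw [hg', Polynomial.natDegree_expand]; nlinarith
  have ud' : IsUnit (d'.eval 1) := by rwa [hd', Polynomial.expand_eval, one_pow]
  have ug' : IsUnit (g'.eval 1) := by rwa [hg', Polynomial.expand_eval, one_pow]
  have rq : RatVal d' p q w := by
    refine ⟨dd', d ^ p, (Polynomial.natDegree_pow_le_of_le p dd).trans (by simp), ?_, ?_⟩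
    · have := congrArg (expand p hp0) hP
      rw [map_mul, map_one] at this
      rw [hd', coe_polynomial_expand hp0, Polynomial.coe_pow, cd, hq]
      linear_combination (1 + C c * X) ^ p * this
    · rw [hd', Polynomial.expand_eval, one_pow, Polynomial.eval_pow, vd, hw]
      linear_combination (1 + c) ^ p * ha
  have rlam : RatVal (d' ^ 2) (2 * p) lam L := by
    have r1 := rq.sub (RatVal.one dd')
    have r2 := r1.raise dd'
    have r3 := ((r1.mul r1).const_mul h)
    have r4 := (RatVal.const (D := d' * d') (n := p + p)
      (Polynomial.natDegree_mul_le_of_le dd' dd') κ).sub ((r2.sub r3).const_mul 4)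
    rw [hlam, hL]
    convert r4 using 1
    · ring
    · ring
    · rw [map_ofNat]; ring
    · ring
  have rK : RatVal d p (expand p hp0 (1 + C c * X) * P) 1 := by
    refine ⟨dd.trans (Nat.one_le_iff_ne_zero.2 hp0), d', dd', ?_, ?_⟩
    · rw [hd', coe_polynomial_expand hp0, cd]
      linear_combination expand p hp0 (1 + C c * X) * hP
    · rw [hd', Polynomial.expand_eval, one_pow, mul_one]
  have rρ : RatVal g 1 ρ b := by
    refine ⟨dg, d, dd, ?_, ?_⟩
    · rw [cg, cd]; linear_combination (1 + C c * X) * hρ - 4 * ρ * hP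
    · rw [vg, vd]; linear_combination (1 + c) * hb - 4 * b * ha
  have rPρ : RatVal g 1 (4 * (P * ρ) + 2) (4 * (a * b) + 2) := by
    have r1 : RatVal g 1 (P * ρ) (a * b) := by
      refine ⟨dg, 1, by simp, ?_, ?_⟩
      · rw [cg]
        push_cast
        linear_combination hρ - j * ρ * hP
      · rw [vg]; simp only [Polynomial.eval_one]; linear_combination hb - j * b * ha
    have := (r1.const_mul 4).add (RatVal.const dg 2)
    rwa [map_ofNat, map_ofNat] at this
  have rQ : RatVal g 1 ((1 - P) * ρ) ((1 - a) * b) := by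
    refine ⟨dg, d - 1, (Polynomial.natDegree_sub_le _ _).trans (by simp [dd]), ?_, ?_⟩
    · rw [cg, Polynomial.coe_sub, cd]
      push_cast
      linear_combination ((1 + C c * X) - 1) * hρ + (j - 4) * ρ * hP
    · rw [vg, Polynomial.eval_sub, vd, Polynomial.eval_one]
      linear_combination c * hb + (j - 4) * b * ha
  have rσ : RatVal (g ^ 3) 3 ((1 - P) * ρ ^ 2 * (4 * (P * ρ) + 2))
      ((1 - a) * b ^ 2 * (4 * (a * b) + 2)) := by
    have := (rQ.mul rρ).mul rPρ
    convert this using 1 <;> ring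
  have rρ3 : RatVal (g ^ 3) 3 ρ b := by
    have := (rρ.raise dg).raise dg
    convert this using 1; ring
  have rρ2 : RatVal (g ^ 3) 3 (ρ ^ 2) (b ^ 2) := by
    have := (rρ.mul rρ).raise dg
    convert this using 1 <;> ring
  have s0 := rT.sum_mul_pow p f0
  have s1 := rT.sum_mul_pow p f1
  have s2 := rT.sum_mul_pow p f2
  rw [← hF0] at s0
  rw [← hF1] at s1
  rw [← hF2] at s2
  have rO : RatVal ((d ^ 4) ^ p * (d' ^ 2 * d' ^ 2)) (4 * p + (2 * p + 2 * p))
      (frobOne p π f0 f1 T lam) (π * F1 + L * F0) := by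
    have hd2 := rlam.1
    have := ((s1.const_mul π).raise (Polynomial.natDegree_mul_le_of_le hd2 hd2)).add
      (s0.mul (rlam.raise hd2))
    rw [frobOne]
    convert this using 1 <;> ring
  have rO2 : RatVal ((d ^ 4) ^ p * (d' ^ 2 * d' ^ 2)) (4 * p + (2 * p + 2 * p))
      (frobTwo p π h f0 f1 f2 T lam) (π ^ 2 * F2 + π * L * F1 + h * L ^ 2 * F0) := by
    have hd2 := rlam.1
    have := (((s2.const_mul (π ^ 2)).raise (Polynomial.natDegree_mul_le_of_le hd2 hd2)).add
      ((s1.const_mul π).mul (rlam.raise hd2))).add ((s0.const_mul h).mul (rlam.mul rlam))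
    rw [frobTwo]
    convert this using 1
    · rw [map_pow]; ring
    · ring
  refine ⟨d * ((d ^ 4) ^ p * (d' ^ 2 * d' ^ 2) * Polynomial.expand R p (g ^ 3)), ?_, ?_, ?_⟩
  · simp only [Polynomial.eval_mul, Polynomial.eval_pow, map_pow]
    exact ud.mul ((((ud.pow 4).pow p).mul ((ud'.pow 2).mul (ud'.pow 2))).mul (ug'.pow 3))
  · have := rK.mul ((rO.mul (rρ3.expand hp0)).add (rO2.mul (rσ.expand hp0)))
    rw [one_mul] at this
    convert this using 1
    ring
  · have := rK.mul (rO2.mul (rρ2.expand hp0))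
    rw [one_mul] at this
    convert this using 1
    ring

end

end PowerSeries

theorem PadicInt.dvd_pow_sub_one {p : ℕ} [Fact p.Prime] {x : ℤ_[p]} (hx : IsUnit x) :
    (p : ℤ_[p]) ∣ x ^ (p - 1) - 1 := by
  rw [← Ideal.mem_span_singleton, ← PadicInt.maximalIdeal_eq_span_p, ← PadicInt.ker_toZMod,
    RingHom.mem_ker, map_sub, map_pow, map_one, ZMod.pow_card_sub_one_eq_one, sub_self]
  exact (hx.map PadicInt.toZMod).ne_zero

section

variable {R : Type*} [CommRing R]

/-- The logarithm truncated after the quadratic term. -/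
def truncLog (h x : R) : R := (x - 1) - h * (x - 1) ^ 2

theorem truncLog_mul {π h x y : R} (hh : 2 * h = 1) (hx : π ∣ x - 1) (hy : π ∣ y - 1) :
    π ^ 3 ∣ truncLog h (x * y) - (truncLog h x + truncLog h y) := by
  obtain ⟨z, hz⟩ := hx
  obtain ⟨w, hw⟩ := hy
  obtain rfl : x = π * z + 1 := by rw [← hz]; ring
  obtain rfl : y = π * w + 1 := by rw [← hw]; ring
  refine ⟨-h * (2 * (z + w) * z * w + π * z ^ 2 * w ^ 2), ?_⟩
  simp only [truncLog]
  linear_combination (-π ^ 2 * z * w) * hh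

theorem dvd_pow_sub_one' {π x : R} (hx : π ∣ x - 1) (n : ℕ) : π ∣ x ^ n - 1 :=
  hx.trans (by simpa using sub_dvd_pow_sub_pow x 1 n)

theorem truncLog_pow {π h x : R} (hh : 2 * h = 1) (hx : π ∣ x - 1) (n : ℕ) :
    π ^ 3 ∣ truncLog h (x ^ n) - n * truncLog h x := by
  induction n with
  | zero => simp [truncLog]
  | succ n ih =>
    convert dvd_add (truncLog_mul hh (dvd_pow_sub_one' hx n) hx) ih using 1
    rw [pow_succ]
    push_cast; ring

theorem truncLog_sub_dvd {π h x w τ : R} {k : ℕ} (hh : 2 * h = 1) (hx : π ∣ x - 1)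
    (hw : π ∣ w - 1) (hτ : π ∣ τ - 1) (e : τ * w ^ 4 = x ^ k) :
    π ^ 3 ∣ (k * truncLog h x - 4 * truncLog h w) - truncLog h τ := by
  have h1 := truncLog_mul hh hτ (dvd_pow_sub_one' hw 4)
  have h2 := truncLog_pow hh hw 4
  have h3 := truncLog_pow hh hx k
  rw [e] at h1
  convert dvd_sub (dvd_add h1 h2) h3 using 1
  push_cast; ring

end

namespace PowerSeries

section

variable {R : Type*} [CommRing R]

theorem log_series_congr {h : R} {N : ℕ} {q l : R⟦X⟧} {π : R} (hh : 2 * h = 1) (hl : C π ∣ l)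
    (hq : q - (1 + l + C h * l ^ 2) ∈ congrIdeal (π ^ 3) N) :
    ((q - 1) - C h * (q - 1) ^ 2) - l ∈ congrIdeal (π ^ 3) N := by
  have h2 : 2 * C h = (1 : R⟦X⟧) := by
    rw [← map_ofNat (C (R := R)) 2, ← map_mul, hh, map_one]
  set J := congrIdeal (π ^ 3) N
  have hl3 : l ^ 3 ∈ J := by
    refine mem_congrIdeal_of_C_dvd ?_
    rw [map_pow]
    exact pow_dvd_pow_of_dvd hl 3
  have := add_mem (J.mul_mem_left (1 - C h * ((q - 1) + (l + C h * l ^ 2))) hq)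
    (J.mul_mem_left (-C h * (1 + C h ^ 2 * l)) hl3)
  convert this using 1
  linear_combination -(C h * l ^ 3) * h2

theorem frob_sub_mem {n : ℕ} {π h : R} {f0 f1 f2 : ℕ → R} {T lam lam' K u v : R⟦X⟧}
    {J : Ideal R⟦X⟧} (hJ : lam' - lam ∈ J) :
    K * (frobOne n π f0 f1 T lam' * u + frobTwo n π h f0 f1 f2 T lam' * v) -
      K * (frobOne n π f0 f1 T lam * u + frobTwo n π h f0 f1 f2 T lam * v) ∈ J := by
  simp only [frobOne, frobTwo]
  convert J.mul_mem_left (K * ((∑ r ∈ range n, C (f0 r) * T ^ r) * u +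
    (C π * (∑ r ∈ range n, C (f1 r) * T ^ r) +
      C h * (lam' + lam) * ∑ r ∈ range n, C (f0 r) * T ^ r) * v)) hJ using 1
  ring

end

end PowerSeries

namespace PadicInt

open PowerSeries

variable {p : ℕ} [Fact p.Prime]

theorem pow_three_dvd_frobenius_side {h : ℤ_[p]} {f0 f1 f2 : ℕ → ℤ_[p]} {x₀ c a t z : ℤ_[p]}
    (hh : 2 * h = 1) {k j : ℕ} (hk : k ≤ 4) {P ρ T l : ℤ_[p]⟦X⟧} (hP : (1 + C c * X) * P = 1)
    (hρ : (4 * P - (j : ℤ_[p]⟦X⟧)) * ρ = 1) (hT : T = (C x₀ * X) ^ k * P ^ 4) {b : ℤ_[p]}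
    (ha : (1 + c) * a = 1) (hb : (4 * a - j) * b = 1) (hx : IsUnit x₀)
    (hz : x₀ ^ (p - 1) = 1 + z) (ht : t = x₀ ^ k * a ^ 4) (hl : C (p : ℤ_[p]) ∣ l)
    (hq : (1 + C c * X) ^ p * expand p (Fact.out : p.Prime).ne_zero P - (1 + l + C h * l ^ 2) ∈
        congrIdeal ((p : ℤ_[p]) ^ 3) (p ^ 2)) {F0 F1 F2 L₀ : ℤ_[p]}
    (hF0 : F0 = ∑ r ∈ range p, f0 r * t ^ r) (hF1 : F1 = ∑ r ∈ range p, f1 r * t ^ r)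
    (hF2 : F2 = ∑ r ∈ range p, f2 r * t ^ r) (hL₀ : L₀ = truncLog h (t ^ (p - 1))) :
    ∃ (E : Polynomial ℤ_[p]) (L : ℤ_[p]) (A B : ℤ_[p]⟦X⟧), IsUnit (E.eval 1) ∧
      (p : ℤ_[p]) ^ 3 ∣ L - L₀ ∧
      A - expand p (Fact.out : p.Prime).ne_zero (1 + C c * X) * P *
          (frobOne p (p : ℤ_[p]) f0 f1 T (C (k * (z - h * z ^ 2)) - 4 * l) *
            expand p (Fact.out : p.Prime).ne_zero ρ +
          frobTwo p (p : ℤ_[p]) h f0 f1 f2 T (C (k * (z - h * z ^ 2)) - 4 * l) *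
            expand p (Fact.out : p.Prime).ne_zero ((1 - P) * ρ ^ 2 * (4 * (P * ρ) + 2))) ∈
        congrIdeal ((p : ℤ_[p]) ^ 3) (p ^ 2) ∧
      B - expand p (Fact.out : p.Prime).ne_zero (1 + C c * X) * P *
          (frobTwo p (p : ℤ_[p]) h f0 f1 f2 T (C (k * (z - h * z ^ 2)) - 4 * l) *
            expand p (Fact.out : p.Prime).ne_zero (ρ ^ 2)) ∈
        congrIdeal ((p : ℤ_[p]) ^ 3) (p ^ 2) ∧
      RatVal E (12 * p) A ((p * F1 + L * F0) * b +
          (p ^ 2 * F2 + p * L * F1 + h * L ^ 2 * F0) * ((1 - a) * b ^ 2 * (4 * (a * b) + 2))) ∧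
      RatVal E (12 * p) B ((p ^ 2 * F2 + p * L * F1 + h * L ^ 2 * F0) * b ^ 2) := by
  have hp := (Fact.out : p.Prime)
  set q := (1 + C c * X) ^ p * expand p hp.ne_zero P with hqd
  set lam := C (k * (z - h * z ^ 2)) - 4 * ((q - 1) - C h * (q - 1) ^ 2) with hlam
  obtain ⟨E, hE, r1, r2⟩ := ratVal_frobenius_side (h := h) (π := (p : ℤ_[p])) hp.ne_zero hk hP hρ hT
    ha hb ((k : ℤ_[p]) * (z - h * z ^ 2)) hqd hlam rfl rfl ht hF0 hF1 hF2
  have hmem : lam - (C (k * (z - h * z ^ 2)) - 4 * l) ∈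
      congrIdeal ((p : ℤ_[p]) ^ 3) (p ^ 2) := by
    convert (congrIdeal ((p : ℤ_[p]) ^ 3) (p ^ 2)).mul_mem_left (-4) (log_series_congr hh hl hq)
      using 1
    rw [hlam]; ring
  have ua : IsUnit a := IsUnit.of_mul_eq_one _ ((mul_comm _ _).trans ha)
  have ud : IsUnit (1 + c) := IsUnit.of_mul_eq_one _ ha
  have hw : (1 + c) ^ p * a = (1 + c) ^ (p - 1) := by
    rw [← pow_sub_one_mul hp.ne_zero, mul_assoc, ha, mul_one]
  refine ⟨E, _, _, _, hE, ?_, frob_sub_mem hmem, ?_, r1, r2⟩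
  · have := truncLog_sub_dvd (k := k) (τ := t ^ (p - 1)) hh (dvd_pow_sub_one hx)
      (dvd_pow_sub_one ud) (dvd_pow_sub_one (by rw [ht]; exact (hx.pow k).mul (ua.pow 4))) (by
        rw [← pow_mul, ← pow_mul, mul_comm (p - 1), mul_comm (p - 1), pow_mul, pow_mul, ← mul_pow,
          ht, mul_assoc, ← mul_pow, mul_comm a, ha, one_pow, mul_one])
    rw [hL₀, hw]
    convert this using 1
    simp only [truncLog, hz]; ring
  · have := frob_sub_mem (n := p) (π := (p : ℤ_[p])) (h := h) (f0 := f0) (f1 := f1) (f2 := f2)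
      (T := T) (K := expand p hp.ne_zero (1 + C c * X) * P) (u := 0)
      (v := expand p hp.ne_zero (ρ ^ 2)) hmem
    simpa only [mul_zero, zero_add] using this

end PadicInt

namespace PadicInt

open PowerSeries

variable {p : ℕ} [Fact p.Prime]

theorem exists_affine_inverse (c : ℤ_[p]) {j : ℕ} (hj : IsUnit (4 - j : ℤ_[p])) :
    ∃ P ρ : ℤ_[p]⟦X⟧, (1 + C c * X) * P = 1 ∧ (4 * P - (j : ℤ_[p]⟦X⟧)) * ρ = 1 := by
  have h1 : IsUnit (1 + C c * X : ℤ_[p]⟦X⟧) := by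
    rw [PowerSeries.isUnit_iff_constantCoeff]; simp
  obtain ⟨P, hP⟩ := h1.exists_right_inv
  have hP0 : constantCoeff P = 1 := by simpa using congrArg constantCoeff hP
  have h2 : IsUnit (4 * P - (j : ℤ_[p]⟦X⟧)) := by
    rw [PowerSeries.isUnit_iff_constantCoeff]
    simpa [map_ofNat, hP0] using hj
  obtain ⟨ρ, hρ⟩ := h2.exists_right_inv
  exact ⟨P, ρ, hP, hρ⟩

theorem frobenius_moments_dvd (hp24 : 24 < p) (h4 : p % 4 = 1) {h : ℤ_[p]} (hh : 2 * h = 1)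
    {f0 f1 f2 : ℕ → ℤ_[p]}
    (hf : ∀ r < p, ∀ (S : Type) [CommRing S] [Algebra ℤ_[p] S], UnitsPerturb S p → ∀ y : S,
      (p : S) ^ 3 ∣ hypTerm (p * y) 0 r - (algebraMap ℤ_[p] S (f0 r) +
        p * algebraMap ℤ_[p] S (f1 r) * y + p ^ 2 * algebraMap ℤ_[p] S (f2 r) * y ^ 2))
    {x₀ a a' b b' t L : ℤ_[p]} (hx : IsUnit x₀) (ha : (1 + 27 * x₀) * a = 1)
    (ha' : (1 + 3 * x₀) * a' = 1) (hb : (4 * a - 3) * b = 1) (hb' : (4 * a' - 1) * b' = 1)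
    (ht : t = x₀ * a ^ 4) (ht' : t = x₀ ^ 3 * a' ^ 4) (hsub : IsUnit (b - b'))
    (hadd : IsUnit (b + b')) (hL : L = (t ^ (p - 1) - 1) - h * (t ^ (p - 1) - 1) ^ 2) :
    (p : ℤ_[p]) ^ 3 ∣ p * (∑ r ∈ range p, f1 r * t ^ r) + L * ∑ r ∈ range p, f0 r * t ^ r ∧
    (p : ℤ_[p]) ^ 3 ∣ p ^ 2 * (∑ r ∈ range p, f2 r * t ^ r) +
      p * L * (∑ r ∈ range p, f1 r * t ^ r) + h * L ^ 2 * ∑ r ∈ range p, f0 r * t ^ r := by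
  have hp := (Fact.out : p.Prime)
  have h3 : IsUnit (3 : ℤ_[p]) := by
    have := isUnit_natCast (p := p) (n := 3) (Nat.not_dvd_of_pos_of_lt (by omega) (by omega))
    exact_mod_cast this
  obtain ⟨P, ρ, hP, hρ⟩ := exists_affine_inverse (27 * x₀) (j := 3) (by norm_num)
  obtain ⟨P', ρ', hP', hρ'⟩ := exists_affine_inverse (3 * x₀) (j := 1)
    (by norm_num; exact h3)
  obtain ⟨z, hz⟩ : ∃ z, x₀ ^ (p - 1) = 1 + z := ⟨_, (add_sub_cancel 1 _).symm⟩
  have hpz : (p : ℤ_[p]) ∣ z := by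
    have := dvd_pow_sub_one hx
    rwa [hz, add_sub_cancel_left] at this
  obtain ⟨l, l', hl, hl', hq, hq', m1, m2⟩ := CubeNil.exists_frobenius_operator_congr (by omega) h4
    hh hf hz hpz hP hρ rfl hP' hρ' rfl
  set F0 := ∑ r ∈ range p, f0 r * t ^ r with hF0
  set F1 := ∑ r ∈ range p, f1 r * t ^ r with hF1
  set F2 := ∑ r ∈ range p, f2 r * t ^ r with hF2
  obtain ⟨E, L1, A, B, hE, hL1, hA, hB, rA, rB⟩ := pow_three_dvd_frobenius_side hh
    (k := 1) (j := 3) (by norm_num) hP hρ rfl ha (by exact_mod_cast hb) hx hz (by rw [ht, pow_one])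
    hl hq hF0 hF1 hF2 hL
  obtain ⟨E', L2, A', B', hE', hL2, hA', hB', rA', rB'⟩ := pow_three_dvd_frobenius_side hh
    (k := 3) (j := 1) (by norm_num) hP' hρ' rfl ha' (by exact_mod_cast hb') hx hz ht'
    hl' hq' hF0 hF1 hF2 hL
  have hEE : IsUnit ((E * E').eval 1) := by rw [Polynomial.eval_mul]; exact hE.mul hE'
  have hlt : 12 * p + 12 * p < p ^ 2 := by nlinarith
  have vA := ((rA.raise rA'.1).sub (mul_comm E' E ▸ rA'.raise rA.1)).dvd_of_mem_congrIdeal hEE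
    (by convert add_mem (sub_mem hA hA') m1 using 1; ring) hlt
  have vB := ((rB.raise rB'.1).sub (mul_comm E' E ▸ rB'.raise rB.1)).dvd_of_mem_congrIdeal hEE
    (by convert add_mem (sub_mem hB hB') m2 using 1; ring) hlt
  obtain ⟨e1, he1⟩ := hL1
  obtain ⟨e2, he2⟩ := hL2
  obtain rfl : L1 = L + p ^ 3 * e1 := by rw [← he1]; ring
  obtain rfl : L2 = L + p ^ 3 * e2 := by rw [← he2]; ring
  have o2 : (p : ℤ_[p]) ^ 3 ∣ p ^ 2 * F2 + p * L * F1 + h * L ^ 2 * F0 := by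
    have key : (p : ℤ_[p]) ^ 3 ∣ (p ^ 2 * F2 + p * L * F1 + h * L ^ 2 * F0) *
        ((b - b') * (b + b')) := by
      refine (dvd_add_right (Dvd.intro ((p * e1 * F1 + h * F0 * (2 * L + p ^ 3 * e1) * e1) * b ^ 2 -
        (p * e2 * F1 + h * F0 * (2 * L + p ^ 3 * e2) * e2) * b' ^ 2) rfl)).1
        (?_ : (p : ℤ_[p]) ^ 3 ∣ _ + _)
      convert vB using 1
      ring
    exact (hsub.mul hadd).dvd_mul_right.1 key
  refine ⟨?_, o2⟩
  obtain ⟨y, hy⟩ := o2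
  have key : (p : ℤ_[p]) ^ 3 ∣ (p * F1 + L * F0) * (b - b') := by
    refine (dvd_add_right (Dvd.intro (e1 * F0 * b - e2 * F0 * b' +
      (y + p * e1 * F1 + h * F0 * (2 * L + p ^ 3 * e1) * e1) *
        ((1 - a) * b ^ 2 * (4 * (a * b) + 2)) -
      (y + p * e2 * F1 + h * F0 * (2 * L + p ^ 3 * e2) * e2) *
        ((1 - a') * b' ^ 2 * (4 * (a' * b') + 2))) rfl)).1 (?_ : (p : ℤ_[p]) ^ 3 ∣ _ + _)
    convert vA using 1
    linear_combination (-((1 - a) * b ^ 2 * (4 * (a * b) + 2)) +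
      ((1 - a') * b' ^ 2 * (4 * (a' * b') + 2))) * hy
  exact hsub.dvd_mul_right.1 key

end PadicInt

theorem hypTerm_zero_zero {p : ℕ} [Fact p.Prime] {r : ℕ} (hr : r < p) :
    hypTerm (0 : ℤ_[p]) 0 r =
      (Nat.choose (4 * r) r * Nat.choose (3 * r) r * Nat.choose (2 * r) r : ℤ_[p]) := by
  have hu : IsUnit ((r.factorial : ℕ) : ℤ_[p]) :=
    PadicInt.isUnit_natCast (mt (Fact.out : p.Prime).dvd_factorial.1 (not_le.2 hr))
  have h1 := shiftedFactorial_four_mul (0 : ℤ_[p]) r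
  rw [mul_zero, shiftedFactorial_zero_left, shiftedFactorial_zero_left] at h1
  have h2 : (4 * r).choose r * (3 * r).choose r * (2 * r).choose r * r.factorial ^ 4 =
      (4 * r).factorial := by
    have e4 := Nat.choose_mul_factorial_mul_factorial (n := 4 * r) (k := r) (by omega)
    have e3 := Nat.choose_mul_factorial_mul_factorial (n := 3 * r) (k := r) (by omega)
    have e2 := Nat.choose_mul_factorial_mul_factorial (n := 2 * r) (k := r) (by omega)
    rw [show 4 * r - r = 3 * r by omega] at e4
    rw [show 3 * r - r = 2 * r by omega] at e3
    rw [show 2 * r - r = r by omega] at e2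
    rw [← e4, ← e3, ← e2]; ring
  have h3 : ((Nat.choose (4 * r) r * Nat.choose (3 * r) r * Nat.choose (2 * r) r : ℤ_[p])) *
      (r.factorial : ℤ_[p]) ^ 4 = ((4 * r).factorial : ℕ) := by exact_mod_cast congrArg (Nat.cast : ℕ → ℤ_[p]) h2
  rw [hypTerm, shiftedFactorial_zero_left]
  refine (hu.pow 4).mul_right_cancel ?_
  rw [h3, h1]
  have h4 := Ring.inverse_mul_cancel _ hu
  linear_combination (∏ j ∈ range r, hypNum ((0 : ℤ_[p]) + j) 0) * (r.factorial : ℤ_[p]) *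
    congrArg (· ^ 3) h4

theorem PadicInt.exists_sq_eq_neg_one {p : ℕ} [Fact p.Prime] (h4 : p % 4 = 1) :
    ∃ i : ℤ_[p], i ^ 2 = -1 := by
  obtain ⟨x, hx⟩ := ZMod.exists_sq_eq_neg_one_iff.2 (show p % 4 ≠ 3 by omega)
  obtain ⟨a, ha⟩ := ZMod.ringHom_surjective (PadicInt.toZMod (p := p)) x
  have hxu : IsUnit x := IsUnit.of_mul_eq_one (-x) (by linear_combination hx)
  have hau : IsUnit a := by
    refine (isUnit_map_iff PadicInt.toZMod a).1 (ha ▸ hxu)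
  have h2 : IsUnit (2 : ℤ_[p]) := by
    have := isUnit_natCast (p := p) (n := 2) fun h => by
      have := (Nat.prime_dvd_prime_iff_eq Fact.out Nat.prime_two).1 h
      omega
    exact_mod_cast this
  obtain ⟨i, hi, -⟩ := HenselianRing.is_henselian (I := IsLocalRing.maximalIdeal ℤ_[p])
    (Polynomial.X ^ 2 + 1 : Polynomial ℤ_[p]) (by monicity!) a (by
      rw [← PadicInt.ker_toZMod, RingHom.mem_ker]
      simp [ha]
      linear_combination -hx) ((by simpa [one_add_one_eq_two] using h2.mul hau : IsUnit _).map _)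
  exact ⟨i, eq_neg_of_add_eq_zero_left (by simpa [Polynomial.IsRoot] using hi)⟩

theorem shiftedLegendreEval_sq_eq {R : Type*} [CommRing R] {y t : R} (m : ℕ) {N : ℕ}
    (hN : m < N) (hy : y * (1 + y) = -64 * t) :
    shiftedLegendreEval y m ^ 2 = ∑ k ∈ range N,
      (-64) ^ k * (legendreCoeff m k * (2 * k).choose k : ℕ) * t ^ k := by
  rw [shiftedLegendreEval_sq, hy]
  refine (sum_congr rfl fun k _ => ?_).trans (sum_subset (range_subset_range.2 hN) fun k _ hk => ?_)
  · push_cast; ring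
  · rw [legendreCoeff_eq_zero (by simpa using hk)]; simp

/-- For `p ≡ 1, 9 mod 20` with `p = u² + 5v²` and `u + v√-5` a `p`-adic unit,
`∑_{k<p} (4k)!/k!⁴ (-1/1024)^k ≡ (u + v√-5)² mod p³`.
Here `(4k)!/k!⁴ = binom(4k,k) binom(3k,k) binom(2k,k)`. -/
theorem stmt_7 (p : ℕ) [Fact p.Prime] (hp20 : p % 20 = 1 ∨ p % 20 = 9) (u v : ℤ)
    (s : ℤ_[p]) (hs : s ^ 2 = -5) (huv : (p : ℤ) = u ^ 2 + 5 * v ^ 2)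
    (hunit : IsUnit ((u : ℤ_[p]) + v * s)) :
    (p : ℤ_[p]) ^ 3 ∣
      (∑ k ∈ Finset.range p,
          ((Nat.choose (4 * k) k * Nat.choose (3 * k) k * Nat.choose (2 * k) k : ℤ_[p]) *
            (-(Ring.inverse (1024 : ℤ_[p]))) ^ k))
        - ((u : ℤ_[p]) + v * s) ^ 2 := by
  have hp := (Fact.out : p.Prime)
  have hp24 : 24 < p := by
    by_contra hcon
    have : p = 1 ∨ p = 9 ∨ p = 21 := by omega
    rcases this with rfl | rfl | rfl <;> norm_num at hp
  have h4 : p % 4 = 1 := by omega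
  have hsmall : ∀ n : ℕ, 0 < n → n ≤ 24 → IsUnit (n : ℤ_[p]) := fun n hn hn' =>
    PadicInt.isUnit_natCast (Nat.not_dvd_of_pos_of_lt hn (by omega))
  obtain ⟨h, hh⟩ : ∃ h : ℤ_[p], 2 * h = 1 := by
    exact_mod_cast (hsmall 2 (by norm_num) (by norm_num)).exists_right_inv
  obtain ⟨τ, hτ⟩ : ∃ τ : ℤ_[p], 3 * τ = 1 := by
    exact_mod_cast (hsmall 3 (by norm_num) (by norm_num)).exists_right_inv
  obtain ⟨ϕ, hϕ⟩ : ∃ ϕ : ℤ_[p], 5 * ϕ = 1 := by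
    exact_mod_cast (hsmall 5 (by norm_num) (by norm_num)).exists_right_inv
  have uh : IsUnit h := IsUnit.of_mul_eq_one 2 (by rw [mul_comm, hh])
  have uτ : IsUnit τ := IsUnit.of_mul_eq_one 3 (by rw [mul_comm, hτ])
  have us : IsUnit s := IsUnit.of_mul_eq_one (-s * ϕ) (by linear_combination -ϕ * hs + hϕ)
  have u2 : IsUnit (2 : ℤ_[p]) := IsUnit.of_mul_eq_one h hh
  obtain ⟨t, ht⟩ : ∃ t : ℤ_[p], t = -(Ring.inverse 1024) := ⟨_, rfl⟩
  have u1024 : IsUnit (1024 : ℤ_[p]) := by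
    have := u2.pow 10
    norm_num at this; exact this
  have ht1 : 1024 * t = -1 := by
    rw [ht, mul_neg, Ring.mul_inverse_cancel _ u1024]
  have hth : t = -h ^ 10 := by
    linear_combination h ^ 10 * ht1 - t * congrArg (· ^ 10) hh
  rw [← ht]
  obtain ⟨f0, f1, f2, hf⟩ := exists_hypTerm_taylor (p := p)
  obtain ⟨l, hl⟩ : ∃ l, l = (t ^ (p - 1) - 1) - h * (t ^ (p - 1) - 1) ^ 2 := ⟨_, rfl⟩
  obtain ⟨h1, h2⟩ := PadicInt.frobenius_moments_dvd hp24 h4 hh hf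
    (x₀ := (1 + 4 * s) * τ ^ 4) (a := (1 - s) * h ^ 3) (a' := (7 - s) * h ^ 3)
    (b := -(5 - s) * τ * ϕ) (b' := (5 + s) * τ * ϕ) (t := t) (L := l)
    ((IsUnit.of_mul_eq_one ((1 - 4 * s) * τ ^ 4) (by grind)).mul (uτ.pow 4))
    (by grind) (by grind) (by grind) (by grind) (by grind) (by grind)
    (by
      convert (u2.mul uτ).neg using 1
      linear_combination -2 * τ * hϕ)
    (by
      convert ((u2.mul us).mul uτ).mul (IsUnit.of_mul_eq_one 5 (by rw [mul_comm, hϕ])) using 1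
      ring) hl
  obtain ⟨i, hi⟩ := PadicInt.exists_sq_eq_neg_one h4
  have hr : (-(i * s)) ^ 2 = 5 := by linear_combination s ^ 2 * hi - hs
  have his : i * -(i * s) = s := by linear_combination -s * hi
  obtain ⟨P, ω, hP, hP1, hω⟩ := JPair.exists_base (B := 2 + -(i * s)) (y := -(2 + -(i * s)) * h ^ 2)
    (by linear_combination -(2 + -(i * s)) * congrArg (· ^ 2) hh)
  obtain ⟨ε, hε, hc⟩ := JPair.exists_sign_congr (by omega) huv hr hi hP hP1 (by rwa [his])
  rw [his] at hc
  set y := -(2 + -(i * s)) * h ^ 2 with hy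
  have hyt : y * (1 + y) = -64 * t := by
    grind
  have hmod : ∀ k, ∃ m, 4 * m + 1 = p ^ k := fun k => by
    have : p ^ k % 4 = 1 := by rw [Nat.pow_mod, h4, one_pow, Nat.mod_eq_of_lt (by norm_num)]
    exact ⟨p ^ k / 4, by omega⟩
  obtain ⟨a, ha⟩ := hmod 2
  obtain ⟨b, hb⟩ := hmod 3
  obtain ⟨m, hm⟩ := hmod 1
  have c0 := hc 0 (by norm_num)
  have c1 := hc 1 (by norm_num)
  have c2 := hc 2 (by norm_num)
  rw [← hb, ← ha, Nat.add_sub_cancel, Nat.add_sub_cancel, hω, hω] at c2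
  rw [← ha, ← hm, Nat.add_sub_cancel, Nat.add_sub_cancel, hω, hω] at c1
  rw [← hm, pow_zero, Nat.add_sub_cancel, show 1 - 1 = 4 * 0 by rfl, hω, hω] at c0
  have uε : IsUnit ε := IsUnit.of_mul_eq_one ε (by rw [← sq, hε])
  set α : ℤ_[p] := u + v * s with hα
  have step : ∀ {x y : ℤ_[p]} {k : ℕ}, (p : ℤ_[p]) ^ (k + 1) ∣ x - ε * α * y → IsUnit y →
      IsUnit x := by
    intro x y k hd hy
    obtain ⟨q, hq⟩ := hd
    by_contra hx
    have h1 : x ∈ IsLocalRing.maximalIdeal ℤ_[p] := hx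
    have h2 : (p : ℤ_[p]) ^ (k + 1) * q ∈ IsLocalRing.maximalIdeal ℤ_[p] := by
      rw [PadicInt.maximalIdeal_eq_span_p, pow_succ', mul_assoc]
      exact Ideal.mul_mem_right _ _ (Ideal.mem_span_singleton_self _)
    have h3 := sub_mem h1 h2
    rw [← hq, sub_sub_cancel] at h3
    exact h3 ((uε.mul hunit).mul hy)
  have v0 : IsUnit (shiftedLegendreEval y 0) := by
    simp [shiftedLegendreEval, legendreCoeff_zero]
  have va := step c1 (step c0 v0)
  have ht0 : IsUnit t := by rw [hth]; exact (uh.pow 10).neg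
  have hblt : b < p * p ^ 2 := by rw [mul_comm, ← pow_succ, ← hb]; omega
  have lift := sum_lift_congr (M := p ^ 2)
    (A := fun k => (-64) ^ k * (legendreCoeff b k * (2 * k).choose k : ℕ))
    (α := fun k => (-64) ^ k * (legendreCoeff a k * (2 * k).choose k : ℕ)) hh
    (fun m _ r hr => legendreTerm_lift_congr (by omega) h4 hf ha hb m r hr)
    (PadicInt.dvd_pow_sub_one ht0) hl h1 h2
  rw [← shiftedLegendreEval_sq_eq b hblt hyt,
    ← shiftedLegendreEval_sq_eq a (by omega) hyt] at lift
  have hsum : (p : ℤ_[p]) ^ 3 ∣ (∑ k ∈ range p,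
      ((Nat.choose (4 * k) k * Nat.choose (3 * k) k * Nat.choose (2 * k) k : ℤ_[p]) * t ^ k)) -
        ∑ r ∈ range p, f0 r * t ^ r := by
    rw [← sum_sub_distrib]
    refine dvd_sum fun r hr => ?_
    have := hf r (mem_range.1 hr) ℤ_[p] CubeNil.unitsPerturb_padicInt 0
    rw [mul_zero, hypTerm_zero_zero (mem_range.1 hr)] at this
    rw [← sub_mul]
    refine Dvd.dvd.mul_right ?_ _
    convert this using 1
    simp
  obtain ⟨w, hw⟩ := c2
  have key : (p : ℤ_[p]) ^ 3 ∣ ((∑ r ∈ range p, f0 r * t ^ r) - α ^ 2) *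
      shiftedLegendreEval y a ^ 2 := by
    refine (dvd_sub (Dvd.intro (w * (shiftedLegendreEval y b + ε * α * shiftedLegendreEval y a))
      rfl) lift).trans (dvd_of_eq ?_)
    linear_combination -(shiftedLegendreEval y b + ε * α * shiftedLegendreEval y a) * hw -
      α ^ 2 * shiftedLegendreEval y a ^ 2 * hε
  have := dvd_add hsum ((va.pow 2).dvd_mul_right.1 key)
  rwa [sub_add_sub_cancel] at this
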